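/- Let phi be a subharmonic function on the open unit disk D, not identically -infinity, which has a harmonic majorant h satisfying sup over 0 < r < 1 of the integral from 0 to 2pi of |h(r e^{i theta})|^p d theta < infinity for some p > 1 (so that phi has radial boundary values phi*(e^{i theta}) almost everywhere on the unit circle). Then for any holomorphic map f : D -> D with f(0) = 0, the composition phi o f has radial boundary values almost everywhere and (1/2pi) times the integral from 0 to 2pi of (phi o f)*(e^{i theta}) d theta is at most (1/2pi) times the integral from 0 to 2pi of phi*(e^{i theta}) d theta. -/

import Mathlib

open MeasureTheory Metric Filter Topology Set Complex
open scoped ENNReal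

noncomputable section

/-- `ℂⁿ`. -/
abbrev En (n : ℕ) : Type := EuclideanSpace ℂ (Fin n)

instance (n : ℕ) : MeasurableSpace (En n) := borel _

instance (n : ℕ) : BorelSpace (En n) := ⟨rfl⟩

open Classical in
/-- The positive part of an extended real number, as an element of `ℝ≥0∞`. -/
def epos (x : EReal) : ℝ≥0∞ := if x = ⊤ then ⊤ else ENNReal.ofReal x.toReal

/-- The integral of an `EReal`-valued function `u` against a measure `μ`, defined as the
difference of the lower integrals of the positive and negative parts of `u`. -/
def eint {α : Type*} [MeasurableSpace α] (μ : Measure α) (u : α → EReal) : EReal :=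
  ((∫⁻ x, epos (u x) ∂μ : ℝ≥0∞) : EReal) - ((∫⁻ x, epos (-(u x)) ∂μ : ℝ≥0∞) : EReal)

/-- The normalized angular measure `(2π)⁻¹ dθ` on `[0, 2π)`. -/
def thetaM : Measure ℝ :=
  (ENNReal.ofReal ((2 * Real.pi)⁻¹)) • (volume.restrict (Set.Ico (0 : ℝ) (2 * Real.pi)))

/-- A function `u` with values in `[-∞, ∞)` is plurisubharmonic on an open set `U ⊆ ℂⁿ`:
it is upper semicontinuous, `< ⊤`, and satisfies the sub-mean-value inequality on every
complex line. -/
def PshOnE {n : ℕ} (u : En n → EReal) (U : Set (En n)) : Prop :=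
  UpperSemicontinuousOn u U ∧ (∀ z ∈ U, u z < ⊤) ∧
  ∀ z ∈ U, ∀ w : En n, ∀ r : ℝ, 0 < r →
    (∀ ζ : ℂ, ‖ζ‖ ≤ r → z + ζ • w ∈ U) →
    u z ≤ eint thetaM (fun θ => u (z + (circleMap 0 r θ) • w))

/-- `μ` is a Jensen measure on `X` with barycenter `z`:  a Borel probability measure
supported on `X` such that `u z ≤ ∫ u dμ` for every function `u` continuous and
plurisubharmonic on some open neighborhood of `X`. -/
def IsJensen {n : ℕ} (X : Set (En n)) (z : En n) (μ : Measure (En n)) : Prop :=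
  IsProbabilityMeasure μ ∧ μ Xᶜ = 0 ∧
  ∀ U : Set (En n), IsOpen U → X ⊆ U →
    ∀ u : En n → EReal, ContinuousOn u U → PshOnE u U → u z ≤ eint μ u

/-- `u : X → [-∞, ∞)` is plurisubharmonic on the compact set `X` : it is upper
semicontinuous on `X`, `< ⊤` on `X`, and satisfies the subaveraging inequality with respect
to all Jensen measures on `X`. -/
def PSHe {n : ℕ} (X : Set (En n)) (u : En n → EReal) : Prop :=
  UpperSemicontinuousOn u X ∧ (∀ z ∈ X, u z < ⊤) ∧
  ∀ z ∈ X, ∀ μ : Measure (En n), IsJensen X z μ → u z ≤ eint μ u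

/-- `PSH^c(X)`: continuous plurisubharmonic functions on `X`. -/
def PSHce {n : ℕ} (X : Set (En n)) (u : En n → EReal) : Prop :=
  PSHe X u ∧ ContinuousOn u X

/-- Real-valued continuous plurisubharmonic functions on `X`. -/
def PSHcR {n : ℕ} (X : Set (En n)) (u : En n → ℝ) : Prop :=
  ContinuousOn u X ∧ PSHe X (fun x => (u x : EReal))

/-- `O_X`: the set of points `z ∈ X` whose only Jensen measure is `δ_z`. -/
def Oset {n : ℕ} (X : Set (En n)) : Set (En n) :=
  {z | z ∈ X ∧ ∀ μ : Measure (En n), IsJensen X z μ → μ = Measure.dirac z}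

/-- The potential boundary `B_X`, the closure of `O_X`. -/
def Bset {n : ℕ} (X : Set (En n)) : Set (En n) := closure (Oset X)

/-- `J^b_z(X)`: Jensen measures with barycenter `z` supported on `B_X`. -/
def IsJensenB {n : ℕ} (X : Set (En n)) (z : En n) (μ : Measure (En n)) : Prop :=
  IsJensen X z μ ∧ μ (Bset X)ᶜ = 0

/-- `ν` is subordinated to `μ` : `μ(u) ≥ ν(u)` for all `u ∈ PSH^c(X)`. -/
def Subord {n : ℕ} (X : Set (En n)) (μ ν : Measure (En n)) : Prop :=
  ∀ u : En n → EReal, PSHce X u → eint ν u ≤ eint μ u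

/-- Subharmonic functions with values in `[-∞, ∞)` on an open set `U ⊆ ℂ`. -/
def SubharmOn (u : ℂ → EReal) (U : Set ℂ) : Prop :=
  UpperSemicontinuousOn u U ∧ (∀ z ∈ U, u z < ⊤) ∧
  ∀ z ∈ U, ∀ r : ℝ, 0 < r → closedBall z r ⊆ U →
    u z ≤ eint thetaM (fun θ => u (circleMap z r θ))

/-- Harmonic (real-valued) functions on an open set `U ⊆ ℂ`: continuous functions
satisfying the mean-value equality. -/
def HarmOn (h : ℂ → ℝ) (U : Set ℂ) : Prop :=
  ContinuousOn h U ∧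
  ∀ z ∈ U, ∀ r : ℝ, 0 < r → closedBall z r ⊆ U →
    h z = (2 * Real.pi)⁻¹ * ∫ θ in (0 : ℝ)..(2 * Real.pi), h (circleMap z r θ)

/-- Superharmonic (real-valued) functions on an open set `U ⊆ ℂ`. -/
def SuperharmOn (v : ℂ → ℝ) (U : Set ℂ) : Prop :=
  LowerSemicontinuousOn v U ∧
  ∀ z ∈ U, ∀ r : ℝ, 0 < r → closedBall z r ⊆ U →
    (2 * Real.pi)⁻¹ * (∫ θ in (0 : ℝ)..(2 * Real.pi), v (circleMap z r θ)) ≤ v z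

/-- The infimum of all positive superharmonic functions on the unit disk, extending
continuously to the closed disk and `≥ 1` on `A`, evaluated at `z`. -/
def hmPre (A : Set ℂ) (z : ℂ) : ℝ :=
  sInf {t : ℝ | ∃ v : ℂ → ℝ, SuperharmOn v (ball 0 1) ∧ (∀ w ∈ ball (0 : ℂ) 1, 0 < v w) ∧
    ContinuousOn v (closedBall 0 1) ∧ (∀ w ∈ A, 1 ≤ v w) ∧ t = v z}

/-- The harmonic measure `ω(z, A, 𝔻)` of `A` with respect to the unit disk. -/
def hm (z : ℂ) (A : Set ℂ) : ℝ := Filter.liminf (fun w => hmPre A w) (𝓝 z)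

open Classical in
/-- The radial limit of a map `f` at the boundary point `ζ` of the unit circle
(junk value `0` if the radial limit does not exist). -/
def bval {n : ℕ} (f : ℂ → En n) (ζ : ℂ) : En n :=
  if h : ∃ l : En n, Tendsto (fun r : ℝ => f ((r : ℂ) * ζ)) (𝓝[<] (1 : ℝ)) (𝓝 l)
  then h.choose else 0

open Classical in
/-- The radial limit of an `EReal`-valued function on the disk at the boundary point `ζ`. -/
def bvalE (g : ℂ → EReal) (ζ : ℂ) : EReal :=
  if h : ∃ l : EReal, Tendsto (fun r : ℝ => g ((r : ℂ) * ζ)) (𝓝[<] (1 : ℝ)) (𝓝 l)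
  then h.choose else 0

/-- `μ_f`: the push-forward of the normalized arclength measure on the unit circle under the
radial boundary values of `f`. -/
def bmeas {n : ℕ} (f : ℂ → En n) : Measure (En n) :=
  thetaM.map (fun θ => bval f (circleMap 0 1 θ))

/-- Weak-* convergence of a sequence of measures on `ℂⁿ`. -/
def WeakConv {n : ℕ} (μs : ℕ → Measure (En n)) (μ : Measure (En n)) : Prop :=
  ∀ φ : BoundedContinuousFunction (En n) ℝ,
    Tendsto (fun j => ∫ x, φ x ∂(μs j)) atTop (𝓝 (∫ x, φ x ∂μ))

/-- The cluster set `cl L` of a sequence of maps of the unit disk into `ℂⁿ`. -/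
def clusterSet {n : ℕ} (f : ℕ → ℂ → En n) : Set (En n) :=
  {z | ∀ r : ℝ, 0 < r → ∀ N : ℕ, ∃ j, N ≤ j ∧ ∃ ζ ∈ ball (0 : ℂ) 1, f j ζ ∈ ball z r}

/-- A point `z` is totally essential for the sequence `f` if for every open set `V ∋ z` the
harmonic measures at `0` of `f j ⁻¹' V` stay bounded away from `0`. -/
def TotallyEssential {n : ℕ} (f : ℕ → ℂ → En n) (z : En n) : Prop :=
  ∀ V : Set (En n), IsOpen V → z ∈ V →
    0 < Filter.atTop.liminf (fun j => hm 0 ((f j ⁻¹' V) ∩ ball 0 1))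

/-- A totally perfect sequence `L` of holomorphic maps of the unit disk into `ℂⁿ`: a
uniformly bounded sequence of holomorphic maps which is weak-* converging (with limit measure
`μ_L` and center `z_L`) and all of whose cluster points are totally essential. -/
structure PerfectSeq (n : ℕ) where
  f : ℕ → ℂ → En n
  holo : ∀ j, DifferentiableOn ℂ (f j) (ball 0 1)
  bdd : ∃ C : ℝ, ∀ j, ∀ ζ ∈ ball (0 : ℂ) 1, ‖f j ζ‖ ≤ C
  μL : Measure (En n)
  conv : WeakConv (fun j => bmeas (f j)) μL
  zL : En n
  center : Tendsto (fun j => f j 0) atTop (𝓝 zL)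
  ess : ∀ z ∈ clusterSet f, TotallyEssential f z

/-- `J_z^s(L)`: the measures obtained as weak-* limits of `μ_{f_{j_k} ∘ g_k}` for subsequences
`{j_k}` and holomorphic maps `g_k : 𝔻 → 𝔻` with `f_{j_k}(g_k(0)) → z`. -/
def JsSet {n : ℕ} (L : PerfectSeq n) (z : En n) : Set (Measure (En n)) :=
  {μ | ∃ jk : ℕ → ℕ, StrictMono jk ∧ ∃ g : ℕ → ℂ → ℂ,
    (∀ k, DifferentiableOn ℂ (g k) (ball 0 1) ∧ MapsTo (g k) (ball 0 1) (ball 0 1)) ∧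
    WeakConv (fun k => bmeas ((L.f (jk k)) ∘ (g k))) μ ∧
    Tendsto (fun k => L.f (jk k) (g k 0)) atTop (𝓝 z)}

/-- `J_z(L)`: the convex hull of `J_z^s(L)`. -/
def JLSet {n : ℕ} (L : PerfectSeq n) (z : En n) : Set (Measure (En n)) :=
  {μ | ∃ (m : ℕ) (w : Fin m → ℝ) (ν : Fin m → Measure (En n)),
    (∀ i, 0 ≤ w i) ∧ (∑ i, w i = 1) ∧ (∀ i, ν i ∈ JsSet L z) ∧
    μ = ∑ i, (ENNReal.ofReal (w i)) • ν i}

/-- `u` is harmonic on the totally perfect sequence `L`. -/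
def HarmonicOnL {n : ℕ} (L : PerfectSeq n) (u : En n → EReal) : Prop :=
  PSHce (clusterSet L.f) u ∧
  ∀ z ∈ clusterSet L.f, ∀ μ ∈ JLSet L z, eint μ u = u z

/-- `PSH^w(X)`: weakly plurisubharmonic functions, the upper envelopes of nonempty families
of continuous plurisubharmonic functions on `X`. -/
def PSHw {n : ℕ} (X : Set (En n)) (u : En n → EReal) : Prop :=
  ∃ F : Set (En n → EReal), F.Nonempty ∧ (∀ v ∈ F, PSHce X v) ∧
    ∀ x ∈ X, u x = ⨆ v ∈ F, v x

/-- `u` is maximal on `X ∖ Z`: for every relatively open `V ⊆ X ∖ Z` and every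
`v ∈ PSH^c(closure V)`, if `v ≤ u` on the relative boundary of `V` in `X` then `v ≤ u`
on `closure V`. -/
def MaximalOn {n : ℕ} (X Z : Set (En n)) (u : En n → EReal) : Prop :=
  ∀ W : Set (En n), IsOpen W → X ∩ W ⊆ X \ Z →
    ∀ v : En n → EReal, PSHce (closure (X ∩ W)) v →
      (∀ x ∈ closure (X ∩ W) \ (X ∩ W), v x ≤ u x) →
      ∀ x ∈ closure (X ∩ W), v x ≤ u x

/-- Pluriharmonic continuous real-valued functions on `X`. -/
def Pluriharm {n : ℕ} (X : Set (En n)) (h : En n → ℝ) : Prop :=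
  ContinuousOn h X ∧
  ∀ z ∈ X, ∀ μ : Measure (En n), IsJensen X z μ → (h z : EReal) = eint μ (fun x => (h x : EReal))

/-- `X` is a Poisson set: every continuous real-valued function on `B_X` extends to a
pluriharmonic function on `X`. -/
def PoissonSet {n : ℕ} (X : Set (En n)) : Prop :=
  ∀ φ : En n → ℝ, ContinuousOn φ (Bset X) →
    ∃ h : En n → ℝ, Pluriharm X h ∧ ∀ w ∈ Bset X, h w = φ w

end

/-- A nonnegative upper semicontinuous function on the unit disk satisfying the sub-mean-value
inequality. -/
structure Subh (u : ℂ → ℝ) : Prop where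
  nonneg : ∀ z ∈ ball (0 : ℂ) 1, 0 ≤ u z
  usc : UpperSemicontinuousOn u (ball 0 1)
  sub : ∀ z ∈ ball (0 : ℂ) 1, ∀ r : ℝ, 0 < r → closedBall z r ⊆ ball 0 1 →
    u z ≤ Real.circleAverage u z r

lemma usc_comp_circleMap {u : ℂ → ℝ} {c : ℂ} {r : ℝ} (hr : 0 ≤ r)
    (hu : UpperSemicontinuousOn u (sphere c r)) :
    UpperSemicontinuous (fun θ => u (circleMap c r θ)) := by
  have := hu.comp (g := circleMap c r) (t := univ) (continuous_circleMap c r).continuousOn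
    (fun θ _ => circleMap_mem_sphere c hr θ)
  exact upperSemicontinuousOn_univ_iff.mp this

lemma usc_bdd_on_sphere {u : ℂ → ℝ} {c : ℂ} {r : ℝ} 
    (hu : UpperSemicontinuousOn u (sphere c r)) : ∃ C, 0 ≤ C ∧ ∀ z ∈ sphere c r, u z ≤ C := by
  obtain ⟨C, hC⟩ := hu.bddAbove_of_isCompact (isCompact_sphere c r)
  exact ⟨max C 0, le_max_right _ _, fun z hz => (hC ⟨z, hz, rfl⟩).trans (le_max_left _ _)⟩

lemma circleIntegrable_of_bdd {u : ℂ → ℝ} {c : ℂ} {r C : ℝ}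
    (hm : Measurable (fun θ => u (circleMap c r θ))) (hC : ∀ θ, |u (circleMap c r θ)| ≤ C) :
    CircleIntegrable u c r := by
  rw [CircleIntegrable, intervalIntegrable_iff]
  exact Measure.integrableOn_of_bounded (M := C) (measure_Ioc_lt_top).ne hm.aestronglyMeasurable
    (Eventually.of_forall hC)

lemma usc_circleIntegrable {u : ℂ → ℝ} {c : ℂ} {r : ℝ} (hr : 0 ≤ r)
    (hu : UpperSemicontinuousOn u (sphere c r)) (h0 : ∀ z ∈ sphere c r, 0 ≤ u z) :
    CircleIntegrable u c r := by
  obtain ⟨C, -, hC⟩ := usc_bdd_on_sphere hu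
  refine circleIntegrable_of_bdd (C := C) (usc_comp_circleMap hr hu).measurable fun θ => ?_
  have := circleMap_mem_sphere c hr θ
  rw [abs_of_nonneg (h0 _ this)]
  exact hC _ this

/-- Upper semicontinuous functions on a compact set are limits of continuous majorants. -/
lemma usc_exists_continuous {u : ℂ → ℝ} {S : Set ℂ} (hS : IsCompact S)
    (hu : UpperSemicontinuousOn u S) (h0 : ∀ z ∈ S, 0 ≤ u z) :
    ∃ (C : ℝ) (c : ℕ → ℂ → ℝ), (∀ n, Continuous (c n)) ∧ (∀ n, ∀ z ∈ S, u z ≤ c n z) ∧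
      (∀ n, ∀ z ∈ S, c n z ≤ C) ∧ ∀ z ∈ S, Tendsto (fun n => c n z) atTop (𝓝 (u z)) := by
  rcases S.eq_empty_or_nonempty with rfl | hne
  · exact ⟨0, fun _ _ => 0, fun _ => continuous_const, by simp, by simp, by simp⟩
  obtain ⟨C, hC⟩ := hu.bddAbove_of_isCompact hS
  have hC' : ∀ z ∈ S, u z ≤ C := fun z hz => hC ⟨z, hz, rfl⟩
  have : Nonempty S := hne.to_subtype
  have hbd : ∀ (n : ℕ) (x : ℂ), BddAbove (range fun y : S => u y - n * dist x y) := by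
    intro n x
    refine ⟨C, ?_⟩
    rintro _ ⟨y, rfl⟩
    have := hC' y y.2
    have : 0 ≤ n * dist x y := by positivity
    simp only
    linarith
  refine ⟨C, fun n x => ⨆ y : S, (u y - n * dist x y), ?_, ?_, ?_, ?_⟩
  · intro n
    refine (LipschitzWith.of_le_add_mul n (fun x x' => ?_)).continuous
    refine ciSup_le fun y => ?_
    have h1 := le_ciSup (hbd n x') y
    have h2 : dist x' y ≤ dist x x' + dist x y := by
      rw [dist_comm x x']; exact dist_triangle _ _ _
    have h3 : (n : ℝ) * dist x' y ≤ n * (dist x x' + dist x y) := by gcongr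
    simp only [NNReal.coe_natCast] at *
    linarith
  · intro n z hz
    have := le_ciSup (hbd n z) ⟨z, hz⟩
    simpa using this
  · intro n z hz
    refine ciSup_le fun y => ?_
    have := hC' y y.2
    have : 0 ≤ n * dist z y := by positivity
    linarith
  · intro z hz
    rw [Metric.tendsto_atTop]
    intro ε hε
    have h1 := hu z hz (u z + ε / 2) (by linarith)
    rw [eventually_nhdsWithin_iff, Metric.eventually_nhds_iff] at h1
    obtain ⟨δ, hδ, h1⟩ := h1
    obtain ⟨N, hN⟩ := exists_nat_gt (C / δ)
    refine ⟨N, fun n hn => ?_⟩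
    have hge := le_ciSup (hbd n z) ⟨z, hz⟩
    have hle : (⨆ y : S, (u y - n * dist z y)) ≤ u z + ε / 2 := by
      refine ciSup_le fun y => ?_
      rcases lt_or_ge (dist (y : ℂ) z) δ with h | h
      · have := h1 h y.2
        have h' : 0 ≤ n * dist z y := by positivity
        linarith
      · have h3 : C ≤ n * dist z y := by
          rw [dist_comm] at h
          calc C = C / δ * δ := by field_simp
            _ ≤ n * dist z y := by
              have : C / δ ≤ n := hN.le.trans (by exact_mod_cast hn)
              gcongr
        have := hC' y y.2
        have := h0 z hz
        linarith
    simp only [dist_self, mul_zero, sub_zero] at hge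
    rw [Real.dist_eq, abs_lt]
    constructor <;> linarith

lemma exists_entire_approx (g : C(AddCircle (2 * Real.pi), ℂ)) {ε : ℝ} (hε : 0 < ε)
    (c : ℂ) {r : ℝ} (hr : 0 < r) :
    ∃ F : ℂ → ℂ, Differentiable ℂ F ∧ ∀ θ : ℝ, |(g θ).re - (F (circleMap c r θ)).re| < ε := by
  have : Fact (0 < 2 * Real.pi) := ⟨by positivity⟩
  have hg : g ∈ (Submodule.span ℂ (range <| @fourier (2 * Real.pi))).topologicalClosure := by
    rw [span_fourier_closure_eq_top]; trivial
  have hspan : ∀ q ∈ Submodule.span ℂ (range <| @fourier (2 * Real.pi)), ∀ a : ℂ,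
      ∃ F : ℂ → ℂ, Differentiable ℂ F ∧
        ∀ θ : ℝ, (a * q (θ : AddCircle (2 * Real.pi))).re = (F (circleMap c r θ)).re := by
    intro q hq
    induction hq using Submodule.span_induction with
    | mem q hq =>
      obtain ⟨n, rfl⟩ := hq
      intro a
      have hz : ∀ θ : ℝ, (circleMap c r θ - c) / r = Complex.exp (θ * I) := by
        intro θ
        have : (r : ℂ) ≠ 0 := by exact_mod_cast hr.ne'
        simp [circleMap, this]
      rcases Int.eq_nat_or_neg n with ⟨m, rfl | rfl⟩
      · refine ⟨fun z => a * ((z - c) / r) ^ m, by fun_prop, fun θ => ?_⟩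
        beta_reduce
        rw [hz, fourier_coe_apply, ← Complex.exp_nat_mul]
        congr 3
        have : (Real.pi : ℂ) ≠ 0 := by exact_mod_cast Real.pi_ne_zero
        push_cast
        field_simp
      · refine ⟨fun z => (starRingEnd ℂ a) * ((z - c) / r) ^ m, by fun_prop, fun θ => ?_⟩
        beta_reduce
        rw [hz, fourier_coe_apply, ← Complex.exp_nat_mul, ← Complex.conj_re, map_mul,
          ← Complex.exp_conj]
        congr 3
        have : (Real.pi : ℂ) ≠ 0 := by exact_mod_cast Real.pi_ne_zero
        simp
        field_simp
    | zero => exact fun a => ⟨0, differentiable_const 0, by simp⟩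
    | add x y _ _ hx hy =>
      intro a
      obtain ⟨F, hF, hFx⟩ := hx a
      obtain ⟨G, hG, hGy⟩ := hy a
      refine ⟨F + G, hF.add hG, fun θ => ?_⟩
      simp [mul_add, ← hFx, ← hGy]
    | smul b x _ hx =>
      intro a
      obtain ⟨F, hF, hFx⟩ := hx (a * b)
      refine ⟨F, hF, fun θ => ?_⟩
      rw [← hFx, ContinuousMap.smul_apply, smul_eq_mul, mul_assoc]
  obtain ⟨q, hq, hqg⟩ := Metric.mem_closure_iff.mp hg ε hε
  obtain ⟨F, hF, hFq⟩ := hspan q hq 1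
  refine ⟨F, hF, fun θ => ?_⟩
  rw [← hFq θ, one_mul, ← Complex.sub_re]
  refine (Complex.abs_re_le_norm _).trans_lt ?_
  rw [← dist_eq_norm]
  exact (ContinuousMap.dist_apply_le_dist _).trans_lt hqg

lemma exists_entire_majorant {u : ℂ → ℝ} {c : ℂ} {r : ℝ} (hr : 0 < r)
    (hu : UpperSemicontinuousOn u (sphere c r)) (h0 : ∀ z ∈ sphere c r, 0 ≤ u z)
    {ε : ℝ} (hε : 0 < ε) :
    ∃ F : ℂ → ℂ, Differentiable ℂ F ∧ (∀ z ∈ sphere c r, u z ≤ (F z).re) ∧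
      Real.circleAverage (fun z => (F z).re) c r ≤ Real.circleAverage u c r + ε := by
  obtain ⟨C, v, hv, huv, hvC, hlim⟩ := usc_exists_continuous (isCompact_sphere c r) hu h0
  have hmem := fun θ => circleMap_mem_sphere c hr.le θ
  have hci : ∀ n, CircleIntegrable (v n) c r := fun n =>
    (hv n).continuousOn.circleIntegrable'
  have h1 : Tendsto (fun n => Real.circleAverage (v n) c r) atTop
      (𝓝 (Real.circleAverage u c r)) := by
    simp only [Real.circleAverage_def]
    refine Tendsto.const_smul ?_ _
    refine intervalIntegral.tendsto_integral_filter_of_dominated_convergence (fun _ => C)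
      (Eventually.of_forall fun n => ?_) (Eventually.of_forall fun n => ?_) (by simp) ?_
    · exact ((hv n).comp (continuous_circleMap c r)).aestronglyMeasurable
    · refine Eventually.of_forall fun θ _ => ?_
      rw [Real.norm_of_nonneg ((h0 _ (hmem θ)).trans (huv n _ (hmem θ)))]
      exact hvC n _ (hmem θ)
    · exact Eventually.of_forall fun θ _ => hlim _ (hmem θ)
  obtain ⟨n, hn⟩ := (h1.eventually_lt_const
    (show Real.circleAverage u c r < Real.circleAverage u c r + ε / 3 by linarith)).exists
  have hper : Function.Periodic (fun θ => ((v n (circleMap c r θ) : ℝ) : ℂ)) (2 * Real.pi) := by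
    intro θ
    simp only [periodic_circleMap c r θ]
  let g : C(AddCircle (2 * Real.pi), ℂ) := ⟨hper.lift, by
    apply continuous_coinduced_dom.mpr
    exact continuous_ofReal.comp ((hv n).comp (continuous_circleMap c r))⟩
  have hg : ∀ θ : ℝ, g θ = v n (circleMap c r θ) := fun θ => rfl
  obtain ⟨F, hF, hFg⟩ := exists_entire_approx g (ε := ε / 3) (by positivity) c hr
  have hFc : Continuous F := hF.continuous
  refine ⟨fun z => F z + (ε / 3 : ℝ), by fun_prop, fun z hz => ?_, ?_⟩
  · obtain ⟨θ, rfl⟩ : ∃ θ, circleMap c r θ = z := by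
      rw [← abs_of_pos hr, ← range_circleMap] at hz
      exact hz
    have := (abs_lt.mp (hFg θ)).2
    rw [hg, ofReal_re] at this
    have := huv n _ hz
    simp only [add_re, ofReal_re]
    linarith
  · have : Real.circleAverage (fun z => (F z + (ε / 3 : ℝ)).re) c r ≤
        Real.circleAverage (fun z => v n z + 2 * (ε / 3)) c r := by
      refine Real.circleAverage_mono ?_ ?_ ?_
      · exact Continuous.continuousOn (by fun_prop) |>.circleIntegrable'
      · exact Continuous.continuousOn (by fun_prop) |>.circleIntegrable'
      · intro z hz
        obtain ⟨θ, rfl⟩ : ∃ θ, circleMap c r θ = z := by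
          rw [← range_circleMap] at hz
          exact hz
        have := (abs_lt.mp (hFg θ)).1
        rw [hg, ofReal_re] at this
        simp only [add_re, ofReal_re]
        linarith
    refine this.trans ?_
    rw [Real.circleAverage_fun_add (hci n) (circleIntegrable_const _ _ _),
      Real.circleAverage_const]
    linarith

/-- Nonconstant holomorphic functions are locally conjugate to a power. -/
lemma exists_local_pow_form {f : ℂ → ℂ} {b : ℂ} (hf : AnalyticAt ℂ f b)
    (hnc : ¬ ∀ᶠ z in 𝓝 b, f z - f b = 0) :
    ∃ (n : ℕ) (g h : ℂ → ℂ), n ≠ 0 ∧ ContinuousAt g b ∧ g b = 0 ∧ AnalyticAt ℂ h 0 ∧ h 0 = b ∧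
      (∀ᶠ z in 𝓝 b, h (g z) = z) ∧ ∀ᶠ ζ in 𝓝 0, f (h ζ) = f b + ζ ^ n := by
  have hf' : AnalyticAt ℂ (fun z => f z - f b) b := hf.sub analyticAt_const
  obtain ⟨n, k, hk, hk0, hfk⟩ := hf'.exists_eventuallyEq_pow_smul_nonzero_iff.mpr hnc
  have hn : n ≠ 0 := by
    rintro rfl
    have := hfk.self_of_nhds
    simp at this
    exact hk0 this.symm
  obtain ⟨κ, hκ⟩ := IsAlgClosed.exists_pow_nat_eq (k b) (Nat.pos_of_ne_zero hn)
  have hκ0 : κ ≠ 0 := by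
    rintro rfl
    rw [zero_pow hn] at hκ
    exact hk0 hκ.symm
  have hn' : (n : ℂ) ≠ 0 := by exact_mod_cast hn
  set e : ℂ → ℂ := fun z => κ * Complex.exp (Complex.log (k z / k b) / n) with he
  have hlog : AnalyticAt ℂ (fun z => Complex.log (k z / k b)) b := by
    refine AnalyticAt.clog (hk.div analyticAt_const hk0) ?_
    rw [div_self hk0]
    exact one_mem_slitPlane
  have hea : AnalyticAt ℂ e b := by
    refine analyticAt_const.mul (AnalyticAt.cexp ?_)
    exact hlog.div analyticAt_const hn'
  have heb : e b = κ := by simp [he, hk0]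
  set g : ℂ → ℂ := fun z => (z - b) * e z with hg
  have hga : AnalyticAt ℂ g b := (analyticAt_id.sub analyticAt_const).mul hea
  have hgb : g b = 0 := by simp [hg]
  have hg' : deriv g b = κ := by
    have h1 : HasDerivAt (fun z : ℂ => z - b) 1 b := (hasDerivAt_id b).sub_const b
    have := (h1.mul hea.differentiableAt.hasDerivAt).deriv
    rw [heb] at this
    rw [show g = (fun z : ℂ => z - b) * e from rfl, this]
    simp
  have hg'0 : deriv g b ≠ 0 := by rw [hg']; exact hκ0
  have hgpow : ∀ᶠ z in 𝓝 b, f z = f b + g z ^ n := by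
    filter_upwards [hfk, hk.continuousAt.eventually_ne hk0] with z hz hkz
    rw [hg]
    simp only [he, mul_pow, hκ, ← Complex.exp_nat_mul]
    rw [mul_div_cancel₀ _ hn', Complex.exp_log (div_ne_zero hkz hk0), mul_div_cancel₀ _ hk0,
      ← smul_eq_mul, ← hz]
    ring
  refine ⟨n, g, hga.hasStrictDerivAt.localInverse _ _ _ hg'0, hn, hga.continuousAt, hgb, ?_, ?_,
    hga.hasStrictDerivAt.eventually_left_inverse hg'0, ?_⟩
  · rw [← hgb]
    exact hga.analyticAt_localInverse hg'0
  · rw [← hgb]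
    exact HasStrictFDerivAt.localInverse_apply_image ..
  · have hc := (hga.analyticAt_localInverse hg'0).continuousAt
    have hb : hga.hasStrictDerivAt.localInverse _ _ _ hg'0 (g b) = b :=
      HasStrictFDerivAt.localInverse_apply_image ..
    have h1 := hga.hasStrictDerivAt.eventually_right_inverse hg'0
    have h2 : ∀ᶠ ζ in 𝓝 (g b), f (hga.hasStrictDerivAt.localInverse _ _ _ hg'0 ζ) =
        f b + g (hga.hasStrictDerivAt.localInverse _ _ _ hg'0 ζ) ^ n := by
      have : Tendsto (hga.hasStrictDerivAt.localInverse _ _ _ hg'0) (𝓝 (g b)) (𝓝 b) := by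
        have := hc.tendsto
        rwa [hb] at this
      exact this.eventually hgpow
    rw [hgb] at h1 h2
    filter_upwards [h1, h2] with ζ h1 h2
    rw [h2, h1]

lemma le_of_forall_max {K : Set ℂ} (hK : IsCompact K) {w : ℂ → ℝ}
    (hw : UpperSemicontinuousOn w K) {m : ℝ}
    (H : ∀ z ∈ K, m < w z → (∀ x ∈ K, w x ≤ w z) → ∃ x ∈ K, ‖z‖ < ‖x‖ ∧ w z ≤ w x) :
    ∀ x ∈ K, w x ≤ m := by
  intro x hx
  by_contra! hlt
  obtain ⟨z, hz, hmax⟩ := hw.exists_isMaxOn ⟨x, hx⟩ hK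
  have hS := hw.isCompact_inter_preimage_Ici hK (w z)
  obtain ⟨y, hy, hymax⟩ := hS.exists_isMaxOn ⟨z, hz, le_refl (w z)⟩ continuous_norm.continuousOn
  have hwy : w z ≤ w y := hy.2
  have hzy : w y ≤ w z := hmax hy.1
  have hxz : w x ≤ w z := hmax hx
  obtain ⟨t, ht, hyt, hwt⟩ := H y hy.1 (by linarith)
    (fun x hx => (hmax hx : w x ≤ w z).trans hwy)
  have : ‖t‖ ≤ ‖y‖ := hymax ⟨ht, hwy.trans hwt⟩
  linarith

lemma exists_eq_of_le_circleAverage {w : ℂ → ℝ} {c : ℂ} {r M : ℝ}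
    (hi : CircleIntegrable w c r) (hle : ∀ z ∈ sphere c |r|, w z ≤ M)
    (hM : M ≤ Real.circleAverage w c r) {O : Set ℂ} (hO : IsOpen O)
    (hne : (O ∩ sphere c |r|).Nonempty) : ∃ z ∈ O ∩ sphere c |r|, w z = M := by
  obtain ⟨z1, hz1, hs⟩ := hne
  rw [← range_circleMap] at hs
  obtain ⟨θ1, rfl⟩ := hs
  have hmem := fun θ => circleMap_mem_sphere' c r θ
  by_contra! hcon
  have hper : (fun θ => w (circleMap c r θ)).Periodic (2 * Real.pi) :=
    fun x => by simp [periodic_circleMap c r x]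
  have hi' : IntervalIntegrable (fun θ => w (circleMap c r θ)) volume (θ1 - Real.pi)
      (θ1 - Real.pi + 2 * Real.pi) := by
    exact hper.intervalIntegrable₀ Real.two_pi_pos.ne' hi _ _
  have hpi := Real.pi_pos
  have hlt : ∫ θ in (θ1 - Real.pi)..(θ1 - Real.pi + 2 * Real.pi), w (circleMap c r θ) <
      ∫ θ in (θ1 - Real.pi)..(θ1 - Real.pi + 2 * Real.pi), M := by
    refine intervalIntegral.integral_lt_integral_of_ae_le_of_measure_setOfPred_lt_ne_zero
      (by linarith) hi' (by simp) (Eventually.of_forall fun θ => hle _ (hmem θ)) ?_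
    have hOp : IsOpen ((circleMap c r) ⁻¹' O ∩ Ioo (θ1 - Real.pi) (θ1 - Real.pi + 2 * Real.pi)) :=
      (hO.preimage (continuous_circleMap c r)).inter isOpen_Ioo
    have hpos := hOp.measure_pos volume ⟨θ1, hz1, by constructor <;> linarith⟩
    refine (hpos.trans_le ?_).ne'
    rw [Measure.restrict_apply' measurableSet_Ioc]
    refine measure_mono fun θ hθ => ⟨?_, Ioo_subset_Ioc_self hθ.2⟩
    exact lt_of_le_of_ne (hle _ (hmem θ)) (hcon _ ⟨hθ.1, hmem θ⟩)
  have heq := hper.intervalIntegral_add_eq 0 (θ1 - Real.pi)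
  rw [← heq, zero_add, intervalIntegral.integral_const] at hlt
  rw [Real.circleAverage_def, smul_eq_mul] at hM
  have h2 : 0 < (2 * Real.pi)⁻¹ := by positivity
  have h3 := mul_lt_mul_of_pos_left hlt h2
  have : (2 * Real.pi)⁻¹ * ((θ1 - Real.pi + 2 * Real.pi - (θ1 - Real.pi)) • M) = M := by
    rw [smul_eq_mul]
    field_simp
    ring
  linarith

lemma circleAverage_comp_pow {u : ℂ → ℝ} {c : ℂ} {ε : ℝ} {n : ℕ} (hn : n ≠ 0)
    (hi : CircleIntegrable u c (ε ^ n)) :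
    CircleIntegrable (fun ζ => u (c + ζ ^ n)) 0 ε ∧
    Real.circleAverage (fun ζ => u (c + ζ ^ n)) 0 ε = Real.circleAverage u c (ε ^ n) := by
  have hper : (fun θ => u (circleMap c (ε ^ n) θ)).Periodic (2 * Real.pi) :=
    fun x => by simp [periodic_circleMap c (ε ^ n) x]
  have hn' : (n : ℝ) ≠ 0 := by exact_mod_cast hn
  have h1 : ∀ θ : ℝ, u (c + (circleMap 0 ε θ) ^ n) = u (circleMap c (ε ^ n) (n * θ)) := by
    intro θ
    congr 1
    simp only [circleMap, zero_add, mul_pow, ← Complex.exp_nat_mul]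
    push_cast
    ring_nf
  have hint : ∀ t₁ t₂, IntervalIntegrable (fun θ => u (circleMap c (ε ^ n) θ)) volume t₁ t₂ :=
    hper.intervalIntegrable₀ Real.two_pi_pos.ne' hi
  constructor
  · unfold CircleIntegrable
    simp only [h1]
    have := (hint (n * 0) (n * (2 * Real.pi))).comp_mul_left (c := (n : ℝ))
    simpa [hn'] using this
  · rw [Real.circleAverage_def, Real.circleAverage_def]
    simp only [h1]
    rw [intervalIntegral.integral_comp_mul_left (fun θ => u (circleMap c (ε ^ n) θ)) hn']
    have h2 := hper.intervalIntegral_add_zsmul_eq n 0 hint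
    simp only [zero_add, natCast_zsmul, nsmul_eq_mul] at h2
    rw [mul_zero, h2, smul_eq_mul, smul_eq_mul, smul_eq_mul, inv_mul_cancel_left₀ hn']

lemma circleAverage_re_eq {G : ℂ → ℂ} {c : ℂ} {r : ℝ} (hr : 0 ≤ r)
    (hG : AnalyticOnNhd ℂ G (closedBall c r)) :
    Real.circleAverage (fun z => (G z).re) c r = (G c).re := by
  have hG' : AnalyticOnNhd ℂ G (closedBall c |r|) := by rwa [abs_of_nonneg hr]
  exact InnerProductSpace.HarmonicOnNhd.circleAverage_eq fun z hz => (hG' z hz).harmonicAt_re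

lemma exists_near_norm_lt (b : ℂ) {η : ℝ} (hη : 0 < η) : ∃ z : ℂ, dist z b < η ∧ ‖b‖ < ‖z‖ := by
  refine ⟨((‖b‖ + η / 2 : ℝ) : ℂ) * Complex.exp (b.arg * I), ?_, ?_⟩
  · have : ((‖b‖ + η / 2 : ℝ) : ℂ) * Complex.exp (b.arg * I) - b =
        (η / 2 : ℝ) * Complex.exp (b.arg * I) := by
      nth_rewrite 3 [← Complex.norm_mul_exp_arg_mul_I b]
      push_cast
      ring
    rw [dist_eq_norm, this, norm_mul, Complex.norm_exp_ofReal_mul_I, Complex.norm_real,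
      Real.norm_of_nonneg (by positivity)]
    linarith
  · rw [norm_mul, Complex.norm_exp_ofReal_mul_I, Complex.norm_real,
      Real.norm_of_nonneg (by positivity)]
    linarith

lemma Subh.comp_le {u : ℂ → ℝ} (hu : Subh u) {f : ℂ → ℂ} (hf : DifferentiableOn ℂ f (ball 0 1))
    (hmap : MapsTo f (ball 0 1) (ball 0 1)) (hnc : ¬ ∃ c, ∀ z ∈ ball (0 : ℂ) 1, f z = c)
    {a : ℂ} {r : ℝ} (hsub : closedBall a r ⊆ ball 0 1) {F : ℂ → ℂ}
    (hF : Differentiable ℂ F) (hle : ∀ z ∈ sphere a r, u (f z) ≤ (F z).re) :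
    ∀ z ∈ closedBall a r, u (f z) ≤ (F z).re := by
  have husc : UpperSemicontinuousOn (fun z => u (f z) - (F z).re) (closedBall a r) := by
    have h1 : UpperSemicontinuousOn (fun z => u (f z)) (closedBall a r) :=
      hu.usc.comp (hf.continuousOn.mono hsub) (fun z hz => hmap (hsub hz))
    have h2 : UpperSemicontinuousOn (fun z => -(F z).re) (closedBall a r) :=
      (ContinuousOn.upperSemicontinuousOn (by
        have := hF.continuous
        fun_prop))
    simpa [sub_eq_add_neg] using h1.add h2
  suffices ∀ z ∈ closedBall a r, u (f z) - (F z).re ≤ 0 by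
    intro z hz
    linarith [this z hz]
  refine le_of_forall_max (isCompact_closedBall a r) husc ?_
  intro b hb hpos hmax
  have hbb : b ∈ ball a r := by
    rw [← closedBall_sdiff_sphere]
    refine ⟨hb, fun hs => ?_⟩
    linarith [hle b hs]
  have hfan := hf.analyticOnNhd isOpen_ball
  have hb1 := hsub hb
  have hnc' : ¬ ∀ᶠ z in 𝓝 b, f z - f b = 0 := by
    intro hev
    refine hnc ⟨f b, ?_⟩
    have := hfan.eqOn_of_preconnected_of_eventuallyEq (g := fun _ => f b)
      (fun _ _ => analyticAt_const) (convex_ball _ _).isPreconnected hb1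
      (hev.mono fun z hz => sub_eq_zero.mp hz)
    exact this
  obtain ⟨n, g, h, hn, hgc, hgb, hha, hh0, hhg, hfh⟩ := exists_local_pow_form (hfan b hb1) hnc'
  obtain ⟨η, hη, hηs⟩ := Metric.nhds_basis_closedBall.mem_iff.mp (isOpen_ball.mem_nhds (hmap hb1))
  have hev : ∀ᶠ ζ in 𝓝 (0 : ℂ), AnalyticAt ℂ h ζ ∧ f (h ζ) = f b + ζ ^ n ∧ h ζ ∈ ball a r ∧
      ‖ζ‖ ^ n < η := by
    refine hha.eventually_analyticAt.and (hfh.and (Eventually.and ?_ ?_))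
    · apply hha.continuousAt
      rw [hh0]
      exact isOpen_ball.mem_nhds hbb
    · have : ContinuousAt (fun ζ : ℂ => ‖ζ‖ ^ n) 0 := by fun_prop
      exact this.eventually_lt_const (by simpa [hn] using hη)
  obtain ⟨δ, hδ, hδs⟩ := Metric.eventually_nhds_iff.mp hev
  have hgt : ∀ᶠ z in 𝓝 b, h (g z) = z ∧ dist (g z) 0 < δ := by
    refine hhg.and ?_
    have := hgc.tendsto
    rw [hgb] at this
    exact this.eventually (ball_mem_nhds (0 : ℂ) hδ)
  obtain ⟨δ', hδ', hδs'⟩ := Metric.eventually_nhds_iff.mp hgt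
  obtain ⟨z₁, hz₁, hlt⟩ := exists_near_norm_lt b hδ'
  obtain ⟨hhz, hgδ⟩ := hδs' hz₁
  set ε := ‖g z₁‖ with hε
  rw [dist_zero_right] at hgδ
  have hεpos : 0 < ε := by
    refine norm_pos_iff.mpr fun h0 => ?_
    rw [h0, hh0] at hhz
    rw [hhz] at hlt
    exact lt_irrefl _ hlt
  have hin : ∀ ζ ∈ closedBall (0 : ℂ) ε, AnalyticAt ℂ h ζ ∧ f (h ζ) = f b + ζ ^ n ∧
      h ζ ∈ ball a r ∧ ‖ζ‖ ^ n < η := by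
    intro ζ hζ
    refine hδs (lt_of_le_of_lt hζ hgδ)
  have hsph : sphere (0 : ℂ) |ε| = sphere 0 ε := by rw [abs_of_pos hεpos]
  have hin' : ∀ ζ ∈ sphere (0 : ℂ) |ε|, ζ ∈ closedBall (0 : ℂ) ε := fun ζ hζ =>
    sphere_subset_closedBall (hsph ▸ hζ)
  have hεn : ε ^ n < η := (hin (g z₁) (by simp [hε])).2.2.2
  have hcb : closedBall (f b) (ε ^ n) ⊆ ball 0 1 := (closedBall_subset_closedBall hεn.le).trans hηs
  have hci : CircleIntegrable u (f b) (ε ^ n) := by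
    refine usc_circleIntegrable (by positivity)
      (hu.usc.mono (sphere_subset_closedBall.trans hcb)) ?_
    exact fun z hz => hu.nonneg z (hcb (sphere_subset_closedBall hz))
  obtain ⟨hci1, hca1⟩ := circleAverage_comp_pow hn hci
  have hci2 : CircleIntegrable (fun ζ => u (f (h ζ))) 0 ε := by
    refine (circleIntegrable_congr fun ζ hζ => ?_).mp hci1
    simp only [(hin ζ (hin' ζ hζ)).2.1]
  have hGan : AnalyticOnNhd ℂ (fun ζ => F (h ζ)) (closedBall 0 ε) := fun ζ hζ =>
    (hF.analyticAt _).comp (hin ζ hζ).1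
  have hci3 : CircleIntegrable (fun ζ => (F (h ζ)).re) 0 ε := by
    refine ContinuousOn.circleIntegrable hεpos.le ?_
    exact Complex.continuous_re.comp_continuousOn
      (hGan.continuousOn.mono sphere_subset_closedBall)
  have hM : u (f b) - (F b).re ≤
      Real.circleAverage (fun ζ => u (f (h ζ)) - (F (h ζ)).re) 0 ε := by
    rw [Real.circleAverage_fun_sub hci2 hci3, circleAverage_re_eq hεpos.le hGan, hh0,
      Real.circleAverage_congr_sphere (f₂ := fun ζ => u (f b + ζ ^ n)), hca1]
    · have := hu.sub (f b) (hmap hb1) (ε ^ n) (by positivity) hcb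
      linarith
    · intro ζ hζ
      simp only [(hin ζ (hin' ζ hζ)).2.1]
  have hO : IsOpen (ball (0 : ℂ) δ ∩ (fun ζ => ‖h ζ‖) ⁻¹' Ioi ‖b‖) := by
    refine ContinuousOn.isOpen_inter_preimage ?_ isOpen_ball isOpen_Ioi
    exact fun ζ hζ => ((hδs hζ).1.continuousAt.norm).continuousWithinAt
  obtain ⟨ζ, ⟨hζO, hζs⟩, hζ⟩ := exists_eq_of_le_circleAverage (hci2.sub hci3)
    (fun ζ hζ => hmax _ (ball_subset_closedBall (hin ζ (hin' ζ hζ)).2.2.1)) hM hO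
    ⟨g z₁, ⟨by simpa using hgδ, by simpa [hhz] using hlt⟩, by simp [hε]⟩
  exact ⟨h ζ, ball_subset_closedBall (hin ζ (hin' ζ hζs)).2.2.1, hζO.2, hζ.ge⟩

lemma subh_const {c : ℝ} (hc : 0 ≤ c) : Subh (fun _ => c) where
  nonneg _ _ := hc
  usc := continuousOn_const.upperSemicontinuousOn
  sub z _ r _ _ := by rw [Real.circleAverage_const]

lemma Subh.circleIntegrable {u : ℂ → ℝ} (hu : Subh u) {c : ℂ} {r : ℝ} (hr : 0 ≤ r)
    (h : sphere c r ⊆ ball 0 1) : CircleIntegrable u c r :=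
  usc_circleIntegrable hr (hu.usc.mono h) fun z hz => hu.nonneg z (h hz)

lemma Subh.congr {u v : ℂ → ℝ} (hu : Subh u) (h : EqOn u v (ball 0 1)) : Subh v where
  nonneg z hz := by rw [← h hz]; exact hu.nonneg z hz
  usc := by
    intro z hz y hy
    rw [← h hz] at hy
    filter_upwards [hu.usc z hz y hy, self_mem_nhdsWithin] with x hx hxb
    rwa [← h hxb]
  sub z hz r hr hs := by
    rw [← h hz, ← Real.circleAverage_congr_sphere (f₁ := u)]
    · exact hu.sub z hz r hr hs
    · intro x hx
      rw [abs_of_pos hr] at hx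
      exact h (hs (sphere_subset_closedBall hx))

lemma Subh.comp {u : ℂ → ℝ} (hu : Subh u) {f : ℂ → ℂ} (hf : DifferentiableOn ℂ f (ball 0 1))
    (hmap : MapsTo f (ball 0 1) (ball 0 1)) : Subh (fun z => u (f z)) := by
  by_cases hnc : ∃ c, ∀ z ∈ ball (0 : ℂ) 1, f z = c
  · obtain ⟨c, hc⟩ := hnc
    have h0 : (0 : ℂ) ∈ ball (0 : ℂ) 1 := mem_ball_self one_pos
    have hcb : c ∈ ball (0 : ℂ) 1 := hc 0 h0 ▸ hmap h0
    exact (subh_const (hu.nonneg c hcb)).congr fun z hz => by simp only [hc z hz]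
  have husc : UpperSemicontinuousOn (fun z => u (f z)) (ball 0 1) :=
    hu.usc.comp hf.continuousOn hmap
  refine ⟨fun z hz => hu.nonneg _ (hmap hz), husc, fun z hz r hr hs => ?_⟩
  refine le_of_forall_pos_le_add fun ε hε => ?_
  have hs' : sphere z r ⊆ ball 0 1 := sphere_subset_closedBall.trans hs
  obtain ⟨F, hF, hle, hav⟩ := exists_entire_majorant hr (husc.mono hs')
    (fun x hx => hu.nonneg _ (hmap (hs' hx))) hε
  have := hu.comp_le hf hmap hnc hs hF hle z (mem_closedBall_self hr.le)
  rw [circleAverage_re_eq hr.le (fun x _ => hF.analyticAt x)] at hav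
  linarith

lemma Subh.le_re {u : ℂ → ℝ} (hu : Subh u) {a : ℂ} {r : ℝ} (hsub : closedBall a r ⊆ ball 0 1)
    {F : ℂ → ℂ} (hF : Differentiable ℂ F) (hle : ∀ z ∈ sphere a r, u z ≤ (F z).re) :
    ∀ z ∈ closedBall a r, u z ≤ (F z).re := by
  refine hu.comp_le (f := id) differentiableOn_id (fun _ h => h) ?_ hsub hF hle
  rintro ⟨c, hc⟩
  have h0 := hc 0 (by simp)
  have h1 := hc (1 / 2) (by simp; norm_num)
  simp only [id] at h0 h1
  rw [← h0] at h1
  norm_num at h1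

/-- The Poisson integral of the restriction of `u` to the circle of radius `R`. -/
noncomputable def poissonInt (u : ℂ → ℝ) (R : ℝ) (z : ℂ) : ℝ :=
  Real.circleAverage ((re ∘ herglotzRieszKernel 0 z) • u) 0 R

section Poisson

variable {u v : ℂ → ℝ} {R : ℝ} {z ζ : ℂ}

lemma poissonInt_kernel_le (hz : z ∈ ball 0 R) (hζ : ζ ∈ sphere (0 : ℂ) |R|) :
    (herglotzRieszKernel 0 z ζ).re ≤ (R + ‖z‖) / (R - ‖z‖) := by
  rw [abs_of_pos (pos_of_mem_ball hz)] at hζ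
  simpa [herglotzRieszKernel] using re_herglotzRieszKernel_le hζ hz

lemma poissonInt_kernel_nonneg (hz : z ∈ ball 0 R) (hζ : ζ ∈ sphere (0 : ℂ) |R|) :
    0 ≤ (herglotzRieszKernel 0 z ζ).re := by
  rw [abs_of_pos (pos_of_mem_ball hz)] at hζ
  have h1 : ‖z‖ < R := by simpa using hz
  have := le_re_herglotzRieszKernel hζ hz
  refine le_trans ?_ (by simpa [herglotzRieszKernel] using this)
  have := norm_nonneg z
  exact div_nonneg (by linarith) (by linarith)

lemma poissonInt_integrable (hu : CircleIntegrable u 0 R) (hz : z ∈ ball 0 R) :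
    CircleIntegrable ((re ∘ herglotzRieszKernel 0 z) • u) 0 R :=
  hu.continuousOn_smul
    (Complex.continuous_re.comp_continuousOn (continuousOn_herglotzRieszKernel_sphere hz))

lemma poissonInt_mono (hu : CircleIntegrable u 0 R) (hv : CircleIntegrable v 0 R)
    (hz : z ∈ ball 0 R) (h : ∀ ζ ∈ sphere (0 : ℂ) R, u ζ ≤ v ζ) :
    poissonInt u R z ≤ poissonInt v R z := by
  refine Real.circleAverage_mono (poissonInt_integrable hu hz) (poissonInt_integrable hv hz) ?_
  intro ζ hζ
  have h1 := poissonInt_kernel_nonneg hz hζ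
  rw [abs_of_pos (pos_of_mem_ball hz)] at hζ
  exact mul_le_mul_of_nonneg_left (h ζ hζ) h1

lemma poissonInt_nonneg (hz : z ∈ ball 0 R) (h : ∀ ζ ∈ sphere (0 : ℂ) R, 0 ≤ u ζ) :
    0 ≤ poissonInt u R z := by
  refine Real.circleAverage_nonneg_of_nonneg ?_
  intro ζ hζ
  have h1 := poissonInt_kernel_nonneg hz hζ
  rw [abs_of_pos (pos_of_mem_ball hz)] at hζ
  exact mul_nonneg h1 (h ζ hζ)

lemma poissonInt_le (hu : CircleIntegrable u 0 R) (h0 : ∀ ζ ∈ sphere (0 : ℂ) R, 0 ≤ u ζ)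
    (hz : z ∈ ball 0 R) :
    poissonInt u R z ≤ (R + ‖z‖) / (R - ‖z‖) * Real.circleAverage u 0 R := by
  rw [← smul_eq_mul, ← Real.circleAverage_fun_smul]
  refine Real.circleAverage_mono (poissonInt_integrable hu hz) (hu.const_smul) ?_
  intro ζ hζ
  have h1 := poissonInt_kernel_le hz hζ
  rw [abs_of_pos (pos_of_mem_ball hz)] at hζ
  exact mul_le_mul_of_nonneg_right h1 (h0 ζ hζ)

lemma poissonInt_zero (hR : 0 < R) : poissonInt u R 0 = Real.circleAverage u 0 R := by
  refine Real.circleAverage_congr_sphere fun ζ hζ => ?_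
  rw [abs_of_pos hR] at hζ
  have : ζ ≠ 0 := by
    rintro rfl
    simp at hζ
    exact hR.ne hζ
  simp [herglotzRieszKernel, this]

lemma poissonInt_eq_re (hu : CircleIntegrable u 0 R) :
    ∃ F : ℂ → ℂ, AnalyticOnNhd ℂ F (ball 0 R) ∧ ∀ z ∈ ball 0 R, (F z).re = poissonInt u R z := by
  refine ⟨_, analyticOnNhd_circleAverage_herglotzRieszKernel_smul
    (f := fun ζ => (u ζ : ℂ)) ?_, fun z hz => re_circleAverage_herglotzRieszKernel_smul hu hz⟩
  simp only [CircleIntegrable, intervalIntegrable_iff] at hu ⊢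
  exact Complex.ofRealCLM.integrable_comp hu

lemma poissonInt_re {F : ℂ → ℂ} (hF : AnalyticOnNhd ℂ F (closedBall 0 R)) (hz : z ∈ ball 0 R) :
    poissonInt (fun z => (F z).re) R z = (F z).re :=
  InnerProductSpace.HarmonicOnNhd.circleAverage_re_herglotzRieszKernel_smul
    (fun z hz => (hF z hz).harmonicAt_re) hz

end Poisson

lemma circleIntegrable_re {F : ℂ → ℂ} {R : ℝ} (hR : 0 ≤ R)
    (hF : ContinuousOn F (closedBall 0 R)) : CircleIntegrable (fun z => (F z).re) 0 R :=
  (Complex.continuous_re.comp_continuousOn (hF.mono sphere_subset_closedBall)).circleIntegrable hR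

lemma sphere_subset_unit_ball {R : ℝ} (hR : R < 1) : sphere (0 : ℂ) R ⊆ ball 0 1 :=
  sphere_subset_closedBall.trans (closedBall_subset_ball hR)

lemma Subh.le_poissonInt {u : ℂ → ℝ} (hu : Subh u) {R : ℝ} (hR : R < 1) {z : ℂ}
    (hz : z ∈ ball 0 R) : u z ≤ poissonInt u R z := by
  have hR0 := pos_of_mem_ball hz
  have hz' : ‖z‖ < R := by simpa using hz
  have hs := sphere_subset_unit_ball hR
  have hui := hu.circleIntegrable hR0.le hs
  set q := (R + ‖z‖) / (R - ‖z‖) with hq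
  have hq0 : 0 < q := div_pos (by positivity) (by linarith)
  refine le_of_forall_pos_le_add fun ε hε => ?_
  obtain ⟨F, hF, hle, hav⟩ := exists_entire_majorant hR0 (hu.usc.mono hs)
    (fun x hx => hu.nonneg _ (hs hx)) (div_pos hε hq0)
  have hFi := circleIntegrable_re hR0.le (F := F) hF.continuous.continuousOn
  have h1 := hu.le_re (closedBall_subset_ball hR) hF hle z (ball_subset_closedBall hz)
  have h2 := poissonInt_re (z := z) (F := F) (fun x _ => hF.analyticAt x) hz
  have h3 := poissonInt_le (hFi.sub hui)
    (fun ζ hζ => by simpa using hle ζ hζ) hz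
  rw [Real.circleAverage_sub hFi hui] at h3
  have h4 : poissonInt ((fun z => (F z).re) - u) R z =
      poissonInt (fun z => (F z).re) R z - poissonInt u R z := by
    unfold poissonInt
    rw [smul_sub, Real.circleAverage_sub (poissonInt_integrable hFi hz)
      (poissonInt_integrable hui hz)]
  have h5 : q * (Real.circleAverage (fun z => (F z).re) 0 R - Real.circleAverage u 0 R) ≤
      q * (ε / q) := by
    gcongr
    linarith
  rw [mul_div_cancel₀ _ hq0.ne'] at h5
  linarith

lemma Subh.circleAverage_comp_le {u : ℂ → ℝ} (hu : Subh u) {f : ℂ → ℂ}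
    (hf : DifferentiableOn ℂ f (ball 0 1)) (hmap : MapsTo f (ball 0 1) (ball 0 1)) (hf0 : f 0 = 0)
    {r R : ℝ} (hr : 0 < r) (hrR : r < R) (hR : R < 1) :
    Real.circleAverage (fun z => u (f z)) 0 r ≤ Real.circleAverage u 0 R := by
  have hR0 := hr.trans hrR
  have hs := sphere_subset_unit_ball hR
  have hr1 := hrR.trans hR
  obtain ⟨F, hF, hFu⟩ := poissonInt_eq_re (hu.circleIntegrable hR0.le hs)
  have hfb : ∀ z ∈ closedBall (0 : ℂ) r, f z ∈ ball (0 : ℂ) R := by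
    intro z hz
    have hz' : ‖z‖ ≤ r := by simpa using hz
    have := Complex.norm_le_norm_of_mapsTo_ball hf (hmap.mono_right ball_subset_closedBall)
      hf0 (z := z) (by linarith)
    simp only [mem_ball, dist_zero_right]
    linarith
  have hFf : AnalyticOnNhd ℂ (fun z => F (f z)) (closedBall 0 r) := fun z hz =>
    (hF _ (hfb z hz)).comp (hf.analyticOnNhd isOpen_ball z (closedBall_subset_ball hr1 hz))
  calc Real.circleAverage (fun z => u (f z)) 0 r
      ≤ Real.circleAverage (fun z => (F (f z)).re) 0 r := by
        refine Real.circleAverage_mono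
          ((hu.comp hf hmap).circleIntegrable hr.le (sphere_subset_unit_ball hr1))
          (circleIntegrable_re hr.le hFf.continuousOn) fun z hz => ?_
        rw [abs_of_pos hr] at hz
        have := hfb z (sphere_subset_closedBall hz)
        rw [hFu _ this]
        exact hu.le_poissonInt hR this
    _ = Real.circleAverage u 0 R := by
        rw [circleAverage_re_eq hr.le hFf, hf0, hFu _ (mem_ball_self hR0), poissonInt_zero hR0]

lemma Subh.circleAverage_mono {u : ℂ → ℝ} (hu : Subh u) {r R : ℝ} (hr : 0 < r) (hrR : r ≤ R)
    (hR : R < 1) : Real.circleAverage u 0 r ≤ Real.circleAverage u 0 R := by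
  rcases hrR.eq_or_lt with rfl | h
  · exact le_rfl
  · exact hu.circleAverage_comp_le (f := id) differentiableOn_id (fun _ h => h) rfl hr h hR

lemma Subh.poissonInt_mono_radius {u : ℂ → ℝ} (hu : Subh u) {r R : ℝ} {z : ℂ}
    (hz : z ∈ ball 0 r) (hrR : r ≤ R) (hR : R < 1) : poissonInt u r z ≤ poissonInt u R z := by
  rcases hrR.eq_or_lt with rfl | h
  · exact le_rfl
  have hr := pos_of_mem_ball hz
  have hR0 := hr.trans h
  have hs := sphere_subset_unit_ball hR
  obtain ⟨F, hF, hFu⟩ := poissonInt_eq_re (hu.circleIntegrable hR0.le hs)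
  have hF' : AnalyticOnNhd ℂ F (closedBall 0 r) := hF.mono (closedBall_subset_ball h)
  rw [← hFu z (ball_subset_ball hrR hz), ← poissonInt_re hF' hz]
  refine poissonInt_mono (hu.circleIntegrable hr.le (sphere_subset_unit_ball (h.trans hR)))
    (circleIntegrable_re hr.le hF'.continuousOn) hz fun ζ hζ => ?_
  have : ζ ∈ ball (0 : ℂ) R := sphere_subset_ball h hζ
  rw [hFu _ this]
  exact hu.le_poissonInt hR this

/-- Radii increasing to one. -/
noncomputable def rad (n : ℕ) : ℝ := 1 - 1 / (n + 2)

lemma rad_lt_one (n : ℕ) : rad n < 1 := by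
  have : (0 : ℝ) < 1 / (n + 2) := by positivity
  unfold rad
  linarith

lemma rad_ge_half (n : ℕ) : 1 / 2 ≤ rad n := by
  have : (1 : ℝ) / (n + 2) ≤ 1 / 2 := by
    have : (0 : ℝ) ≤ n := by positivity
    exact one_div_le_one_div_of_le (by norm_num) (by linarith)
  unfold rad
  linarith

lemma rad_pos (n : ℕ) : 0 < rad n := by linarith [rad_ge_half n]

lemma rad_mono : Monotone rad := by
  intro m n h
  have : (1 : ℝ) / (n + 2) ≤ 1 / (m + 2) := by
    have : (m : ℝ) ≤ n := by exact_mod_cast h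
    exact one_div_le_one_div_of_le (by positivity) (by linarith)
  unfold rad
  linarith

lemma tendsto_rad : Tendsto rad atTop (𝓝 1) := by
  have : Tendsto (fun n : ℕ => 1 - (1 : ℝ) / (n + 2)) atTop (𝓝 (1 - 0)) := by
    refine tendsto_const_nhds.sub ?_
    have := (tendsto_add_atTop_iff_nat 1).mpr (tendsto_one_div_add_atTop_nhds_zero_nat (𝕜 := ℝ))
    refine this.congr fun n => ?_
    push_cast
    ring
  rw [sub_zero] at this
  exact this

lemma Subh.exists_limit_poissonInt {u : ℂ → ℝ} (hu : Subh u) {C : ℝ}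
    (hC : ∀ r : ℝ, 0 < r → r < 1 → Real.circleAverage u 0 r ≤ C) {z : ℂ} (hz : z ∈ ball (0 : ℂ) 1) :
    ∃ l, Tendsto (fun n => poissonInt u (rad n) z) atTop (𝓝 l) := by
  have hz' : ‖z‖ < 1 := by simpa using hz
  obtain ⟨N, hN⟩ := (tendsto_rad.eventually_const_lt hz').exists
  have hzN : ∀ n, N ≤ n → z ∈ ball (0 : ℂ) (rad n) := fun n hn => by
    simpa using hN.trans_le (rad_mono hn)
  have hmono : Monotone fun n => poissonInt u (rad (n + N)) z := by
    intro m n hmn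
    exact hu.poissonInt_mono_radius (hzN _ (by omega)) (rad_mono (by omega)) (rad_lt_one _)
  have hbdd : BddAbove (range fun n => poissonInt u (rad (n + N)) z) := by
    refine ⟨2 / (rad N - ‖z‖) * C, ?_⟩
    rintro _ ⟨n, rfl⟩
    have hs := sphere_subset_unit_ball (rad_lt_one (n + N))
    have h1 := poissonInt_le (hu.circleIntegrable (rad_pos (n + N)).le hs)
      (fun ζ hζ => hu.nonneg ζ (hs hζ)) (hzN (n + N) (by omega))
    have h2 := hC _ (rad_pos (n + N)) (rad_lt_one _)
    have h3 := rad_mono (show N ≤ n + N by omega)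
    have h4 := rad_lt_one (n + N)
    have h5 : 0 ≤ Real.circleAverage u 0 (rad (n + N)) := by
      refine Real.circleAverage_nonneg_of_nonneg fun ζ hζ => ?_
      rw [abs_of_pos (rad_pos _)] at hζ
      exact hu.nonneg ζ (hs hζ)
    refine h1.trans ?_
    gcongr
    · linarith
  refine ⟨_, (tendsto_add_atTop_iff_nat N).mp (tendsto_atTop_ciSup hmono hbdd)⟩

/-- A nonnegative subharmonic function with bounded means has a harmonic majorant whose value at the
center is the limit of the means. -/
lemma Subh.exists_harmonic_majorant {u : ℂ → ℝ} (hu : Subh u) {C : ℝ}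
    (hC : ∀ r : ℝ, 0 < r → r < 1 → Real.circleAverage u 0 r ≤ C) :
    ∃ F : ℂ → ℂ, AnalyticOnNhd ℂ F (ball 0 1) ∧ (∀ z ∈ ball (0 : ℂ) 1, u z ≤ (F z).re) ∧
      Tendsto (fun n => Real.circleAverage u 0 (rad n)) atTop (𝓝 (F 0).re) := by
  choose! W hW using fun z (hz : z ∈ ball (0 : ℂ) 1) => hu.exists_limit_poissonInt hC hz
  have hui : ∀ n, CircleIntegrable u 0 (rad n) := fun n =>
    hu.circleIntegrable (rad_pos n).le (sphere_subset_unit_ball (rad_lt_one n))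
  have hrep : ∀ ρ : ℝ, 0 < ρ → ρ < 1 → CircleIntegrable W 0 ρ ∧
      ∀ z ∈ ball (0 : ℂ) ρ, poissonInt W ρ z = W z := by
    intro ρ hρ hρ1
    obtain ⟨N, hN⟩ := (tendsto_rad.eventually_const_lt hρ1).exists
    have hsub : ∀ n, closedBall (0 : ℂ) ρ ⊆ ball 0 (rad (n + N)) := fun n =>
      closedBall_subset_ball (hN.trans_le (rad_mono (by omega)))
    choose F hF hFu using fun n => poissonInt_eq_re (hui (n + N))
    have hF' : ∀ n, AnalyticOnNhd ℂ (F n) (closedBall 0 ρ) := fun n => (hF n).mono (hsub n)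
    have hlim : ∀ z ∈ closedBall (0 : ℂ) ρ, Tendsto (fun n => (F n z).re) atTop (𝓝 (W z)) := by
      intro z hz
      refine ((tendsto_add_atTop_iff_nat N).mpr
        (hW z (closedBall_subset_ball hρ1 hz))).congr fun n => ?_
      rw [hFu n z (hsub n hz)]
    set B := 2 / (rad N - ρ) * C with hB
    have hbd : ∀ n, ∀ z ∈ sphere (0 : ℂ) ρ, |(F n z).re| ≤ B := by
      intro n z hz
      have hzb := hsub n (sphere_subset_closedBall hz)
      have hz' : ‖z‖ = ρ := by simpa using hz
      have hs := sphere_subset_unit_ball (rad_lt_one (n + N))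
      have hn0 : ∀ ζ ∈ sphere (0 : ℂ) (rad (n + N)), 0 ≤ u ζ := fun ζ hζ => hu.nonneg ζ (hs hζ)
      rw [hFu n z hzb, abs_of_nonneg (poissonInt_nonneg hzb hn0)]
      have h1 := poissonInt_le (hui (n + N)) hn0 hzb
      have h2 := hC _ (rad_pos (n + N)) (rad_lt_one _)
      have h3 := rad_mono (show N ≤ n + N by omega)
      have h4 := rad_lt_one (n + N)
      have h5 : 0 ≤ Real.circleAverage u 0 (rad (n + N)) := by
        refine Real.circleAverage_nonneg_of_nonneg fun ζ hζ => ?_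
        rw [abs_of_pos (rad_pos _)] at hζ
        exact hn0 ζ hζ
      refine h1.trans ?_
      rw [hz', hB]
      gcongr
      · linarith
    have hmem := fun θ => circleMap_mem_sphere (0 : ℂ) hρ.le θ
    have hcF : ∀ n, Continuous fun θ => (F n (circleMap 0 ρ θ)).re := fun n =>
      Complex.continuous_re.comp ((hF' n).continuousOn.comp_continuous (continuous_circleMap 0 ρ)
        fun θ => sphere_subset_closedBall (hmem θ))
    have hWm : Measurable fun θ => W (circleMap 0 ρ θ) := by
      refine measurable_of_tendsto_metrizable (fun n => (hcF n).measurable)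
        (tendsto_pi_nhds.mpr fun θ => hlim _ (sphere_subset_closedBall (hmem θ)))
    have hWb : ∀ θ, |W (circleMap 0 ρ θ)| ≤ B := fun θ =>
      le_of_tendsto (hlim _ (sphere_subset_closedBall (hmem θ))).abs
        (Eventually.of_forall fun n => hbd n _ (hmem θ))
    have hWi := circleIntegrable_of_bdd hWm hWb
    refine ⟨hWi, fun z hz => ?_⟩
    have hB0 : 0 ≤ B := (abs_nonneg _).trans (hWb 0)
    have h1 : ∀ n, poissonInt (fun z => (F n z).re) ρ z = (F n z).re := fun n =>
      poissonInt_re (hF' n) hz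
    have h2 : Tendsto (fun n => poissonInt (fun z => (F n z).re) ρ z) atTop
        (𝓝 (poissonInt W ρ z)) := by
      simp only [poissonInt, Real.circleAverage_def]
      refine Tendsto.const_smul ?_ _
      refine intervalIntegral.tendsto_integral_filter_of_dominated_convergence
        (fun _ => (ρ + ‖z‖) / (ρ - ‖z‖) * B)
        (Eventually.of_forall fun n => ?_) (Eventually.of_forall fun n => ?_) (by simp) ?_
      · have := poissonInt_integrable (circleIntegrable_re hρ.le (hF' n).continuousOn) hz
        have h := (intervalIntegrable_iff.mp this).aestronglyMeasurable
        exact h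
      · refine Eventually.of_forall fun θ _ => ?_
        have hs : circleMap 0 ρ θ ∈ sphere (0 : ℂ) |ρ| := circleMap_mem_sphere' _ _ _
        have hk := poissonInt_kernel_nonneg hz hs
        have hk' := poissonInt_kernel_le hz hs
        simp only [Pi.smul_apply', Function.comp_apply, smul_eq_mul, norm_mul, Real.norm_eq_abs]
        rw [abs_of_nonneg hk]
        exact mul_le_mul hk' (hbd n _ (hmem θ)) (abs_nonneg _) (hk.trans hk')
      · refine Eventually.of_forall fun θ _ => ?_
        exact (hlim _ (sphere_subset_closedBall (hmem θ))).const_mul _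
    refine tendsto_nhds_unique h2 ?_
    simp only [h1]
    exact hlim z (ball_subset_closedBall hz)
  have hWh : InnerProductSpace.HarmonicOnNhd W (ball 0 1) := by
    intro z hz
    have hz' : ‖z‖ < 1 := by simpa using hz
    obtain ⟨ρ, hzρ, hρ1⟩ := exists_between hz'
    have hρ : 0 < ρ := (norm_nonneg z).trans_lt hzρ
    obtain ⟨hi, heq⟩ := hrep ρ hρ hρ1
    obtain ⟨F, hF, hFW⟩ := poissonInt_eq_re hi
    have hzb : z ∈ ball (0 : ℂ) ρ := by simpa using hzρ
    have := (hF z hzb).harmonicAt_re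
    refine (InnerProductSpace.harmonicAt_congr_nhds ?_).mp this
    filter_upwards [isOpen_ball.mem_nhds hzb] with x hx
    simp only [hFW x hx, heq x hx]
  obtain ⟨F, hF, hFW⟩ := hWh.exists_analyticOnNhd_ball_re_eq
  refine ⟨F, hF, fun z hz => ?_, ?_⟩
  · have : (F z).re = W z := hFW hz
    rw [this]
    have hz' : ‖z‖ < 1 := by simpa using hz
    refine ge_of_tendsto (hW z hz) ?_
    filter_upwards [tendsto_rad.eventually_const_lt hz'] with n hn
    exact hu.le_poissonInt (rad_lt_one n) (by simpa using hn)
  · have h0 : (0 : ℂ) ∈ ball (0 : ℂ) 1 := mem_ball_self one_pos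
    have : (F 0).re = W 0 := hFW h0
    rw [this]
    exact (hW 0 h0).congr fun n => poissonInt_zero (rad_pos n)

/-- The Green function of the unit disk. -/
noncomputable def greenK (z w : ℂ) : ℝ := Real.log (‖1 - (starRingEnd ℂ) w * z‖ / ‖z - w‖)

lemma greenK_eq {z w : ℂ} (hzw : z ≠ w) :
    greenK z w = 1 / 2 * Real.log (1 + (1 - ‖z‖ ^ 2) * (1 - ‖w‖ ^ 2) / ‖z - w‖ ^ 2) := by
  have h0 : 0 < ‖z - w‖ := norm_pos_iff.mpr (sub_ne_zero.mpr hzw)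
  have h1 : ‖1 - (starRingEnd ℂ) w * z‖ ^ 2 =
      ‖z - w‖ ^ 2 + (1 - ‖z‖ ^ 2) * (1 - ‖w‖ ^ 2) := by
    simp only [← Complex.normSq_eq_norm_sq, Complex.normSq_apply]
    simp
    ring
  have h2 : 1 + (1 - ‖z‖ ^ 2) * (1 - ‖w‖ ^ 2) / ‖z - w‖ ^ 2 =
      (‖1 - (starRingEnd ℂ) w * z‖ / ‖z - w‖) ^ 2 := by
    rw [div_pow, h1]
    field_simp
  rw [h2, Real.log_pow, greenK]
  push_cast
  ring

lemma greenK_nonneg {z w : ℂ} (hz : ‖z‖ ≤ 1) (hw : ‖w‖ ≤ 1) : 0 ≤ greenK z w := by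
  by_cases hzw : z = w
  · simp [greenK, hzw]
  rw [greenK_eq hzw]
  have h1 : 0 ≤ 1 - ‖z‖ ^ 2 := by nlinarith [norm_nonneg z]
  have h2 : 0 ≤ 1 - ‖w‖ ^ 2 := by nlinarith [norm_nonneg w]
  have : 0 ≤ (1 - ‖z‖ ^ 2) * (1 - ‖w‖ ^ 2) / ‖z - w‖ ^ 2 := by positivity
  have := Real.log_nonneg (le_add_of_nonneg_right (a := 1) this)
  positivity

lemma greenK_le {z w : ℂ} (hz : ‖z‖ ≤ 1) (hw : ‖w‖ ≤ 1) (hzw : z ≠ w) :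
    greenK z w ≤ 2 * (1 - ‖z‖) * (1 - ‖w‖) / ‖z - w‖ ^ 2 := by
  have h0 : 0 < ‖z - w‖ := norm_pos_iff.mpr (sub_ne_zero.mpr hzw)
  rw [greenK_eq hzw]
  have h1 : 0 ≤ 1 - ‖z‖ ^ 2 := by nlinarith [norm_nonneg z]
  have h2 : 0 ≤ 1 - ‖w‖ ^ 2 := by nlinarith [norm_nonneg w]
  have h3 : 1 - ‖z‖ ^ 2 ≤ 2 * (1 - ‖z‖) := by nlinarith [norm_nonneg z]
  have h4 : 1 - ‖w‖ ^ 2 ≤ 2 * (1 - ‖w‖) := by nlinarith [norm_nonneg w]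
  have h5 : 0 ≤ (1 - ‖z‖ ^ 2) * (1 - ‖w‖ ^ 2) / ‖z - w‖ ^ 2 := by positivity
  have h6 := Real.log_le_sub_one_of_pos (show 0 < 1 + (1 - ‖z‖ ^ 2) * (1 - ‖w‖ ^ 2) / ‖z - w‖ ^ 2 by
    positivity)
  calc _ ≤ 1 / 2 * ((1 - ‖z‖ ^ 2) * (1 - ‖w‖ ^ 2) / ‖z - w‖ ^ 2) := by linarith
    _ ≤ 1 / 2 * ((2 * (1 - ‖z‖)) * (2 * (1 - ‖w‖)) / ‖z - w‖ ^ 2) := by gcongr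
    _ = _ := by ring

lemma greenK_zero_ge {w : ℂ} (hw : w ≠ 0) : 1 - ‖w‖ ≤ greenK 0 w := by
  have h0 : 0 < ‖w‖ := norm_pos_iff.mpr hw
  have := Real.log_le_sub_one_of_pos h0
  simp only [greenK, mul_zero, sub_zero, norm_one, zero_sub, norm_neg, one_div, Real.log_inv]
  linarith

lemma norm_sub_sq_polar (a ρ α θ : ℝ) :
    ‖circleMap 0 a α - circleMap 0 ρ θ‖ ^ 2 =
      (a - ρ) ^ 2 + 2 * a * ρ * (1 - Real.cos (θ - α)) := by
  rw [← Complex.normSq_eq_norm_sq, Complex.normSq_apply, Real.cos_sub]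
  simp only [circleMap, zero_add, Complex.sub_re, Complex.sub_im, Complex.re_ofReal_mul,
    Complex.im_ofReal_mul, Complex.exp_ofReal_mul_I_re, Complex.exp_ofReal_mul_I_im]
  linear_combination a ^ 2 * Real.cos_sq_add_sin_sq α + ρ ^ 2 * Real.cos_sq_add_sin_sq θ

lemma polar_dist_ge {a ρ t : ℝ} (ha : 0 ≤ a) (hρ : 1 / 2 ≤ ρ) (ht : |t| ≤ Real.pi) :
    1 / 2 * ((a - ρ) ^ 2 + (t / 16) ^ 2) ≤ (a - ρ) ^ 2 + 2 * a * ρ * (1 - Real.cos t) := by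
  have hpi : Real.pi ^ 2 < 10 := by nlinarith [Real.pi_lt_d2, Real.pi_pos]
  have hc := Real.cos_le_one_sub_mul_cos_sq ht
  have h1 : t ^ 2 / 5 ≤ 1 - Real.cos t := by
    have : 1 / 5 ≤ 2 / Real.pi ^ 2 := by
      rw [div_le_div_iff₀ (by norm_num) (by positivity)]; linarith
    nlinarith [sq_nonneg t]
  have ht2 : t ^ 2 ≤ 10 := by
    have := sq_le_sq' (by linarith [abs_nonneg t, Real.pi_pos]) ht
    rw [sq_abs] at this
    linarith
  have hcc : 0 ≤ 1 - Real.cos t := by linarith [sq_nonneg t]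
  rcases le_or_gt (1 / 4) a with h | h
  · have : 1 / 4 ≤ 2 * a * ρ := by nlinarith
    nlinarith [sq_nonneg t, sq_nonneg (a - ρ)]
  · have : 1 / 16 ≤ (a - ρ) ^ 2 := by nlinarith
    have : 0 ≤ 2 * a * ρ * (1 - Real.cos t) := by positivity
    nlinarith

lemma half_log_div_le {δ d s : ℝ} (hδ : 0 < δ) (hd : 0 < d) (hs : s ≠ 0) :
    1 / 2 * Real.log (1 + 8 * δ * d / ((δ - d) ^ 2 + s ^ 2)) / d ≤
      4 * δ / (δ ^ 2 / 4 + s ^ 2) + 1 / δ * Real.log (1 + 16 * δ ^ 2 / s ^ 2) := by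
  have hs2 : 0 < s ^ 2 := by positivity
  have hQ : 0 < (δ - d) ^ 2 + s ^ 2 := by positivity
  have hy : 0 ≤ 8 * δ * d / ((δ - d) ^ 2 + s ^ 2) := by positivity
  have hl1 : 0 ≤ Real.log (1 + 16 * δ ^ 2 / s ^ 2) :=
    Real.log_nonneg (le_add_of_nonneg_right (by positivity))
  by_cases hnear : δ / 2 < d ∧ d < 2 * δ
  · have h1 : 8 * δ * d / ((δ - d) ^ 2 + s ^ 2) ≤ 16 * δ ^ 2 / s ^ 2 := by
      apply div_le_div₀ (by positivity) (by nlinarith) hs2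
      nlinarith [sq_nonneg (δ - d)]
    have h2 := Real.log_le_log (show 0 < 1 + 8 * δ * d / ((δ - d) ^ 2 + s ^ 2) by positivity)
      (add_le_add_right h1 1)
    have h3 : 1 / 2 / d ≤ 1 / δ := by
      rw [div_div, div_le_div_iff₀ (by positivity) hδ]; linarith
    have h4 : 0 ≤ 4 * δ / (δ ^ 2 / 4 + s ^ 2) := by positivity
    calc _ = 1 / 2 / d * Real.log (1 + 8 * δ * d / ((δ - d) ^ 2 + s ^ 2)) := by ring
      _ ≤ 1 / δ * Real.log (1 + 16 * δ ^ 2 / s ^ 2) :=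
          mul_le_mul h3 h2 (Real.log_nonneg (le_add_of_nonneg_right hy)) (by positivity)
      _ ≤ _ := by linarith
  · have h1 : δ ^ 2 / 4 ≤ (δ - d) ^ 2 := by
      rw [not_and_or, not_lt, not_lt] at hnear
      rcases hnear with h | h <;> nlinarith
    have h2 := Real.log_le_sub_one_of_pos
      (show 0 < 1 + 8 * δ * d / ((δ - d) ^ 2 + s ^ 2) by positivity)
    have h3 : 0 ≤ 1 / δ * Real.log (1 + 16 * δ ^ 2 / s ^ 2) := by positivity
    calc _ ≤ 1 / 2 * (8 * δ * d / ((δ - d) ^ 2 + s ^ 2)) / d := by gcongr; linarith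
      _ = 4 * δ / ((δ - d) ^ 2 + s ^ 2) := by field_simp; ring
      _ ≤ 4 * δ / (δ ^ 2 / 4 + s ^ 2) := by gcongr
      _ ≤ _ := by linarith

/-- A function dominating the normalized Green kernel uniformly in the radius of the pole. -/
noncomputable def greenB (δ t : ℝ) : ℝ :=
  4 * δ / (δ ^ 2 / 4 + (t / 16) ^ 2) + 1 / δ * Real.log (1 + 16 * δ ^ 2 / (t / 16) ^ 2)

lemma greenK_div_le {a ρ α θ : ℝ} (ha : 0 ≤ a) (ha1 : a < 1) (hρ : 1 / 2 ≤ ρ) (hρ1 : ρ < 1)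
    (ht : |θ - α| ≤ Real.pi) (ht0 : θ ≠ α) :
    greenK (circleMap 0 a α) (circleMap 0 ρ θ) / (1 - ρ) ≤ greenB (1 - a) (θ - α) := by
  have hs : (θ - α) / 16 ≠ 0 := div_ne_zero (sub_ne_zero.mpr ht0) (by norm_num)
  have hd : 0 < 1 - ρ := by linarith
  have hδ : 0 < 1 - a := by linarith
  have hge := polar_dist_ge ha hρ ht
  rw [← norm_sub_sq_polar] at hge
  have hs2 : 0 < ((θ - α) / 16) ^ 2 := by positivity
  have hne : circleMap 0 a α ≠ circleMap 0 ρ θ := by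
    intro h
    rw [h, sub_self, norm_zero] at hge
    nlinarith [sq_nonneg (a - ρ)]
  refine le_trans ?_ (half_log_div_le hδ hd hs)
  rw [greenK_eq hne]
  simp only [norm_circleMap_zero, sq_abs]
  have h1 : 0 ≤ 1 - a ^ 2 := by nlinarith
  have h2 : 0 ≤ 1 - ρ ^ 2 := by nlinarith
  have h3 : (1 - a ^ 2) * (1 - ρ ^ 2) ≤ 2 * (1 - a) * (2 * (1 - ρ)) := by
    apply mul_le_mul <;> nlinarith
  have h4 : (1 - a ^ 2) * (1 - ρ ^ 2) / ‖circleMap 0 a α - circleMap 0 ρ θ‖ ^ 2 ≤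
      8 * (1 - a) * (1 - ρ) / ((1 - a - (1 - ρ)) ^ 2 + ((θ - α) / 16) ^ 2) := by
    have h5 : (a - ρ) ^ 2 = (1 - a - (1 - ρ)) ^ 2 := by ring
    rw [h5] at hge
    have hQ : 0 < (1 - a - (1 - ρ)) ^ 2 + ((θ - α) / 16) ^ 2 := by positivity
    calc _ ≤ 2 * (1 - a) * (2 * (1 - ρ)) /
        (1 / 2 * ((1 - a - (1 - ρ)) ^ 2 + ((θ - α) / 16) ^ 2)) :=
          div_le_div₀ (by positivity) h3 (by positivity) hge
      _ = _ := by field_simp; ring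
  have h6 : 0 ≤ (1 - a ^ 2) * (1 - ρ ^ 2) / ‖circleMap 0 a α - circleMap 0 ρ θ‖ ^ 2 := by
    positivity
  gcongr

lemma greenB_nonneg {δ : ℝ} (hδ : 0 < δ) (t : ℝ) : 0 ≤ greenB δ t := by
  have : 0 ≤ Real.log (1 + 16 * δ ^ 2 / (t / 16) ^ 2) :=
    Real.log_nonneg (le_add_of_nonneg_right (by positivity))
  rw [greenB]
  positivity

lemma greenB_integral {δ : ℝ} (hδ : 0 < δ) :
    IntervalIntegrable (greenB δ) volume (-Real.pi) Real.pi ∧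
      ∫ t in (-Real.pi)..Real.pi, greenB δ t ≤ 1000 * Real.pi := by
  set g : ℝ → ℝ := fun t => 128 * Real.arctan (t / (8 * δ)) +
    1 / δ * (t * Real.log (t ^ 2 + (64 * δ) ^ 2) - 2 * (t * Real.log t) +
      2 * (64 * δ) * Real.arctan (t / (64 * δ))) with hg
  have hcont : Continuous g := by
    have h1 : ∀ t : ℝ, t ^ 2 + (64 * δ) ^ 2 ≠ 0 := fun t => by positivity
    have h2 : Continuous fun t : ℝ => t * Real.log (t ^ 2 + (64 * δ) ^ 2) :=
      continuous_id.mul (Continuous.log (by fun_prop) h1)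
    have h3 := Real.continuous_mul_log
    have h4 := Real.continuous_arctan
    have h5 : Continuous fun t : ℝ => Real.arctan (t / (8 * δ)) := h4.comp (by fun_prop)
    have h6 : Continuous fun t : ℝ => Real.arctan (t / (64 * δ)) := h4.comp (by fun_prop)
    exact (h5.const_mul _).add (((h2.sub (h3.const_mul 2)).add (h6.const_mul _)).const_mul _)
  have hder : ∀ t : ℝ, t ≠ 0 → HasDerivAt g (greenB δ t) t := by
    intro t ht
    have hp : 0 < t ^ 2 + (64 * δ) ^ 2 := by positivity
    have e1 : HasDerivAt (fun t : ℝ => Real.arctan (t / (8 * δ)))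
        (1 / (1 + (t / (8 * δ)) ^ 2) * (1 / (8 * δ))) t :=
      (((hasDerivAt_id t).div_const _)).arctan
    have e2 : HasDerivAt (fun t : ℝ => Real.arctan (t / (64 * δ)))
        (1 / (1 + (t / (64 * δ)) ^ 2) * (1 / (64 * δ))) t :=
      (((hasDerivAt_id t).div_const _)).arctan
    have e3 : HasDerivAt (fun t : ℝ => Real.log (t ^ 2 + (64 * δ) ^ 2))
        (2 * t / (t ^ 2 + (64 * δ) ^ 2)) t := by
      have := (((hasDerivAt_pow 2 t).add_const ((64 * δ) ^ 2))).log hp.ne'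
      simpa using this
    have e4 := (hasDerivAt_id t).mul e3
    have e5 := Real.hasDerivAt_mul_log ht
    have e6 := (e1.const_mul 128).add
      (((e4.sub (e5.const_mul 2)).add (e2.const_mul (2 * (64 * δ)))).const_mul (1 / δ))
    refine e6.congr_deriv ?_
    have hlog : Real.log (1 + 16 * δ ^ 2 / (t / 16) ^ 2) =
        Real.log (t ^ 2 + (64 * δ) ^ 2) - 2 * Real.log t := by
      have : 1 + 16 * δ ^ 2 / (t / 16) ^ 2 = (t ^ 2 + (64 * δ) ^ 2) / t ^ 2 := by
        field_simp; ring
      rw [this, Real.log_div hp.ne' (by positivity), Real.log_pow]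
      norm_num
    rw [greenB, hlog]
    have hp2 : t ^ 2 + (64 * δ) ^ 2 ≠ 0 := hp.ne'
    have e7 : 1 / (1 + (t / (8 * δ)) ^ 2) * (1 / (8 * δ)) =
        4 * δ / (δ ^ 2 / 4 + (t / 16) ^ 2) / 128 := by
      field_simp; ring
    have e8 : 1 / (1 + (t / (64 * δ)) ^ 2) * (1 / (64 * δ)) = 64 * δ / (t ^ 2 + (64 * δ) ^ 2) := by
      field_simp; ring
    have e9 : t * (2 * t / (t ^ 2 + (64 * δ) ^ 2)) =
        2 - 2 * (64 * δ) * (64 * δ / (t ^ 2 + (64 * δ) ^ 2)) := by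
      field_simp; ring
    simp only [id, one_mul]
    rw [e7, e8, e9]
    ring
  have hI1 : IntegrableOn (greenB δ) (Ioc (-Real.pi) 0) :=
    intervalIntegral.integrableOn_deriv_of_nonneg hcont.continuousOn
      (fun t ht => hder t ht.2.ne) (fun t _ => greenB_nonneg hδ t)
  have hI2 : IntegrableOn (greenB δ) (Ioc 0 Real.pi) :=
    intervalIntegral.integrableOn_deriv_of_nonneg hcont.continuousOn
      (fun t ht => hder t ht.1.ne') (fun t _ => greenB_nonneg hδ t)
  have hpi := Real.pi_pos
  have hJ1 : IntervalIntegrable (greenB δ) volume (-Real.pi) 0 :=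
    (intervalIntegrable_iff_integrableOn_Ioc_of_le (by linarith)).mpr hI1
  have hJ2 : IntervalIntegrable (greenB δ) volume 0 Real.pi :=
    (intervalIntegrable_iff_integrableOn_Ioc_of_le (by linarith)).mpr hI2
  have hJ := hJ1.trans hJ2
  refine ⟨hJ, ?_⟩
  rw [← intervalIntegral.integral_add_adjacent_intervals hJ1 hJ2,
    intervalIntegral.integral_eq_sub_of_hasDerivAt_of_le (by linarith) hcont.continuousOn
      (fun t ht => hder t ht.2.ne) hJ1,
    intervalIntegral.integral_eq_sub_of_hasDerivAt_of_le (by linarith) hcont.continuousOn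
      (fun t ht => hder t ht.1.ne') hJ2]
  have hodd : g (-Real.pi) = - g Real.pi := by
    simp only [hg, neg_div, Real.arctan_neg, Real.log_neg_eq_log, even_two, Even.neg_pow]
    ring
  have hpos : 0 < 64 * δ := by positivity
  have hgpi : g Real.pi ≤ 500 * Real.pi := by
    have a1 := (Real.arctan_lt_pi_div_two (Real.pi / (8 * δ))).le
    have a2 := (Real.arctan_lt_pi_div_two (Real.pi / (64 * δ))).le
    have a3 : Real.pi * Real.log (Real.pi ^ 2 + (64 * δ) ^ 2) - 2 * (Real.pi * Real.log Real.pi) ≤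
        2 * (64 * δ) := by
      have b1 : Real.log (Real.pi ^ 2 + (64 * δ) ^ 2) ≤ 2 * Real.log (Real.pi + 64 * δ) := by
        have := Real.log_le_log (show 0 < Real.pi ^ 2 + (64 * δ) ^ 2 by positivity)
          (show Real.pi ^ 2 + (64 * δ) ^ 2 ≤ (Real.pi + 64 * δ) ^ 2 by nlinarith)
        rwa [Real.log_pow, Nat.cast_ofNat] at this
      have b2 : Real.log (Real.pi + 64 * δ) ≤ Real.log Real.pi + 64 * δ / Real.pi := by
        have : Real.pi + 64 * δ = Real.pi * (1 + 64 * δ / Real.pi) := by field_simp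
        rw [this, Real.log_mul hpi.ne' (by positivity)]
        have := Real.log_le_sub_one_of_pos (show 0 < 1 + 64 * δ / Real.pi by positivity)
        linarith
      have b3 : Real.pi * (64 * δ / Real.pi) = 64 * δ := by field_simp
      nlinarith
    have a4 : g Real.pi ≤ 128 * (Real.pi / 2) +
        1 / δ * (2 * (64 * δ) + 2 * (64 * δ) * (Real.pi / 2)) := by
      simp only [hg]
      gcongr
    have a5 : 1 / δ * (2 * (64 * δ) + 2 * (64 * δ) * (Real.pi / 2)) = 128 + 64 * Real.pi := by
      field_simp; ring
    have := Real.pi_gt_three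
    linarith
  rw [hodd]
  linarith

/-- A measurable set of angles carrying poles `ρ θ * exp (i θ)` inside a compact set `E`. -/
structure PoleData (K : Set ℝ) (ρ : ℝ → ℝ) (E : Set ℂ) : Prop where
  measK : MeasurableSet K
  sub : K ⊆ Ioc 0 (2 * Real.pi)
  measρ : Measurable ρ
  half : ∀ θ ∈ K, 1 / 2 ≤ ρ θ
  mem : ∀ θ ∈ K, circleMap 0 (ρ θ) θ ∈ E
  compact : IsCompact E
  ball : E ⊆ ball 0 1

/-- The normalized Green kernel with pole `ρ θ * exp (i θ)`. -/
noncomputable def greenN (ρ : ℝ → ℝ) (z : ℂ) (θ : ℝ) : ℝ :=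
  greenK z (circleMap 0 (ρ θ) θ) / (1 - ρ θ)

/-- The Green potential of the normalized poles. -/
noncomputable def greenPot (K : Set ℝ) (ρ : ℝ → ℝ) (z : ℂ) : ℝ := ∫ θ in K, greenN ρ z θ

lemma PoleData.norm_pole {K : Set ℝ} {ρ : ℝ → ℝ} {E : Set ℂ} (h : PoleData K ρ E) {θ : ℝ}
    (hθ : θ ∈ K) : ‖circleMap 0 (ρ θ) θ‖ = ρ θ := by
  rw [norm_circleMap_zero, abs_of_nonneg]
  linarith [h.half θ hθ]

lemma PoleData.lt {K : Set ℝ} {ρ : ℝ → ℝ} {E : Set ℂ} (h : PoleData K ρ E) {θ : ℝ}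
    (hθ : θ ∈ K) : ρ θ < 1 := by
  rw [← h.norm_pole hθ]
  simpa using h.ball (h.mem θ hθ)

lemma PoleData.greenN_nonneg {K : Set ℝ} {ρ : ℝ → ℝ} {E : Set ℂ} (h : PoleData K ρ E) {θ : ℝ}
    (hθ : θ ∈ K) {z : ℂ} (hz : ‖z‖ ≤ 1) : 0 ≤ greenN ρ z θ := by
  have h1 := h.lt hθ
  refine div_nonneg (greenK_nonneg hz ?_) (by linarith)
  rw [h.norm_pole hθ]
  exact h1.le

lemma PoleData.greenN_le {K : Set ℝ} {ρ : ℝ → ℝ} {E : Set ℂ} (h : PoleData K ρ E) {θ : ℝ}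
    (hθ : θ ∈ K) {z : ℂ} (hz : ‖z‖ ≤ 1) {η : ℝ} (hη : 0 < η)
    (hzη : ∀ w ∈ E, η ≤ ‖z - w‖) : greenN ρ z θ ≤ 2 * (1 - ‖z‖) / η ^ 2 := by
  have h1 := h.lt hθ
  have h2 := hzη _ (h.mem θ hθ)
  have h3 : z ≠ circleMap 0 (ρ θ) θ := by
    intro h4
    rw [← h4, sub_self, norm_zero] at h2
    linarith
  have h5 := greenK_le hz (by rw [h.norm_pole hθ]; exact h1.le) h3
  rw [h.norm_pole hθ] at h5
  have h6 : 0 < 1 - ρ θ := by linarith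
  have h7 : 0 ≤ 1 - ‖z‖ := by linarith
  rw [greenN, div_le_iff₀ h6]
  calc _ ≤ 2 * (1 - ‖z‖) * (1 - ρ θ) / ‖z - circleMap 0 (ρ θ) θ‖ ^ 2 := h5
    _ ≤ 2 * (1 - ‖z‖) * (1 - ρ θ) / η ^ 2 := by gcongr
    _ = _ := by ring

lemma PoleData.measurable_greenN {K : Set ℝ} {ρ : ℝ → ℝ} {E : Set ℂ} (h : PoleData K ρ E) :
    Measurable fun q : ℂ × ℝ => greenN ρ q.1 q.2 := by
  have h1 : Measurable fun q : ℂ × ℝ => circleMap 0 (ρ q.2) q.2 := by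
    have := h.measρ
    simp only [circleMap]
    fun_prop
  simp only [greenN, greenK]
  have h2 : Measurable fun q : ℂ × ℝ => ‖1 - (starRingEnd ℂ) (circleMap 0 (ρ q.2) q.2) * q.1‖ :=
    (((Complex.continuous_conj.measurable.comp h1).mul measurable_fst).const_sub 1).norm
  have h3 : Measurable fun q : ℂ × ℝ => ‖q.1 - circleMap 0 (ρ q.2) q.2‖ :=
    (measurable_fst.sub h1).norm
  exact (Real.measurable_log.comp (h2.div h3)).div ((h.measρ.comp measurable_snd).const_sub 1)

lemma PoleData.volume_lt_top {K : Set ℝ} {ρ : ℝ → ℝ} {E : Set ℂ} (h : PoleData K ρ E) :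
    volume K < ⊤ := (measure_mono h.sub).trans_lt measure_Ioc_lt_top

lemma PoleData.volume_real_le {K : Set ℝ} {ρ : ℝ → ℝ} {E : Set ℂ} (h : PoleData K ρ E) :
    volume.real K ≤ 2 * Real.pi := by
  have := measureReal_mono (μ := volume) h.sub measure_Ioc_lt_top.ne
  simpa [Real.pi_pos.le] using this

lemma PoleData.integrableOn_greenN {K : Set ℝ} {ρ : ℝ → ℝ} {E : Set ℂ} (h : PoleData K ρ E)
    {z : ℂ} (hz : ‖z‖ ≤ 1) {η : ℝ} (hη : 0 < η) (hzη : ∀ w ∈ E, η ≤ ‖z - w‖) :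
    IntegrableOn (greenN ρ z) K := by
  refine Measure.integrableOn_of_bounded (M := 2 * (1 - ‖z‖) / η ^ 2) h.volume_lt_top.ne
    (h.measurable_greenN.comp (measurable_const.prodMk measurable_id)).aestronglyMeasurable ?_
  refine (ae_restrict_iff' h.measK).mpr (Eventually.of_forall fun θ hθ => ?_)
  rw [Real.norm_of_nonneg (h.greenN_nonneg hθ hz)]
  exact h.greenN_le hθ hz hη hzη

lemma PoleData.greenPot_le_of_dist {K : Set ℝ} {ρ : ℝ → ℝ} {E : Set ℂ} (h : PoleData K ρ E)
    {z : ℂ} (hz : ‖z‖ ≤ 1) {η : ℝ} (hη : 0 < η) (hzη : ∀ w ∈ E, η ≤ ‖z - w‖) :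
    greenPot K ρ z ≤ 2 * (1 - ‖z‖) / η ^ 2 * (2 * Real.pi) := by
  have h0 : 0 ≤ 2 * (1 - ‖z‖) / η ^ 2 := by
    have : 0 ≤ 1 - ‖z‖ := by linarith
    positivity
  calc greenPot K ρ z ≤ ∫ _ in K, 2 * (1 - ‖z‖) / η ^ 2 :=
        setIntegral_mono_on (h.integrableOn_greenN hz hη hzη)
          (integrableOn_const h.volume_lt_top.ne) h.measK fun θ hθ => h.greenN_le hθ hz hη hzη
    _ = volume.real K * (2 * (1 - ‖z‖) / η ^ 2) := by simp
    _ ≤ _ := by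
      rw [mul_comm]
      exact mul_le_mul_of_nonneg_left h.volume_real_le h0

lemma PoleData.volume_le_greenPot_zero {K : Set ℝ} {ρ : ℝ → ℝ} {E : Set ℂ}
    (h : PoleData K ρ E) (hE : ∀ w ∈ E, 1 / 2 ≤ ‖w‖) : volume.real K ≤ greenPot K ρ 0 := by
  have hE' : ∀ w ∈ E, (1 / 2 : ℝ) ≤ ‖0 - w‖ := by simpa using hE
  calc volume.real K = ∫ _ in K, (1 : ℝ) := by simp
    _ ≤ _ := by
      refine setIntegral_mono_on (integrableOn_const h.volume_lt_top.ne)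
        (h.integrableOn_greenN (by simp) (by norm_num) hE') h.measK fun θ hθ => ?_
      have h1 := h.lt hθ
      have h2 := h.half θ hθ
      have h3 := h.norm_pole hθ
      rw [greenN, le_div_iff₀ (by linarith), one_mul]
      have := greenK_zero_ge (w := circleMap 0 (ρ θ) θ) (by
        rw [← norm_pos_iff, h3]; linarith)
      rwa [h3] at this

lemma exists_dist_of_disjoint {A E : Set ℂ} (hA : IsCompact A) (hE : IsCompact E)
    (hd : Disjoint A E) : ∃ η : ℝ, 0 < η ∧ ∀ z ∈ A, ∀ w ∈ E, η ≤ ‖z - w‖ := by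
  obtain ⟨r, hr, h⟩ := Metric.exists_pos_forall_lt_edist hA hE.isClosed hd
  refine ⟨r, hr, fun z hz w hw => ?_⟩
  have := h z hz w hw
  rw [edist_nndist, ENNReal.coe_lt_coe] at this
  rw [← dist_eq_norm]
  exact_mod_cast this.le

lemma PoleData.continuousAt_greenPot {K : Set ℝ} {ρ : ℝ → ℝ} {E : Set ℂ} (h : PoleData K ρ E)
    {z : ℂ} (hz : z ∈ Metric.ball (0 : ℂ) 1) (hzE : z ∉ E) : ContinuousAt (greenPot K ρ) z := by
  have hO : IsOpen (Metric.ball (0 : ℂ) 1 \ E) := isOpen_ball.sdiff h.compact.isClosed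
  obtain ⟨r, hr, hsub⟩ := Metric.nhds_basis_closedBall.mem_iff.mp (hO.mem_nhds ⟨hz, hzE⟩)
  obtain ⟨η, hη, hd⟩ := exists_dist_of_disjoint (isCompact_closedBall z r) h.compact
    (Set.disjoint_left.mpr fun x hx hxE => (hsub hx).2 hxE)
  refine tendsto_integral_filter_of_dominated_convergence (fun _ => 2 / η ^ 2) ?_ ?_
    (integrableOn_const h.volume_lt_top.ne) ?_
  · exact Eventually.of_forall fun x =>
      (h.measurable_greenN.comp (measurable_const.prodMk measurable_id)).aestronglyMeasurable
  · filter_upwards [closedBall_mem_nhds z hr] with x hx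
    refine (ae_restrict_iff' h.measK).mpr (Eventually.of_forall fun θ hθ => ?_)
    have hx1 : ‖x‖ ≤ 1 := by simpa using (ball_subset_closedBall (hsub hx).1)
    rw [Real.norm_of_nonneg (h.greenN_nonneg hθ hx1)]
    refine (h.greenN_le hθ hx1 hη (hd x hx)).trans ?_
    gcongr
    linarith [norm_nonneg x]
  · refine (ae_restrict_iff' h.measK).mpr (Eventually.of_forall fun θ hθ => ?_)
    have h1 : z - circleMap 0 (ρ θ) θ ≠ 0 := fun h0 =>
      hzE (by rw [sub_eq_zero.mp h0]; exact h.mem θ hθ)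
    have hlt := h.lt hθ
    have h2 : 1 - (starRingEnd ℂ) (circleMap 0 (ρ θ) θ) * z ≠ 0 := by
      intro h0
      have h3 : ‖(starRingEnd ℂ) (circleMap 0 (ρ θ) θ) * z‖ = 1 := by
        rw [← sub_eq_zero.mp h0, norm_one]
      rw [norm_mul, RCLike.norm_conj, h.norm_pole hθ] at h3
      have : ‖z‖ < 1 := by simpa using hz
      nlinarith [norm_nonneg z, h.half θ hθ]
    have : ContinuousAt (fun x => greenN ρ x θ) z := by
      simp only [greenN, greenK]
      refine ContinuousAt.div_const (ContinuousAt.log ?_ ?_) _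
      · exact ContinuousAt.div (by fun_prop) (by fun_prop) (norm_ne_zero_iff.mpr h1)
      · exact div_ne_zero (norm_ne_zero_iff.mpr h2) (norm_ne_zero_iff.mpr h1)
    exact this

lemma circleAverage_greenK {w z : ℂ} {r : ℝ} (hr : 0 < r)
    (hz : closedBall z r ⊆ ball 0 1) (hw : ‖w‖ < 1) (hwz : w ∉ closedBall z r) :
    Real.circleAverage (fun x => greenK x w) z r = greenK z w := by
  have hH : InnerProductSpace.HarmonicOnNhd (fun x => greenK x w) (closedBall z |r|) := by
    rw [abs_of_pos hr]
    intro x hx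
    have hx1 : ‖x‖ < 1 := by simpa using hz hx
    have h1 : x - w ≠ 0 := fun h0 => hwz (by rwa [← sub_eq_zero.mp h0])
    have h2 : 1 - (starRingEnd ℂ) w * x ≠ 0 := by
      intro h0
      have h3 : ‖(starRingEnd ℂ) w * x‖ = 1 := by rw [← sub_eq_zero.mp h0, norm_one]
      rw [norm_mul, RCLike.norm_conj] at h3
      nlinarith [norm_nonneg x, norm_nonneg w]
    have ha : AnalyticAt ℂ (fun x => (1 - (starRingEnd ℂ) w * x) / (x - w)) x :=
      AnalyticAt.div (by fun_prop) (by fun_prop) h1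
    have := ha.harmonicAt_log_norm (div_ne_zero h2 h1)
    simpa only [greenK, norm_div] using this
  exact hH.circleAverage_eq

lemma PoleData.circleAverage_greenPot {K : Set ℝ} {ρ : ℝ → ℝ} {E : Set ℂ} (h : PoleData K ρ E)
    {z : ℂ} {r : ℝ} (hr : 0 < r) (hz : closedBall z r ⊆ Metric.ball 0 1)
    (hd : Disjoint (closedBall z r) E) :
    Real.circleAverage (greenPot K ρ) z r = greenPot K ρ z := by
  obtain ⟨η, hη, hdist⟩ := exists_dist_of_disjoint (isCompact_closedBall z r) h.compact hd
  have hmem : ∀ t, circleMap z r t ∈ closedBall z r := fun t =>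
    sphere_subset_closedBall (circleMap_mem_sphere z hr.le t)
  have hn1 : ∀ t, ‖circleMap z r t‖ ≤ 1 := fun t => by
    simpa using ball_subset_closedBall (hz (hmem t))
  set Φ : ℝ → ℝ → ℝ := fun t θ => greenN ρ (circleMap z r t) θ with hΦ
  have hc1 : Measurable fun t => circleMap z r t := (continuous_circleMap z r).measurable
  have hc2 : Measurable fun q : ℝ × ℝ => circleMap z r q.1 := hc1.comp measurable_fst
  have hc : Measurable fun q : ℝ × ℝ => (circleMap z r q.1, q.2) := hc2.prodMk measurable_snd
  have hm : Measurable (Function.uncurry Φ) := by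
    have := h.measurable_greenN.comp hc
    exact this
  have hfin : IsFiniteMeasure (volume.restrict K) := ⟨by simpa using h.volume_lt_top⟩
  have hbound : ∀ t, ∀ θ ∈ K, ‖Φ t θ‖ ≤ 2 / η ^ 2 := fun t θ hθ => by
    rw [Real.norm_of_nonneg (h.greenN_nonneg hθ (hn1 _))]
    refine (h.greenN_le hθ (hn1 _) hη (hdist _ (hmem _))).trans ?_
    gcongr
    linarith [norm_nonneg (circleMap z r t)]
  have hae : ∀ᵐ q ∂((volume.restrict (Ioc 0 (2 * Real.pi))).prod (volume.restrict K)),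
      ‖Function.uncurry Φ q‖ ≤ 2 / η ^ 2 := by
    rw [Measure.prod_restrict]
    exact (ae_restrict_iff' (measurableSet_Ioc.prod h.measK)).mpr
      (Eventually.of_forall fun q hq => hbound q.1 q.2 hq.2)
  have hint : Integrable (Function.uncurry Φ)
      ((volume.restrict (Ioc 0 (2 * Real.pi))).prod (volume.restrict K)) :=
    Integrable.of_bound hm.aestronglyMeasurable _ hae
  have hswap := integral_integral_swap hint
  have hleft : Real.circleAverage (greenPot K ρ) z r =
      (2 * Real.pi)⁻¹ * ∫ t in Ioc 0 (2 * Real.pi), ∫ θ in K, Φ t θ := by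
    rw [Real.circleAverage_def, intervalIntegral.integral_of_le Real.two_pi_pos.le, smul_eq_mul]
    rfl
  rw [hleft, hswap, ← integral_const_mul]
  refine setIntegral_congr_fun h.measK fun θ hθ => ?_
  have h1 := circleAverage_greenK hr hz (w := circleMap 0 (ρ θ) θ)
    (by rw [h.norm_pole hθ]; exact h.lt hθ) (fun hx => Set.disjoint_left.mp hd hx (h.mem θ hθ))
  rw [Real.circleAverage_def, intervalIntegral.integral_of_le Real.two_pi_pos.le,
    smul_eq_mul] at h1
  simp only [hΦ, greenN]
  rw [← h1, integral_div, mul_div_assoc]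

lemma PoleData.greenPot_le {K : Set ℝ} {ρ : ℝ → ℝ} {E : Set ℂ} (h : PoleData K ρ E)
    {z : ℂ} (hz : ‖z‖ < 1) : greenPot K ρ z ≤ 1000 * Real.pi := by
  set α := Complex.arg z
  set a := ‖z‖ with ha
  have hza : z = circleMap 0 a α := by
    rw [circleMap, zero_add]
    exact (Complex.norm_mul_exp_arg_mul_I z).symm
  have hδ : 0 < 1 - a := by linarith
  have hpp := Real.two_pi_pos
  set τ : ℝ → ℝ := fun t => toIocMod hpp (-Real.pi) t with hτ
  have hτm : ∀ t, τ t ∈ Ioc (-Real.pi) Real.pi := fun t => by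
    have := toIocMod_mem_Ioc hpp (-Real.pi) t
    rwa [show -Real.pi + 2 * Real.pi = Real.pi by ring] at this
  set P : ℝ → ℝ := fun t => greenB (1 - a) (τ t) with hP
  have hper : Function.Periodic P (2 * Real.pi) := fun t => by
    simp only [hP, hτ, toIocMod_add_right]
  have hPself : EqOn (greenB (1 - a)) P (Ioc (-Real.pi) Real.pi) := fun t ht => by
    simp only [hP, hτ]
    rw [(toIocMod_eq_self hpp).mpr]
    rwa [show -Real.pi + 2 * Real.pi = Real.pi by ring]
  obtain ⟨hI, hle⟩ := greenB_integral hδ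
  have hpi := Real.pi_pos
  have hPI : IntervalIntegrable P volume (-Real.pi) (-Real.pi + 2 * Real.pi) := by
    rw [show -Real.pi + 2 * Real.pi = Real.pi by ring]
    refine hI.congr ?_
    rw [uIoc_of_le (by linarith)]
    exact hPself
  have hPI' : IntervalIntegrable (fun θ => P (θ - α)) volume 0 (2 * Real.pi) := by
    have := (hper.intervalIntegrable hpp.ne' hPI (0 - α) (2 * Real.pi - α)).comp_sub_right α
    simpa using this
  have hval : ∫ θ in (0 : ℝ)..(2 * Real.pi), P (θ - α) ≤ 1000 * Real.pi := by
    rw [intervalIntegral.integral_comp_sub_right]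
    have e1 := hper.intervalIntegral_add_eq (0 - α) (-Real.pi)
    rw [show 0 - α + 2 * Real.pi = 2 * Real.pi - α by ring,
      show -Real.pi + 2 * Real.pi = Real.pi by ring] at e1
    rw [e1]
    refine le_of_eq_of_le ?_ hle
    refine intervalIntegral.integral_congr_ae (Eventually.of_forall fun t ht => ?_)
    rw [uIoc_of_le (by linarith)] at ht
    exact (hPself ht).symm
  have hPI'' : IntegrableOn (fun θ => P (θ - α)) (Ioc 0 (2 * Real.pi)) :=
    (intervalIntegrable_iff_integrableOn_Ioc_of_le hpp.le).mp hPI'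
  have hP0 : ∀ t, 0 ≤ P t := fun t => greenB_nonneg hδ _
  refine le_trans ?_ hval
  rw [intervalIntegral.integral_of_le hpp.le]
  refine le_trans ?_ (setIntegral_mono_set hPI'' (Eventually.of_forall fun t => hP0 _)
    (Eventually.of_forall h.sub))
  have hcount : {θ : ℝ | τ (θ - α) = 0}.Countable := by
    refine (Set.countable_range fun n : ℤ => α + n * (2 * Real.pi)).mono ?_
    intro θ hθ
    refine ⟨toIocDiv hpp (-Real.pi) (θ - α), ?_⟩
    have e1 := toIocMod_add_toIocDiv_zsmul hpp (-Real.pi) (θ - α)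
    have e2 : toIocMod hpp (-Real.pi) (θ - α) = 0 := hθ
    rw [e2, zero_add, zsmul_eq_mul] at e1
    simp only [e1]
    ring
  refine integral_mono_of_nonneg ?_ (hPI''.mono_set h.sub) ?_
  · exact (ae_restrict_iff' h.measK).mpr
      (Eventually.of_forall fun θ hθ => h.greenN_nonneg hθ hz.le)
  · refine (ae_restrict_iff' h.measK).mpr ?_
    filter_upwards [compl_mem_ae_iff.mpr (hcount.measure_zero volume)] with θ hθ hθK
    have hθ0 : τ (θ - α) ≠ 0 := hθ
    have e1 := toIocMod_add_toIocDiv_zsmul hpp (-Real.pi) (θ - α)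
    have e2 : circleMap 0 (ρ θ) θ = circleMap 0 (ρ θ) (α + τ (θ - α)) := by
      have : θ = α + τ (θ - α) + toIocDiv hpp (-Real.pi) (θ - α) * (2 * Real.pi) := by
        rw [zsmul_eq_mul] at e1
        simp only [hτ]
        linarith
      have e3 : ∀ s, θ = s + toIocDiv hpp (-Real.pi) (θ - α) * (2 * Real.pi) →
          circleMap 0 (ρ θ) θ = circleMap 0 (ρ θ) s := fun s hs => by
        rw [← ((periodic_circleMap 0 (ρ θ)).int_mul _) s, ← hs]
      exact e3 _ this
    have hτ' := hτm (θ - α)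
    have := greenK_div_le (a := a) (ρ := ρ θ) (α := α) (θ := α + τ (θ - α)) (norm_nonneg z) hz
      (h.half θ hθK) (h.lt hθK) (by
        rw [add_sub_cancel_left, abs_le]; exact ⟨hτ'.1.le, hτ'.2⟩) (by simpa using hθ0)
    rw [add_sub_cancel_left, ← e2, ← hza] at this
    exact this

lemma isOpen_lt_re_sub {u : ℂ → ℝ} (hu : Subh u) {F : ℂ → ℂ}
    (hF : AnalyticOnNhd ℂ F (ball 0 1)) (l : ℝ) :
    IsOpen {z | z ∈ ball (0 : ℂ) 1 ∧ l < (F z).re - u z} := by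
  rw [isOpen_iff_mem_nhds]
  rintro z ⟨hz, hl⟩
  have hnb := isOpen_ball.mem_nhds hz
  set ε := ((F z).re - u z - l) / 2 with hε
  have h1 := hu.usc z hz (u z + ε) (by linarith)
  rw [isOpen_ball.nhdsWithin_eq hz] at h1
  have h2 : ∀ᶠ x in 𝓝 z, (F z).re - ε < (F x).re :=
    (Complex.continuous_re.continuousAt.comp (hF z hz).continuousAt).eventually_const_lt
      (by simp only [Function.comp]; linarith)
  filter_upwards [hnb, h1, h2] with x hx h1 h2
  exact ⟨hx, by linarith⟩

/-- The Green potential of a set of poles where the defect exceeds `l` is dominated by the defect. -/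
lemma PoleData.greenPot_le_defect {K : Set ℝ} {ρ : ℝ → ℝ} {E : Set ℂ} (h : PoleData K ρ E)
    {u : ℂ → ℝ} (hu : Subh u) {F : ℂ → ℂ} (hF : AnalyticOnNhd ℂ F (Metric.ball 0 1))
    (hle : ∀ z ∈ Metric.ball (0 : ℂ) 1, u z ≤ (F z).re) {l : ℝ} (hl : 0 < l)
    (hE : ∀ z ∈ E, l < (F z).re - u z) {z : ℂ} (hz : z ∈ Metric.ball (0 : ℂ) 1) :
    l / (1000 * Real.pi) * greenPot K ρ z ≤ (F z).re - u z := by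
  set c := l / (1000 * Real.pi) with hc
  have hpi := Real.pi_pos
  have hc0 : 0 < c := by positivity
  have hcl : ∀ x ∈ Metric.ball (0 : ℂ) 1, c * greenPot K ρ x ≤ l := fun x hx => by
    have hx' : ‖x‖ < 1 := by simpa using hx
    calc c * greenPot K ρ x ≤ c * (1000 * Real.pi) := by gcongr; exact h.greenPot_le hx'
      _ = l := by rw [hc]; field_simp
  set V := {z | z ∈ Metric.ball (0 : ℂ) 1 ∧ l < (F z).re - u z} with hV
  have hVo : IsOpen V := isOpen_lt_re_sub hu hF l
  have hEV : E ⊆ V := fun x hx => ⟨h.ball hx, hE x hx⟩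
  set w : ℂ → ℝ := fun x => u x - (F x).re + c * greenPot K ρ x with hw
  have hwV : ∀ x ∈ V, w x ≤ 0 := fun x hx => by
    have := hcl x hx.1
    have := hx.2
    simp only [hw]
    linarith
  suffices H : ∀ ε > 0, w z ≤ ε by
    have := le_of_forall_pos_le_add (a := w z) (b := 0) fun ε hε => by simpa using H ε hε
    simp only [hw] at this
    linarith
  intro ε hε
  obtain ⟨η, hη, hd⟩ := exists_dist_of_disjoint (isCompact_sphere (0 : ℂ) 1) h.compact
    (Set.disjoint_left.mpr fun x hx hxE => by
      have h1 : ‖x‖ = 1 := by simpa using hx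
      have h2 : ‖x‖ < 1 := by simpa using h.ball hxE
      linarith)
  have hz' : ‖z‖ < 1 := by simpa using hz
  have hlim : Tendsto (fun r : ℝ => c * (2 * (1 - r) / (η / 2) ^ 2 * (2 * Real.pi))) (𝓝[<] 1)
      (𝓝 0) := by
    have : Continuous fun r : ℝ => c * (2 * (1 - r) / (η / 2) ^ 2 * (2 * Real.pi)) := by fun_prop
    have := this.tendsto 1
    simp only [sub_self, mul_zero, zero_div, zero_mul] at this
    exact this.mono_left nhdsWithin_le_nhds
  have ev1 : ∀ᶠ r in 𝓝[<] (1 : ℝ), ‖z‖ < r := mem_nhdsWithin_of_mem_nhds (Ioi_mem_nhds hz')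
  have ev2 : ∀ᶠ r in 𝓝[<] (1 : ℝ), 1 - η / 2 < r :=
    mem_nhdsWithin_of_mem_nhds (Ioi_mem_nhds (by linarith))
  have ev3 : ∀ᶠ r in 𝓝[<] (1 : ℝ), r < 1 := self_mem_nhdsWithin
  obtain ⟨r0, hr1, hr2, hr3, hr4⟩ :=
    ((hlim.eventually_lt_const hε).and (ev1.and (ev2.and ev3))).exists
  have hr0 : 0 < r0 := (norm_nonneg z).trans_lt hr2
  have hbd : ∀ x : ℂ, ‖x‖ = r0 → w x ≤ ε := by
    intro x hx
    have hx1 : x ∈ Metric.ball (0 : ℂ) 1 := by simpa [hx] using hr4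
    have hxE : ∀ y ∈ E, η / 2 ≤ ‖x - y‖ := by
      intro y hy
      have e0 : (r0 : ℂ) ≠ 0 := by exact_mod_cast hr0.ne'
      have e1 : ‖x / r0‖ = 1 := by
        rw [norm_div, hx, Complex.norm_real, Real.norm_of_nonneg hr0.le, div_self hr0.ne']
      have e2 := hd (x / r0) (by simpa using e1) y hy
      have e3 : ‖x / r0 - x‖ = 1 - r0 := by
        have : x / r0 - x = x / r0 * ((1 - r0 : ℝ) : ℂ) := by push_cast; field_simp
        rw [this, norm_mul, e1, one_mul, Complex.norm_real, Real.norm_of_nonneg (by linarith)]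
      have e4 : ‖x / r0 - y‖ ≤ ‖x / r0 - x‖ + ‖x - y‖ := norm_sub_le_norm_sub_add_norm_sub _ _ _
      linarith
    have e5 := h.greenPot_le_of_dist (z := x) (by rw [hx]; exact hr4.le) (by positivity) hxE
    rw [hx] at e5
    have e6 := mul_le_mul_of_nonneg_left e5 hc0.le
    have := hle x hx1
    simp only [hw]
    linarith
  have hsubD : closedBall (0 : ℂ) r0 ⊆ Metric.ball 0 1 := closedBall_subset_ball hr4
  have hcU : ∀ x ∈ Metric.ball (0 : ℂ) 1, x ∉ E → ContinuousAt (greenPot K ρ) x :=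
    fun x hx hxE => h.continuousAt_greenPot hx hxE
  have husc : ∀ x ∈ Metric.ball (0 : ℂ) 1, x ∉ E → UpperSemicontinuousAt w x := by
    intro x hx hxE
    have h1 : UpperSemicontinuousAt u x := by
      intro y hy
      have := hu.usc x hx y hy
      rwa [isOpen_ball.nhdsWithin_eq hx] at this
    have h2 : ContinuousAt (fun x => -(F x).re + c * greenPot K ρ x) x :=
      (Complex.continuous_re.continuousAt.comp (hF x hx).continuousAt).neg.add
        ((hcU x hx hxE).const_mul c)
    have h3 : w = fun x => u x + (-(F x).re + c * greenPot K ρ x) := by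
      ext y
      simp only [hw]
      ring
    rw [h3]
    exact h1.add h2.upperSemicontinuousAt
  by_cases hzV : z ∈ V
  · exact (hwV z hzV).trans hε.le
  refine le_of_forall_max ((isCompact_closedBall (0 : ℂ) r0).diff hVo) ?_ ?_ z
    ⟨by simpa using hr2.le, hzV⟩
  · exact fun x hx => (husc x (hsubD hx.1) fun hxE => hx.2 (hEV hxE)).upperSemicontinuousWithinAt _
  · rintro a ⟨ha, haV⟩ hma hmax
    have ha1 : ‖a‖ ≤ r0 := by simpa using ha
    have ha2 : ‖a‖ < r0 := lt_of_le_of_ne ha1 fun h0 => (hbd a h0).not_gt hma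
    have haE : a ∉ E := fun hx => haV (hEV hx)
    have hO : IsOpen (Metric.ball (0 : ℂ) r0 \ E) := isOpen_ball.sdiff h.compact.isClosed
    obtain ⟨r, hr, hrs⟩ := Metric.nhds_basis_closedBall.mem_iff.mp
      (hO.mem_nhds ⟨by simpa using ha2, haE⟩)
    have hrD : closedBall a r ⊆ Metric.ball 0 1 := fun x hx =>
      hsubD (ball_subset_closedBall (hrs hx).1)
    have hrE : Disjoint (closedBall a r) E := Set.disjoint_left.mpr fun x hx => (hrs hx).2
    have hs : sphere a r ⊆ closedBall a r := sphere_subset_closedBall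
    have hui : CircleIntegrable u a r := hu.circleIntegrable hr.le (hs.trans hrD)
    have hFi : CircleIntegrable (fun x => (F x).re) a r := by
      refine ContinuousOn.circleIntegrable hr.le ?_
      exact Complex.continuous_re.comp_continuousOn ((hF.mono (hs.trans hrD)).continuousOn)
    have hUi : CircleIntegrable (greenPot K ρ) a r := by
      refine ContinuousOn.circleIntegrable hr.le fun x hx => ?_
      exact (hcU x (hrD (hs hx)) (hrs (hs hx)).2).continuousWithinAt
    have hcUi : CircleIntegrable (fun x => c * greenPot K ρ x) a r := 
      IntervalIntegrable.const_mul hUi c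
    have havg : w a ≤ Real.circleAverage w a r := by
      have e1 : Real.circleAverage w a r = Real.circleAverage u a r -
          Real.circleAverage (fun x => (F x).re) a r + c * Real.circleAverage (greenPot K ρ) a r := by
        have := Real.circleAverage_fun_add (hui.sub hFi) hcUi
        have e2 := Real.circleAverage_fun_smul (a := c) (f := greenPot K ρ) (c := a) (R := r)
        simp only [smul_eq_mul] at e2
        rw [← Real.circleAverage_sub hui hFi, ← e2, ← this]
        rfl
      rw [e1, circleAverage_re_eq hr.le (hF.mono hrD), h.circleAverage_greenPot hr hrD hrE]
      have := hu.sub a (hrD (mem_closedBall_self hr.le)) r hr hrD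
      simp only [hw]
      linarith
    have hwi : CircleIntegrable w a r := (hui.sub hFi).add hcUi
    have hwle : ∀ x ∈ sphere a |r|, w x ≤ w a := by
      rw [abs_of_pos hr]
      intro x hx
      by_cases hxV : x ∈ V
      · exact (hwV x hxV).trans (hε.trans hma).le
      · exact hmax x ⟨ball_subset_closedBall (hrs (hs hx)).1, hxV⟩
    obtain ⟨x, ⟨hxO, hxs⟩, hxa⟩ := exists_eq_of_le_circleAverage hwi hwle havg
      (O := {x : ℂ | ‖a‖ < ‖x‖}) (isOpen_lt continuous_const continuous_norm) (by
        rw [abs_of_pos hr]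
        refine ⟨a + r * Complex.exp (a.arg * I), ?_, by simp [abs_of_pos hr]⟩
        have : a + r * Complex.exp (a.arg * I) =
            ((‖a‖ + r : ℝ) : ℂ) * Complex.exp (a.arg * I) := by
          nth_rewrite 1 [← Complex.norm_mul_exp_arg_mul_I a]
          push_cast
          ring
        change ‖a‖ < ‖_‖
        rw [this, norm_mul, Complex.norm_exp_ofReal_mul_I, Complex.norm_real,
          Real.norm_of_nonneg (by positivity)]
        linarith)
    rw [abs_of_pos hr] at hxs
    refine ⟨x, ⟨ball_subset_closedBall (hrs (hs hxs)).1, fun hxV => ?_⟩, hxO, hxa.ge⟩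
    have := hwV x hxV
    linarith

lemma exists_measurable_selection {ι : Type*} (t : Finset ι) (K : ι → Set ℝ)
    (hK : ∀ i, MeasurableSet (K i)) (q : ι → ℝ) :
    ∃ ρ : ℝ → ℝ, Measurable ρ ∧ ∀ θ ∈ ⋃ i ∈ t, K i, ∃ i ∈ t, θ ∈ K i ∧ ρ θ = q i := by
  classical
  induction t using Finset.induction with
  | empty => exact ⟨fun _ => 0, measurable_const, by simp⟩
  | insert a s _ ih =>
    obtain ⟨ρ, hρ, h⟩ := ih
    refine ⟨fun θ => if θ ∈ K a then q a else ρ θ, Measurable.ite (hK a) measurable_const hρ,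
      fun θ hθ => ?_⟩
    by_cases ha : θ ∈ K a
    · exact ⟨a, by simp, ha, by simp [ha]⟩
    · simp only [Finset.mem_insert, iUnion_iUnion_eq_or_left, mem_union, ha, false_or] at hθ
      obtain ⟨i, hi, hθi, hq⟩ := h θ hθ
      exact ⟨i, by simp [hi], hθi, by simp [ha, hq]⟩

/-- Weak type estimate for the radial maximal function of `Re F - u`. -/
lemma volume_radial_defect_le {u : ℂ → ℝ} (hu : Subh u) {F : ℂ → ℂ}
    (hF : AnalyticOnNhd ℂ F (ball 0 1)) (hle : ∀ z ∈ ball (0 : ℂ) 1, u z ≤ (F z).re)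
    {R : ℝ} (hR : 1 / 2 ≤ R) (hR1 : R < 1) {l : ℝ} (hl : 0 < l) :
    volume {θ : ℝ | θ ∈ Ioo 0 (2 * Real.pi) ∧ ∃ r ∈ Ioo R 1,
      l < (F (circleMap 0 r θ)).re - u (circleMap 0 r θ)} ≤
      ENNReal.ofReal (1000 * Real.pi / l *
        ((F 0).re - Real.circleAverage u 0 R)) := by
  set V := {z | z ∈ ball (0 : ℂ) 1 ∧ l < (F z).re - u z} with hV
  have hVo : IsOpen V := isOpen_lt_re_sub hu hF l
  set U : Ioo R 1 → Set ℝ := fun r => Ioo 0 (2 * Real.pi) ∩ circleMap 0 (r : ℝ) ⁻¹' V with hU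
  have hUo : ∀ r, IsOpen (U r) := fun r => isOpen_Ioo.inter (hVo.preimage (continuous_circleMap _ _))
  have hmemV : ∀ r : Ioo R 1, ∀ θ, circleMap 0 (r : ℝ) θ ∈ ball (0 : ℂ) 1 := fun r θ => by
    have h1 := r.2.1
    have h2 := r.2.2
    simp only [mem_ball_zero_iff, norm_circleMap_zero]
    rw [abs_of_pos (by linarith)]
    exact h2
  have hS : {θ : ℝ | θ ∈ Ioo 0 (2 * Real.pi) ∧ ∃ r ∈ Ioo R 1,
      l < (F (circleMap 0 r θ)).re - u (circleMap 0 r θ)} = ⋃ r, U r := by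
    ext θ
    simp only [mem_ofPred_eq, mem_iUnion, hU, mem_inter_iff, mem_preimage, hV]
    constructor
    · rintro ⟨h1, r, hr, h2⟩
      exact ⟨⟨r, hr⟩, h1, hmemV ⟨r, hr⟩ θ, h2⟩
    · rintro ⟨r, h1, -, h2⟩
      exact ⟨h1, r, r.2, h2⟩
  rw [hS, (isOpen_iUnion hUo).measure_eq_iSup_isCompact]
  refine iSup₂_le fun K hKs => iSup_le fun hK => ?_
  obtain ⟨t, ht⟩ := hK.elim_finite_subcover U hUo hKs
  obtain ⟨L, hLc, hLU, hKL⟩ := hK.finite_compact_cover t U (fun i _ => hUo i) ht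
  obtain ⟨ρ, hρ, hsel⟩ := exists_measurable_selection t L (fun i => (hLc i).measurableSet)
    (fun i => (i : ℝ))
  rw [← hKL] at hsel
  set E : Set ℂ := ⋃ i ∈ t, circleMap 0 (i : ℝ) '' L i with hEdef
  have hEc : IsCompact E := t.isCompact_biUnion fun i _ => (hLc i).image (continuous_circleMap _ _)
  have hEV : ∀ z ∈ E, z ∈ V ∧ R < ‖z‖ := by
    intro z hz
    simp only [hEdef, mem_iUnion] at hz
    obtain ⟨i, hi, θ, hθ, rfl⟩ := hz
    refine ⟨(hLU i hθ).2, ?_⟩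
    have := i.2.1
    rw [norm_circleMap_zero, abs_of_pos (by linarith)]
    exact this
  have hP : PoleData K ρ E := by
    refine ⟨hK.measurableSet, ?_, hρ, ?_, ?_, hEc, fun z hz => (hEV z hz).1.1⟩
    · intro θ hθ
      obtain ⟨r, hr⟩ := mem_iUnion.mp (hKs hθ)
      exact Ioo_subset_Ioc_self hr.1
    · intro θ hθ
      obtain ⟨i, -, -, h⟩ := hsel θ hθ
      have := i.2.1
      linarith
    · intro θ hθ
      obtain ⟨i, hi, hθi, h⟩ := hsel θ hθ
      rw [h]
      exact mem_iUnion₂.mpr ⟨i, hi, mem_image_of_mem _ hθi⟩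
  have hR0 : 0 < R := by linarith
  have hsub : closedBall (0 : ℂ) R ⊆ ball 0 1 := closedBall_subset_ball hR1
  have hs : sphere (0 : ℂ) R ⊆ closedBall 0 R := sphere_subset_closedBall
  have hdis : Disjoint (closedBall (0 : ℂ) R) E := Set.disjoint_left.mpr fun z hz hzE => by
    have := (hEV z hzE).2
    have : ‖z‖ ≤ R := by simpa using hz
    linarith
  have h1 := hP.volume_le_greenPot_zero fun w hw => by have := (hEV w hw).2; linarith
  have hui : CircleIntegrable u 0 R := hu.circleIntegrable hR0.le (hs.trans hsub)
  have hFi : CircleIntegrable (fun x => (F x).re) 0 R :=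
    ContinuousOn.circleIntegrable hR0.le
      (Complex.continuous_re.comp_continuousOn ((hF.mono (hs.trans hsub)).continuousOn))
  have hUi : CircleIntegrable (greenPot K ρ) 0 R :=
    ContinuousOn.circleIntegrable hR0.le fun x hx =>
      (hP.continuousAt_greenPot (hsub (hs hx))
        (Set.disjoint_left.mp hdis (hs hx))).continuousWithinAt
  have hpi := Real.pi_pos
  set c := l / (1000 * Real.pi) with hc
  have hc0 : 0 < c := by positivity
  have hcUi : CircleIntegrable (fun x => c * greenPot K ρ x) 0 R := 
    IntervalIntegrable.const_mul hUi c
  have h2 : Real.circleAverage (fun x => c * greenPot K ρ x) 0 R ≤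
      Real.circleAverage (fun x => (F x).re - u x) 0 R := by
    refine Real.circleAverage_mono hcUi (hFi.sub hui) fun x hx => ?_
    rw [abs_of_pos hR0] at hx
    exact hP.greenPot_le_defect hu hF hle hl (fun z hz => (hEV z hz).1.2) (hsub (hs hx))
  have e2 := Real.circleAverage_fun_smul (a := c) (f := greenPot K ρ) (c := 0) (R := R)
  simp only [smul_eq_mul] at e2
  rw [e2, hP.circleAverage_greenPot hR0 hsub hdis, Real.circleAverage_fun_sub hFi hui,
    circleAverage_re_eq hR0.le (hF.mono hsub)] at h2
  have h3 : volume.real K ≤ 1000 * Real.pi / l * ((F 0).re - Real.circleAverage u 0 R) := by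
    calc volume.real K ≤ greenPot K ρ 0 := h1
      _ = 1000 * Real.pi / l * (c * greenPot K ρ 0) := by rw [hc]; field_simp
      _ ≤ _ := by gcongr
  rw [← ENNReal.ofReal_toReal hP.volume_lt_top.ne]
  exact ENNReal.ofReal_le_ofReal h3

lemma circleAverage_norm_sq {G : ℂ → ℂ} {a : ℂ} {r : ℝ} (hr : 0 ≤ r)
    (hG : AnalyticOnNhd ℂ G (closedBall a r)) :
    Real.circleAverage (fun z => ‖G z‖ ^ 2) a r =
      ‖G a‖ ^ 2 + Real.circleAverage (fun z => ‖G z - G a‖ ^ 2) a r := by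
  have hs : sphere a r ⊆ closedBall a r := sphere_subset_closedBall
  have hc := hG.continuousOn.mono hs
  have h1 : ∀ z, ‖G z‖ ^ 2 = ‖G z - G a‖ ^ 2 +
      (2 * (starRingEnd ℂ) (G a) * G z - (starRingEnd ℂ) (G a) * G a).re := by
    intro z
    simp only [← Complex.normSq_eq_norm_sq, Complex.normSq_apply]
    simp
    ring
  have hA : AnalyticOnNhd ℂ (fun z => 2 * (starRingEnd ℂ) (G a) * G z -
      (starRingEnd ℂ) (G a) * G a) (closedBall a r) :=
    (analyticOnNhd_const.mul hG).sub analyticOnNhd_const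
  have hi1 : CircleIntegrable (fun z => ‖G z - G a‖ ^ 2) a r :=
    ContinuousOn.circleIntegrable hr ((hc.sub continuousOn_const).norm.pow 2)
  have hi2 : CircleIntegrable (fun z => (2 * (starRingEnd ℂ) (G a) * G z -
      (starRingEnd ℂ) (G a) * G a).re) a r :=
    ContinuousOn.circleIntegrable hr
      (Complex.continuous_re.comp_continuousOn (hA.continuousOn.mono hs))
  simp_rw [h1]
  rw [Real.circleAverage_fun_add hi1 hi2, circleAverage_re_eq hr hA]
  simp
  ring

lemma subh_norm_sq {G : ℂ → ℂ} (hG : AnalyticOnNhd ℂ G (ball 0 1)) :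
    Subh fun z => ‖G z‖ ^ 2 where
  nonneg z _ := by positivity
  usc := (hG.continuousOn.norm.pow 2).upperSemicontinuousOn
  sub z _ r hr h := by
    rw [circleAverage_norm_sq hr.le (hG.mono h)]
    exact le_add_of_nonneg_right (Real.circleAverage_nonneg_of_nonneg fun _ _ => by positivity)

lemma exists_tendsto_of_approx {l : Filter ℝ} [l.NeBot] {g : ℝ → ℂ}
    (H : ∀ ε > 0, ∃ (p : ℝ → ℂ) (a : ℂ), Tendsto p l (𝓝 a) ∧ ∀ᶠ r in l, ‖g r - p r‖ ≤ ε) :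
    ∃ b, Tendsto g l (𝓝 b) := by
  rw [← cauchy_map_iff_exists_tendsto, Metric.cauchy_iff]
  refine ⟨inferInstance, fun ε hε => ?_⟩
  obtain ⟨p, a, hp, hg⟩ := H (ε / 4) (by positivity)
  have h1 : ∀ᶠ r in l, dist (p r) a < ε / 4 := (Metric.tendsto_nhds.mp hp) _ (by positivity)
  refine ⟨g '' {r | ‖g r - p r‖ ≤ ε / 4 ∧ dist (p r) a < ε / 4},
    image_mem_map (hg.and h1), ?_⟩
  have key : ∀ r, ‖g r - p r‖ ≤ ε / 4 ∧ dist (p r) a < ε / 4 → dist (g r) a < ε / 2 := by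
    rintro r ⟨h1, h2⟩
    calc dist (g r) a ≤ dist (g r) (p r) + dist (p r) a := dist_triangle _ _ _
      _ < ε / 2 := by rw [dist_eq_norm]; linarith
  rintro _ ⟨r, hr, rfl⟩ _ ⟨s, hs, rfl⟩
  calc dist (g r) (g s) ≤ dist (g r) a + dist (g s) a := dist_triangle_right _ _ _
    _ < ε := by linarith [key r hr, key s hs]

lemma subh_zero : Subh fun _ => (0 : ℝ) where
  nonneg _ _ := le_rfl
  usc := continuousOn_const.upperSemicontinuousOn
  sub z _ r _ _ := by simp [Real.circleAverage_const]

/-- Weak type estimate for the radial maximal function of a positive harmonic function. -/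
lemma volume_radial_re_le {F : ℂ → ℂ} (hF : AnalyticOnNhd ℂ F (ball 0 1))
    (hle : ∀ z ∈ ball (0 : ℂ) 1, 0 ≤ (F z).re) {l : ℝ} (hl : 0 < l) :
    volume {θ : ℝ | θ ∈ Ioo 0 (2 * Real.pi) ∧ ∃ r ∈ Ioo (1 / 2 : ℝ) 1,
      l < (F (circleMap 0 r θ)).re} ≤ ENNReal.ofReal (1000 * Real.pi / l * (F 0).re) := by
  have := volume_radial_defect_le subh_zero hF hle le_rfl (by norm_num) hl
  simpa [Real.circleAverage_const] using this

lemma measure_zero_of_le_ofReal {S : Set ℝ} {ι : Type*} {l : Filter ι} [l.NeBot] {a : ι → ℝ}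
    (ha : Tendsto a l (𝓝 0)) (h : ∀ i, volume S ≤ ENNReal.ofReal (a i)) : volume S = 0 := by
  have h1 := (ENNReal.continuous_ofReal.tendsto 0).comp ha
  rw [ENNReal.ofReal_zero] at h1
  exact le_antisymm (ge_of_tendsto' h1 h) bot_le

lemma circleMap_mem_unit_ball {r : ℝ} (h0 : 0 ≤ r) (h1 : r < 1) (θ : ℝ) :
    circleMap 0 r θ ∈ ball (0 : ℂ) 1 := by
  simpa [abs_of_nonneg h0] using h1

lemma eventually_mem_Ioo_one {R : ℝ} (hR : R < 1) : ∀ᶠ r in 𝓝[<] (1 : ℝ), r ∈ Ioo R 1 :=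
  Ioo_mem_nhdsLT hR

/-- The defect from the least harmonic majorant has radial limit zero almost everywhere. -/
lemma ae_tendsto_defect {u : ℂ → ℝ} (hu : Subh u) {F : ℂ → ℂ}
    (hF : AnalyticOnNhd ℂ F (ball 0 1)) (hle : ∀ z ∈ ball (0 : ℂ) 1, u z ≤ (F z).re)
    (hlim : Tendsto (fun n => Real.circleAverage u 0 (rad n)) atTop (𝓝 (F 0).re)) :
    ∀ᵐ θ : ℝ, θ ∈ Ioo 0 (2 * Real.pi) → Tendsto (fun r : ℝ =>
      (F (circleMap 0 r θ)).re - u (circleMap 0 r θ)) (𝓝[<] 1) (𝓝 0) := by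
  have hnull : ∀ k : ℕ, volume (⋂ n, {θ : ℝ | θ ∈ Ioo 0 (2 * Real.pi) ∧ ∃ r ∈ Ioo (rad n) 1,
      1 / ((k : ℝ) + 1) < (F (circleMap 0 r θ)).re - u (circleMap 0 r θ)}) = 0 := by
    intro k
    have h1 : Tendsto (fun n => 1000 * Real.pi / (1 / ((k : ℝ) + 1)) *
        ((F 0).re - Real.circleAverage u 0 (rad n))) atTop (𝓝 0) := by
      have := (hlim.const_sub (F 0).re).const_mul (1000 * Real.pi / (1 / ((k : ℝ) + 1)))
      simpa using this
    refine measure_zero_of_le_ofReal h1 fun n => (measure_mono (iInter_subset _ n)).trans ?_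
    exact volume_radial_defect_le hu hF hle (rad_ge_half n) (rad_lt_one n) (by positivity)
  have hall : ∀ᵐ θ : ℝ, ∀ k : ℕ, θ ∉ ⋂ n, {θ : ℝ | θ ∈ Ioo 0 (2 * Real.pi) ∧ ∃ r ∈ Ioo (rad n) 1,
      1 / ((k : ℝ) + 1) < (F (circleMap 0 r θ)).re - u (circleMap 0 r θ)} :=
    ae_all_iff.mpr fun k => compl_mem_ae_iff.mpr (hnull k)
  filter_upwards [hall] with θ hθ hmem
  rw [Metric.tendsto_nhds]
  intro ε hε
  obtain ⟨k, hk⟩ := exists_nat_one_div_lt hε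
  have hk' := hθ k
  simp only [mem_iInter, mem_ofPred_eq, not_forall, not_and, not_exists, not_lt] at hk'
  obtain ⟨n, hn⟩ := hk'
  filter_upwards [eventually_mem_Ioo_one (rad_lt_one n)] with r hr
  have h1 := hn hmem r hr
  have h2 := hle _ (circleMap_mem_unit_ball ((rad_pos n).trans hr.1).le hr.2 θ)
  rw [Real.dist_eq, sub_zero, abs_of_nonneg (by linarith)]
  linarith

lemma ae_bdd_re {F : ℂ → ℂ} (hF : AnalyticOnNhd ℂ F (ball 0 1))
    (hle : ∀ z ∈ ball (0 : ℂ) 1, 0 ≤ (F z).re) :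
    ∀ᵐ θ : ℝ, θ ∈ Ioo 0 (2 * Real.pi) → ∃ M : ℝ, ∀ᶠ r in 𝓝[<] (1 : ℝ),
      (F (circleMap 0 r θ)).re ≤ M := by
  have hnull : volume (⋂ k : ℕ, {θ : ℝ | θ ∈ Ioo 0 (2 * Real.pi) ∧ ∃ r ∈ Ioo (1 / 2 : ℝ) 1,
      (k : ℝ) + 1 < (F (circleMap 0 r θ)).re}) = 0 := by
    have h1 : Tendsto (fun k : ℕ => 1000 * Real.pi / ((k : ℝ) + 1) * (F 0).re) atTop (𝓝 0) := by
      have := (tendsto_one_div_add_atTop_nhds_zero_nat (𝕜 := ℝ)).const_mul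
        (1000 * Real.pi * (F 0).re)
      rw [mul_zero] at this
      refine this.congr fun k => ?_
      ring
    refine measure_zero_of_le_ofReal h1 fun k => (measure_mono (iInter_subset _ k)).trans ?_
    exact volume_radial_re_le hF hle (by positivity)
  filter_upwards [compl_mem_ae_iff.mpr hnull] with θ hθ hmem
  simp only [mem_compl_iff, mem_iInter, mem_ofPred_eq, not_forall, not_and, not_exists,
    not_lt] at hθ
  obtain ⟨k, hk⟩ := hθ
  refine ⟨k + 1, ?_⟩
  filter_upwards [eventually_mem_Ioo_one (R := 1 / 2) (by norm_num)] with r hr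
  exact hk hmem r hr

/-- The remainder `B_n` in `B = ∑_{k < n} c_k z ^ k + z ^ n B_n`. -/
noncomputable def taylorRem (B : ℂ → ℂ) : ℕ → ℂ → ℂ
  | 0 => B
  | n + 1 => dslope (taylorRem B n) 0

lemma taylorRem_analytic {B : ℂ → ℂ} (hB : AnalyticOnNhd ℂ B (ball 0 1)) (n : ℕ) :
    AnalyticOnNhd ℂ (taylorRem B n) (ball 0 1) := by
  induction n with
  | zero => exact hB
  | succ n ih =>
    have h1 : DifferentiableOn ℂ (dslope (taylorRem B n) 0) (ball 0 1) :=
      (Complex.differentiableOn_dslope (ball_mem_nhds 0 one_pos)).mpr ih.differentiableOn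
    exact h1.analyticOnNhd isOpen_ball

lemma taylorRem_step (B : ℂ → ℂ) (n : ℕ) (z : ℂ) :
    taylorRem B n z - taylorRem B n 0 = z * taylorRem B (n + 1) z := by
  have := sub_smul_dslope (taylorRem B n) 0 z
  rw [sub_zero, smul_eq_mul] at this
  exact this.symm

lemma taylorRem_sum (B : ℂ → ℂ) (n : ℕ) (z : ℂ) :
    B z - ∑ k ∈ Finset.range n, taylorRem B k 0 * z ^ k = z ^ n * taylorRem B n z := by
  induction n with
  | zero => simp [taylorRem]
  | succ n ih =>
    rw [Finset.sum_range_succ, ← sub_sub, ih, pow_succ, mul_assoc, ← taylorRem_step]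
    ring

lemma circleAverage_taylorRem {B : ℂ → ℂ} (hB : AnalyticOnNhd ℂ B (ball 0 1)) (n : ℕ) {r : ℝ}
    (hr : 0 < r) (hr1 : r < 1) :
    Real.circleAverage (fun z => ‖taylorRem B n z‖ ^ 2) 0 r = ‖taylorRem B n 0‖ ^ 2 +
      r ^ 2 * Real.circleAverage (fun z => ‖taylorRem B (n + 1) z‖ ^ 2) 0 r := by
  have hsub : closedBall (0 : ℂ) r ⊆ ball 0 1 := closedBall_subset_ball hr1
  rw [circleAverage_norm_sq hr.le ((taylorRem_analytic hB n).mono hsub)]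
  congr 1
  have e := Real.circleAverage_fun_smul (a := r ^ 2)
    (f := fun z => ‖taylorRem B (n + 1) z‖ ^ 2) (c := 0) (R := r)
  simp only [smul_eq_mul] at e
  rw [← e]
  refine Real.circleAverage_congr_sphere fun z hz => ?_
  have hz' : ‖z‖ = r := by simpa [abs_of_pos hr] using hz
  rw [taylorRem_step, norm_mul, mul_pow, hz']

lemma circleAverage_eq_sum_add {B : ℂ → ℂ} (hB : AnalyticOnNhd ℂ B (ball 0 1)) (N m : ℕ) {r : ℝ}
    (hr : 0 < r) (hr1 : r < 1) :
    r ^ (2 * N) * Real.circleAverage (fun z => ‖taylorRem B N z‖ ^ 2) 0 r =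
      ∑ k ∈ Finset.range m, r ^ (2 * (N + k)) * ‖taylorRem B (N + k) 0‖ ^ 2 +
      r ^ (2 * (N + m)) *
        Real.circleAverage (fun z => ‖taylorRem B (N + m) z‖ ^ 2) 0 r := by
  induction m with
  | zero => simp
  | succ m ih =>
    rw [ih, circleAverage_taylorRem hB (N + m) hr hr1, Finset.sum_range_succ, ← add_assoc N m 1]
    ring

lemma circleAverage_taylorRem_nonneg (B : ℂ → ℂ) (n : ℕ) (r : ℝ) :
    0 ≤ Real.circleAverage (fun z => ‖taylorRem B n z‖ ^ 2) 0 r :=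
  Real.circleAverage_nonneg_of_nonneg fun _ _ => by positivity

lemma circleAverage_norm_sq_le_one {B : ℂ → ℂ} (hB : AnalyticOnNhd ℂ B (ball 0 1))
    (h1 : ∀ z ∈ ball (0 : ℂ) 1, ‖B z‖ ≤ 1) {r : ℝ} (hr : 0 < r) (hr1 : r < 1) :
    Real.circleAverage (fun z => ‖B z‖ ^ 2) 0 r ≤ 1 := by
  have hs := sphere_subset_unit_ball hr1
  have := Real.circleAverage_mono ((subh_norm_sq hB).circleIntegrable hr.le hs)
    (circleIntegrable_const (1 : ℝ) 0 r) (fun z hz => by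
      rw [abs_of_pos hr] at hz
      have := h1 z (hs hz)
      have := norm_nonneg (B z)
      nlinarith)
  simpa [Real.circleAverage_const] using this

lemma pow_mul_circleAverage_le_one {B : ℂ → ℂ} (hB : AnalyticOnNhd ℂ B (ball 0 1))
    (h1 : ∀ z ∈ ball (0 : ℂ) 1, ‖B z‖ ≤ 1) (m : ℕ) {r : ℝ} (hr : 0 < r) (hr1 : r < 1) :
    ∑ k ∈ Finset.range m, r ^ (2 * k) * ‖taylorRem B k 0‖ ^ 2 +
      r ^ (2 * m) * Real.circleAverage (fun z => ‖taylorRem B m z‖ ^ 2) 0 r ≤ 1 := by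
  have h2 := circleAverage_eq_sum_add hB 0 m hr hr1
  have h3 := circleAverage_norm_sq_le_one hB h1 hr hr1
  simp only [mul_zero, pow_zero, one_mul, zero_add] at h2
  rw [← h2]
  exact h3

lemma summable_taylorRem {B : ℂ → ℂ} (hB : AnalyticOnNhd ℂ B (ball 0 1))
    (h1 : ∀ z ∈ ball (0 : ℂ) 1, ‖B z‖ ≤ 1) : Summable fun k => ‖taylorRem B k 0‖ ^ 2 := by
  refine summable_of_sum_range_le (c := 1) (fun k => by positivity) fun m => ?_
  have hle : ∀ n : ℕ, ∑ k ∈ Finset.range m, rad n ^ (2 * k) * ‖taylorRem B k 0‖ ^ 2 ≤ 1 := by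
    intro n
    have h2 := pow_mul_circleAverage_le_one hB h1 m (rad_pos n) (rad_lt_one n)
    have h3 := circleAverage_taylorRem_nonneg B m (rad n)
    have h4 : 0 ≤ rad n ^ (2 * m) := pow_nonneg (rad_pos n).le _
    nlinarith [mul_nonneg h4 h3]
  have hlim : Tendsto (fun n => ∑ k ∈ Finset.range m, rad n ^ (2 * k) * ‖taylorRem B k 0‖ ^ 2)
      atTop (𝓝 (∑ k ∈ Finset.range m, (1 : ℝ) ^ (2 * k) * ‖taylorRem B k 0‖ ^ 2)) :=
    tendsto_finsetSum _ fun k _ => (tendsto_rad.pow _).mul_const _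
  simpa using le_of_tendsto' hlim hle

/-- The tail of the Taylor series has small means, uniformly in the radius. -/
lemma circleAverage_tail_le {B : ℂ → ℂ} (hB : AnalyticOnNhd ℂ B (ball 0 1))
    (h1 : ∀ z ∈ ball (0 : ℂ) 1, ‖B z‖ ≤ 1) (N : ℕ) {r : ℝ} (hr : 0 < r) (hr1 : r < 1) :
    r ^ (2 * N) * Real.circleAverage (fun z => ‖taylorRem B N z‖ ^ 2) 0 r ≤
      ∑' k, ‖taylorRem B (k + N) 0‖ ^ 2 := by
  have hsum : Summable fun k => ‖taylorRem B (k + N) 0‖ ^ 2 :=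
    (summable_nat_add_iff N).mpr (summable_taylorRem hB h1)
  obtain ⟨s, hs, hs1⟩ := exists_between hr1
  have hs0 : 0 < s := hr.trans hs
  have hrs : r / s < 1 := (div_lt_one hs0).mpr hs
  have hq : (r / s) ^ 2 < 1 := by
    have : 0 ≤ r / s := by positivity
    nlinarith
  have hbd : ∀ m : ℕ, r ^ (2 * N) * Real.circleAverage (fun z => ‖taylorRem B N z‖ ^ 2) 0 r ≤
      ∑' k, ‖taylorRem B (k + N) 0‖ ^ 2 + ((r / s) ^ 2) ^ (N + m) := by
    intro m
    rw [circleAverage_eq_sum_add hB N m hr hr1]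
    have e1 : ∑ k ∈ Finset.range m, r ^ (2 * (N + k)) * ‖taylorRem B (N + k) 0‖ ^ 2 ≤
        ∑' k, ‖taylorRem B (k + N) 0‖ ^ 2 := by
      refine le_trans (Finset.sum_le_sum fun k _ => ?_)
        (hsum.sum_le_tsum (Finset.range m) fun k _ => by positivity)
      rw [add_comm N k]
      exact mul_le_of_le_one_left (by positivity) (pow_le_one₀ hr.le hr1.le)
    have e2 : r ^ (2 * (N + m)) * Real.circleAverage (fun z => ‖taylorRem B (N + m) z‖ ^ 2) 0 r ≤
        ((r / s) ^ 2) ^ (N + m) := by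
      have f1 := (subh_norm_sq (taylorRem_analytic hB (N + m))).circleAverage_mono hr hs.le hs1
      have f2 := pow_mul_circleAverage_le_one hB h1 (N + m) hs0 hs1
      have f3 : 0 ≤ ∑ k ∈ Finset.range (N + m), s ^ (2 * k) * ‖taylorRem B k 0‖ ^ 2 :=
        Finset.sum_nonneg fun k _ => by positivity
      have f4 : r ^ (2 * (N + m)) = ((r / s) ^ 2) ^ (N + m) * s ^ (2 * (N + m)) := by
        rw [← pow_mul, div_pow]; field_simp
      calc _ ≤ r ^ (2 * (N + m)) *
            Real.circleAverage (fun z => ‖taylorRem B (N + m) z‖ ^ 2) 0 s := by gcongr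
        _ = ((r / s) ^ 2) ^ (N + m) * (s ^ (2 * (N + m)) *
            Real.circleAverage (fun z => ‖taylorRem B (N + m) z‖ ^ 2) 0 s) := by rw [f4]; ring
        _ ≤ ((r / s) ^ 2) ^ (N + m) * 1 := by gcongr; linarith
        _ = _ := mul_one _
    linarith
  have hlim : Tendsto (fun m => ∑' k, ‖taylorRem B (k + N) 0‖ ^ 2 + ((r / s) ^ 2) ^ (N + m)) atTop
      (𝓝 (∑' k, ‖taylorRem B (k + N) 0‖ ^ 2 + 0)) := by
    refine Tendsto.const_add _ ?_
    have := tendsto_pow_atTop_nhds_zero_of_lt_one (by positivity) hq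
    refine ((tendsto_add_atTop_iff_nat N).mpr this).congr fun m => ?_
    rw [add_comm]
  simpa using ge_of_tendsto' hlim hbd

/-- Fatou's theorem on radial limits of bounded holomorphic functions. -/
lemma ae_exists_tendsto_of_bounded {B : ℂ → ℂ} (hB : AnalyticOnNhd ℂ B (ball 0 1))
    (h1 : ∀ z ∈ ball (0 : ℂ) 1, ‖B z‖ ≤ 1) :
    ∀ᵐ θ : ℝ, θ ∈ Ioo 0 (2 * Real.pi) → ∃ b, Tendsto (fun r : ℝ => B (circleMap 0 r θ))
      (𝓝[<] 1) (𝓝 b) := by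
  set P : ℕ → ℂ → ℂ := fun N z => ∑ k ∈ Finset.range N, taylorRem B k 0 * z ^ k with hP
  have hvol : ∀ N : ℕ, ∀ l : ℝ, 0 < l →
      volume {θ : ℝ | θ ∈ Ioo 0 (2 * Real.pi) ∧ ∃ r ∈ Ioo (1 / 2 : ℝ) 1,
        l < ‖B (circleMap 0 r θ) - P N (circleMap 0 r θ)‖ ^ 2} ≤
      ENNReal.ofReal (1000 * Real.pi / l * ∑' k, ‖taylorRem B (k + N) 0‖ ^ 2) := by
    intro N l hl
    have hA : AnalyticOnNhd ℂ (fun z => z ^ N * taylorRem B N z) (ball 0 1) :=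
      (analyticOnNhd_id.pow N).mul (taylorRem_analytic hB N)
    have hmean : ∀ r : ℝ, 0 < r → r < 1 →
        Real.circleAverage (fun z => ‖z ^ N * taylorRem B N z‖ ^ 2) 0 r ≤
        ∑' k, ‖taylorRem B (k + N) 0‖ ^ 2 := by
      intro r hr hr1
      refine le_of_eq_of_le ?_ (circleAverage_tail_le hB h1 N hr hr1)
      have e := Real.circleAverage_fun_smul (a := r ^ (2 * N))
        (f := fun z => ‖taylorRem B N z‖ ^ 2) (c := 0) (R := r)
      simp only [smul_eq_mul] at e
      rw [← e]
      refine Real.circleAverage_congr_sphere fun z hz => ?_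
      have hz' : ‖z‖ = r := by simpa [abs_of_pos hr] using hz
      rw [norm_mul, norm_pow, mul_pow, hz', ← pow_mul, mul_comm N 2]
    obtain ⟨F, hF, hle, hlim⟩ := (subh_norm_sq hA).exists_harmonic_majorant hmean
    have hF0 : (F 0).re ≤ ∑' k, ‖taylorRem B (k + N) 0‖ ^ 2 :=
      le_of_tendsto' hlim fun n => hmean _ (rad_pos n) (rad_lt_one n)
    have h2 := volume_radial_re_le hF (fun z hz => le_trans (by positivity) (hle z hz)) hl
    refine le_trans (measure_mono ?_) (h2.trans (ENNReal.ofReal_le_ofReal (by gcongr)))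
    rintro θ ⟨hθ, r, hr, hlt⟩
    refine ⟨hθ, r, hr, hlt.trans_le ?_⟩
    rw [taylorRem_sum]
    exact hle _ (circleMap_mem_unit_ball (by linarith [hr.1]) hr.2 θ)
  have hnull : ∀ j : ℕ, volume (⋂ N, {θ : ℝ | θ ∈ Ioo 0 (2 * Real.pi) ∧ ∃ r ∈ Ioo (1 / 2 : ℝ) 1,
      (1 / ((j : ℝ) + 1)) ^ 2 < ‖B (circleMap 0 r θ) - P N (circleMap 0 r θ)‖ ^ 2}) = 0 := by
    intro j
    have h2 : Tendsto (fun N => 1000 * Real.pi / (1 / ((j : ℝ) + 1)) ^ 2 *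
        ∑' k, ‖taylorRem B (k + N) 0‖ ^ 2) atTop (𝓝 0) := by
      have := (tendsto_sum_nat_add fun k => ‖taylorRem B k 0‖ ^ 2).const_mul
        (1000 * Real.pi / (1 / ((j : ℝ) + 1)) ^ 2)
      simpa using this
    exact measure_zero_of_le_ofReal h2 fun N => (measure_mono (iInter_subset _ N)).trans
      (hvol N _ (by positivity))
  have hall : ∀ᵐ θ : ℝ, ∀ j : ℕ, θ ∉ ⋂ N, {θ : ℝ | θ ∈ Ioo 0 (2 * Real.pi) ∧
      ∃ r ∈ Ioo (1 / 2 : ℝ) 1,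
      (1 / ((j : ℝ) + 1)) ^ 2 < ‖B (circleMap 0 r θ) - P N (circleMap 0 r θ)‖ ^ 2} :=
    ae_all_iff.mpr fun k => compl_mem_ae_iff.mpr (hnull k)
  filter_upwards [hall] with θ hθ hmem
  refine exists_tendsto_of_approx fun ε hε => ?_
  obtain ⟨j, hj⟩ := exists_nat_one_div_lt hε
  have hj' := hθ j
  simp only [mem_iInter, mem_ofPred_eq, not_forall, not_and, not_exists, not_lt] at hj'
  obtain ⟨N, hN⟩ := hj'
  refine ⟨fun r => P N (circleMap 0 r θ), P N (circleMap 0 1 θ), ?_, ?_⟩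
  · have : Continuous fun r : ℝ => P N (circleMap 0 r θ) := by
      simp only [hP, circleMap]
      fun_prop
    exact (this.tendsto 1).mono_left nhdsWithin_le_nhds
  · filter_upwards [eventually_mem_Ioo_one (R := 1 / 2) (by norm_num)] with r hr
    exact (le_of_sq_le_sq (hN hmem r hr) (by positivity)).trans hj.le

lemma ae_exists_tendsto_re {F : ℂ → ℂ} (hF : AnalyticOnNhd ℂ F (ball 0 1))
    (hle : ∀ z ∈ ball (0 : ℂ) 1, 0 ≤ (F z).re) :
    ∀ᵐ θ : ℝ, θ ∈ Ioo 0 (2 * Real.pi) → ∃ l, Tendsto (fun r : ℝ => (F (circleMap 0 r θ)).re)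
      (𝓝[<] 1) (𝓝 l) := by
  have hB : AnalyticOnNhd ℂ (fun z => Complex.exp (-F z)) (ball 0 1) := hF.neg.cexp
  have hn : ∀ z, ‖Complex.exp (-F z)‖ = Real.exp (-(F z).re) := fun z => by
    rw [Complex.norm_exp, Complex.neg_re]
  filter_upwards [ae_bdd_re hF hle, ae_exists_tendsto_of_bounded hB fun z hz => by
    rw [hn]; exact Real.exp_le_one_iff.mpr (by linarith [hle z hz])] with θ h1 h2 hθ
  obtain ⟨M, hM⟩ := h1 hθ
  obtain ⟨b, hb⟩ := h2 hθ
  have hb' := hb.norm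
  simp only [hn] at hb'
  have hb0 : Real.exp (-M) ≤ ‖b‖ := ge_of_tendsto hb' (hM.mono fun r hr =>
    Real.exp_le_exp.mpr (by linarith))
  refine ⟨-Real.log ‖b‖, ?_⟩
  have := (hb'.log ((Real.exp_pos _).trans_le hb0).ne').neg
  simpa using this

/-- Littlewood's theorem: radial limits of subharmonic functions with bounded means. -/
lemma Subh.ae_exists_tendsto {u : ℂ → ℝ} (hu : Subh u) {C : ℝ}
    (hC : ∀ r : ℝ, 0 < r → r < 1 → Real.circleAverage u 0 r ≤ C) :
    ∀ᵐ θ : ℝ, θ ∈ Ioo 0 (2 * Real.pi) → ∃ l, Tendsto (fun r : ℝ => u (circleMap 0 r θ))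
      (𝓝[<] 1) (𝓝 l) := by
  obtain ⟨F, hF, hle, hlim⟩ := hu.exists_harmonic_majorant hC
  filter_upwards [ae_tendsto_defect hu hF hle hlim,
    ae_exists_tendsto_re hF fun z hz => (hu.nonneg z hz).trans (hle z hz)] with θ h1 h2 hθ
  obtain ⟨l, hl⟩ := h2 hθ
  refine ⟨l, ?_⟩
  have := hl.sub (h1 hθ)
  simpa using this

lemma epos_coe (a : ℝ) : epos (a : EReal) = ENNReal.ofReal a := by
  simp [epos]

lemma epos_bot : epos ⊥ = 0 := by
  simp [epos]

lemma epos_top : epos ⊤ = ⊤ := by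
  simp [epos]

lemma continuous_epos : Continuous epos := by
  have h : epos = EReal.toENNReal := by
    funext x
    simp [epos, EReal.toENNReal]
  rw [h]
  exact EReal.continuous_toENNReal

lemma continuous_epos_add (k : ℕ) : Continuous fun x : EReal => epos (x + ((k : ℝ) : EReal)) := by
  refine continuous_epos.comp (continuous_iff_continuousAt.mpr fun x => ?_)
  exact (EReal.continuousAt_add (Or.inr (EReal.coe_ne_bot _)) (Or.inr (EReal.coe_ne_top _))).comp
    (f := fun x : EReal => (x, ((k : ℝ) : EReal))) (by fun_prop)

/-- Shifting by `k` moves the part of the negative part below `k` into the positive part. -/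
lemma epos_add_min (x : EReal) (k : ℕ) :
    epos (x + ((k : ℝ) : EReal)) + min (epos (-x)) (k : ℝ≥0∞) = k + epos x := by
  induction x with
  | bot => simp [epos_bot, epos_top]
  | top =>
    rw [EReal.top_add_coe]
    simp [epos_bot, epos_top]
  | coe a =>
    rw [← EReal.coe_add, ← EReal.coe_neg, epos_coe, epos_coe, epos_coe]
    have hk : (k : ℝ≥0∞) = ENNReal.ofReal k := by simp
    have hk0 : (0 : ℝ) ≤ k := by positivity
    rw [hk]
    rcases le_total 0 a with h | h
    · rw [ENNReal.ofReal_of_nonpos (by linarith : -a ≤ 0), ENNReal.ofReal_add h hk0]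
      simp [add_comm]
    · rw [ENNReal.ofReal_of_nonpos h, add_zero]
      rcases le_total (-a) k with h' | h'
      · rw [min_eq_left (ENNReal.ofReal_le_ofReal h'),
          ← ENNReal.ofReal_add (by linarith) (by linarith)]
        congr 1
        ring
      · rw [min_eq_right (ENNReal.ofReal_le_ofReal h'),
          ENNReal.ofReal_of_nonpos (by linarith), zero_add]

/-- The shifted truncation `max (φ + k) 0`. -/
noncomputable def trunc (φ : ℂ → EReal) (k : ℕ) (z : ℂ) : ℝ :=
  (epos (φ z + ((k : ℝ) : EReal))).toReal

section trunc

variable {φ : ℂ → EReal} {k : ℕ} {z : ℂ}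

lemma trunc_nonneg : 0 ≤ trunc φ k z := ENNReal.toReal_nonneg

lemma trunc_of_bot (h : φ z = ⊥) : trunc φ k z = 0 := by
  simp [trunc, h, epos_bot]

lemma trunc_of_coe {a : ℝ} (h : φ z = a) : trunc φ k z = max (a + k) 0 := by
  rw [trunc, h, ← EReal.coe_add, epos_coe, ENNReal.toReal_ofReal']

lemma ofReal_trunc (h : φ z < ⊤) :
    ENNReal.ofReal (trunc φ k z) = epos (φ z + ((k : ℝ) : EReal)) := by
  refine ENNReal.ofReal_toReal ?_
  generalize φ z = x at h
  induction x with
  | bot => simp [epos_bot]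
  | top => simp at h
  | coe a => rw [← EReal.coe_add, epos_coe]; exact ENNReal.ofReal_ne_top

lemma trunc_lt_iff (h : φ z < ⊤) {c : ℝ} (hc : 0 < c) :
    trunc φ k z < c ↔ φ z < ((c - k : ℝ) : EReal) := by
  rcases hx : φ z with _ | _ | a
  · rw [trunc_of_bot hx]
    exact ⟨fun _ => EReal.bot_lt_coe _, fun _ => hc⟩
  · exact absurd hx h.ne
  · have hx' : φ z = (a : EReal) := hx
    rw [trunc_of_coe hx']
    change _ ↔ (a : EReal) < _
    rw [EReal.coe_lt_coe_iff, max_lt_iff]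
    constructor
    · rintro ⟨h1, -⟩
      linarith
    · intro h1
      exact ⟨by linarith, hc⟩

lemma trunc_le (h : ℝ) (hz : φ z ≤ h) : trunc φ k z ≤ k + |h| := by
  have hk0 : (0 : ℝ) ≤ k := by positivity
  rcases hx : φ z with _ | _ | a
  · rw [trunc_of_bot hx]
    positivity
  · exact absurd hx (hz.trans_lt (EReal.coe_lt_top h)).ne
  · have hx' : φ z = (a : EReal) := hx
    rw [trunc_of_coe hx']
    rw [hx', EReal.coe_le_coe_iff] at hz
    exact max_le (by linarith [le_abs_self h]) (by positivity)

end trunc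

lemma lintegral_thetaM (g : ℝ → ℝ≥0∞) : ∫⁻ θ, g θ ∂thetaM =
    ENNReal.ofReal (2 * Real.pi)⁻¹ * ∫⁻ θ in Ioc 0 (2 * Real.pi), g θ := by
  rw [thetaM, lintegral_smul_measure, restrict_Ico_eq_restrict_Ioc, smul_eq_mul]

lemma lintegral_circle {u : ℂ → ℝ} {c : ℂ} {r : ℝ} (hu : CircleIntegrable u c r)
    (h0 : ∀ θ, 0 ≤ u (circleMap c r θ)) :
    ∫⁻ θ, ENNReal.ofReal (u (circleMap c r θ)) ∂thetaM =
      ENNReal.ofReal (Real.circleAverage u c r) := by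
  have h2 : (0 : ℝ) ≤ 2 * Real.pi := by positivity
  have hi : IntegrableOn (fun θ => u (circleMap c r θ)) (Ioc 0 (2 * Real.pi)) :=
    (intervalIntegrable_iff_integrableOn_Ioc_of_le h2).mp hu
  rw [lintegral_thetaM, Real.circleAverage_def, intervalIntegral.integral_of_le h2, smul_eq_mul,
    ENNReal.ofReal_mul (by positivity), ofReal_integral_eq_lintegral_ofReal hi
      (Eventually.of_forall h0)]

lemma lintegral_thetaM_const (c : ℝ≥0∞) : ∫⁻ _, c ∂thetaM = c := by
  rw [lintegral_thetaM, lintegral_const, Measure.restrict_apply MeasurableSet.univ, univ_inter,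
    Real.volume_Ioc, sub_zero, mul_left_comm, ← ENNReal.ofReal_mul (by positivity),
    inv_mul_cancel₀ (by positivity), ENNReal.ofReal_one, mul_one]

lemma ae_thetaM {P : ℝ → Prop} (h : ∀ᵐ θ : ℝ, θ ∈ Ioo 0 (2 * Real.pi) → P θ) :
    ∀ᵐ θ ∂thetaM, P θ := by
  refine Measure.ae_smul_measure ?_ _
  rw [← Measure.restrict_congr_set Ioo_ae_eq_Ico]
  exact (ae_restrict_iff' measurableSet_Ioo).mpr h

lemma measurable_usc_circle {φ : ℂ → EReal} (hφ : UpperSemicontinuousOn φ (ball 0 1)) {c : ℂ} {r : ℝ}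
    (hs : ∀ θ, circleMap c r θ ∈ ball (0 : ℂ) 1) : Measurable fun θ => φ (circleMap c r θ) := by
  refine UpperSemicontinuous.measurable ?_
  rw [← upperSemicontinuousOn_univ_iff]
  exact hφ.comp (continuous_circleMap c r).continuousOn fun θ _ => hs θ

lemma SubharmOn.subh_trunc {φ : ℂ → EReal} (hφ : SubharmOn φ (ball 0 1)) (k : ℕ) :
    Subh (trunc φ k) := by
  obtain ⟨husc, htop, hsub⟩ := hφ
  have hu : UpperSemicontinuousOn (trunc φ k) (ball 0 1) := by
    intro z hz c hc
    have hc0 : 0 < c := trunc_nonneg.trans_lt hc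
    filter_upwards [husc z hz _ ((trunc_lt_iff (htop z hz) hc0).mp hc), self_mem_nhdsWithin]
      with w hw hwb
    exact (trunc_lt_iff (htop w hwb) hc0).mpr hw
  refine ⟨fun z _ => trunc_nonneg, hu, fun z hz r hr hsubset => ?_⟩
  have hs : ∀ θ, circleMap z r θ ∈ ball (0 : ℂ) 1 := fun θ =>
    hsubset (sphere_subset_closedBall (circleMap_mem_sphere z hr.le θ))
  have hci : CircleIntegrable (trunc φ k) z r := usc_circleIntegrable hr.le
    (hu.mono (sphere_subset_closedBall.trans hsubset)) fun ζ _ => trunc_nonneg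
  have hav : 0 ≤ Real.circleAverage (trunc φ k) z r :=
    Real.circleAverage_nonneg_of_nonneg fun ζ _ => trunc_nonneg
  have hint : ∫⁻ θ, epos (φ (circleMap z r θ) + ((k : ℝ) : EReal)) ∂thetaM =
      ENNReal.ofReal (Real.circleAverage (trunc φ k) z r) := by
    rw [← lintegral_circle hci fun θ => trunc_nonneg]
    exact lintegral_congr fun θ => (ofReal_trunc (htop _ (hs θ))).symm
  have hmeas := measurable_usc_circle husc hs
  have hkey : (k : ℝ≥0∞) + ∫⁻ θ, epos (φ (circleMap z r θ)) ∂thetaM ≤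
      ENNReal.ofReal (Real.circleAverage (trunc φ k) z r) +
        ∫⁻ θ, epos (-φ (circleMap z r θ)) ∂thetaM := by
    have hmeas' : Measurable fun θ => epos (φ (circleMap z r θ) + ((k : ℝ) : EReal)) :=
      (continuous_epos_add k).measurable.comp hmeas
    rw [← hint, ← lintegral_add_left hmeas']
    nth_rewrite 1 [← lintegral_thetaM_const k]
    rw [← lintegral_add_left measurable_const]
    refine lintegral_mono fun θ => ?_
    dsimp only
    rw [← epos_add_min]
    gcongr
    exact min_le_left _ _
  have hz2 := hsub z hz r hr hsubset
  rw [eint] at hz2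
  rcases hx : φ z with _ | _ | a
  · rw [trunc_of_bot hx]
    exact hav
  · exact absurd hx (htop z hz).ne
  · have hx' : φ z = (a : EReal) := hx
    rw [hx'] at hz2
    rw [trunc_of_coe hx']
    refine max_le ?_ hav
    generalize (∫⁻ θ, epos (φ (circleMap z r θ)) ∂thetaM) = P at hz2 hkey
    generalize (∫⁻ θ, epos (-φ (circleMap z r θ)) ∂thetaM) = N at hz2 hkey
    have hN : N ≠ ⊤ := by
      rintro rfl
      simp at hz2
    have hP : P ≠ ⊤ := by
      rintro rfl
      have := hkey.trans_lt (ENNReal.add_lt_top.mpr ⟨ENNReal.ofReal_lt_top, hN.lt_top⟩)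
      simp at this
    lift N to NNReal using hN
    lift P to NNReal using hP
    rw [EReal.coe_nnreal_eq_coe_real, EReal.coe_nnreal_eq_coe_real] at hz2
    have h1 : a ≤ P - N := by exact_mod_cast hz2
    have h2 : (k : ℝ) + P ≤ Real.circleAverage (trunc φ k) z r + N := by
      have := ENNReal.toReal_mono (by simp) hkey
      rw [ENNReal.toReal_add (by simp) (by simp), ENNReal.toReal_add (by simp) (by simp),
        ENNReal.toReal_ofReal hav] at this
      simpa using this
    linarith

/-- Uniform integrability bound for truncations under an `L^p` bounded majorant. -/
lemma circleAverage_trunc_le {φ : ℂ → EReal} (hφ : SubharmOn φ (ball 0 1)) {h : ℂ → ℝ}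
    (hh : ContinuousOn h (ball 0 1)) (hmaj : ∀ z ∈ ball (0 : ℂ) 1, φ z ≤ (h z : EReal))
    {p : ℝ} (hp : 1 < p) {M : ℝ} {r : ℝ} (h0 : 0 < r) (h1 : r < 1)
    (hM : (∫ θ in (0 : ℝ)..(2 * Real.pi), |h (circleMap 0 r θ)| ^ p) ≤ M) (k : ℕ) {N : ℝ}
    (hN : 0 < N) :
    Real.circleAverage (trunc φ k) 0 r ≤
      Real.circleAverage (fun z => min (trunc φ k z) (k + N)) 0 r +
        N ^ (1 - p) * ((2 * Real.pi)⁻¹ * M) := by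
  have hs := sphere_subset_unit_ball h1
  have hsubh := hφ.subh_trunc k
  have hci := hsubh.circleIntegrable h0.le hs
  have hcm : CircleIntegrable (fun z => min (trunc φ k z) (k + N)) 0 r := by
    have h3 : IntegrableOn (fun _ : ℝ => (k : ℝ) + N) (uIoc 0 (2 * Real.pi)) volume := by
      simp [uIoc]
    exact intervalIntegrable_iff.mpr ((intervalIntegrable_iff.mp hci).inf h3)
  have hch : CircleIntegrable (fun z => |h z| ^ p) 0 r := by
    refine ContinuousOn.circleIntegrable h0.le ?_
    exact ((hh.mono hs).abs).rpow_const fun _ _ => Or.inr (by linarith)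
  have hch' : CircleIntegrable (fun z => N ^ (1 - p) * |h z| ^ p) 0 r :=
    IntervalIntegrable.const_mul hch _
  have hpt : ∀ z ∈ ball (0 : ℂ) 1, trunc φ k z ≤
      min (trunc φ k z) (k + N) + N ^ (1 - p) * |h z| ^ p := by
    intro z hz
    have ht := trunc_le (k := k) (h z) (hmaj z hz)
    rcases le_total (trunc φ k z) (k + N) with h2 | h2
    · rw [min_eq_left h2]
      have : 0 ≤ N ^ (1 - p) * |h z| ^ p := by positivity
      linarith
    · rw [min_eq_right h2]
      have hNh : N ≤ |h z| := by linarith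
      have hpos : 0 < |h z| := hN.trans_le hNh
      have h3 : |h z| ≤ N ^ (1 - p) * |h z| ^ p := by
        calc |h z| = |h z| ^ (1 - p) * |h z| ^ p := by
              rw [← Real.rpow_add hpos]
              simp
          _ ≤ _ := mul_le_mul_of_nonneg_right
              (Real.rpow_le_rpow_of_nonpos hN hNh (by linarith)) (by positivity)
      linarith
  calc Real.circleAverage (trunc φ k) 0 r
      ≤ Real.circleAverage (fun z => min (trunc φ k z) (k + N) + N ^ (1 - p) * |h z| ^ p) 0 r := by
        refine Real.circleAverage_mono hci (hcm.add hch') fun ζ hζ => hpt ζ ?_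
        rw [abs_of_pos h0] at hζ
        exact hs hζ
    _ = Real.circleAverage (fun z => min (trunc φ k z) (k + N)) 0 r +
        N ^ (1 - p) * Real.circleAverage (fun z => |h z| ^ p) 0 r := by
        rw [Real.circleAverage_fun_add hcm hch']
        congr 1
        exact Real.circleAverage_fun_smul (a := N ^ (1 - p)) (f := fun z => |h z| ^ p)
    _ ≤ _ := by
        have : Real.circleAverage (fun z => |h z| ^ p) 0 r ≤ (2 * Real.pi)⁻¹ * M := by
          rw [Real.circleAverage_def, smul_eq_mul]
          gcongr
        gcongr

lemma exists_tendsto_of_trunc {φ : ℂ → EReal} {γ : ℝ → ℂ} {F : Filter ℝ} [F.NeBot]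
    (hlt : ∀ᶠ r in F, φ (γ r) < ⊤)
    (hlim : ∀ k : ℕ, ∃ l, Tendsto (fun r => trunc φ k (γ r)) F (𝓝 l)) :
    ∃ l : EReal, Tendsto (fun r => φ (γ r)) F (𝓝 l) := by
  choose l hl using hlim
  have hl0 : ∀ k, 0 ≤ l k := fun k => ge_of_tendsto' (hl k) fun r => trunc_nonneg
  by_cases hpos : ∃ k, 0 < l k
  · obtain ⟨k, hk⟩ := hpos
    refine ⟨((l k - k : ℝ) : EReal), ?_⟩
    have h1 := (continuous_coe_real_ereal.tendsto _).comp ((hl k).sub_const (k : ℝ))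
    refine h1.congr' ?_
    filter_upwards [hlt, (hl k).eventually_const_lt hk] with r hr hr2
    rcases hx : φ (γ r) with _ | _ | a
    · rw [trunc_of_bot hx] at hr2
      exact absurd hr2 (lt_irrefl _)
    · exact absurd hx hr.ne
    · have hx' : φ (γ r) = (a : EReal) := hx
      have h3 : trunc φ k (γ r) = a + k := by
        rw [trunc_of_coe hx'] at hr2 ⊢
        rcases lt_max_iff.mp hr2 with h | h
        · exact max_eq_left h.le
        · exact absurd h (lt_irrefl _)
      simp only [Function.comp_apply, h3, add_sub_cancel_right]
      rfl
  · push Not at hpos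
    refine ⟨⊥, EReal.tendsto_nhds_bot_iff_real.mpr fun c => ?_⟩
    obtain ⟨k, hk⟩ := exists_nat_gt (1 - c)
    have hk0 : l k < 1 := (hpos k).trans_lt one_pos
    filter_upwards [hlt, (hl k).eventually_lt_const hk0] with r hr hr2
    refine ((trunc_lt_iff hr one_pos).mp hr2).trans ?_
    exact EReal.coe_lt_coe_iff.mpr (by linarith)

lemma ofReal_mul_circleMap_one (r θ : ℝ) : (r : ℂ) * circleMap 0 1 θ = circleMap 0 r θ := by
  simp [circleMap]

lemma tendsto_bvalE {g : ℂ → EReal} {ζ : ℂ}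
    (h : ∃ l : EReal, Tendsto (fun r : ℝ => g ((r : ℂ) * ζ)) (𝓝[<] (1 : ℝ)) (𝓝 l)) :
    Tendsto (fun r : ℝ => g ((r : ℂ) * ζ)) (𝓝[<] (1 : ℝ)) (𝓝 (bvalE g ζ)) := by
  rw [bvalE, dif_pos h]
  exact h.choose_spec

lemma tendsto_rad_left : Tendsto rad atTop (𝓝[<] 1) :=
  tendsto_nhdsWithin_iff.mpr ⟨tendsto_rad, Eventually.of_forall rad_lt_one⟩

lemma rad_lt_succ (n : ℕ) : rad n < rad (n + 1) := by
  have : (1 : ℝ) / ((n + 1 : ℕ) + 2) < 1 / (n + 2) := by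
    refine one_div_lt_one_div_of_lt (by positivity) ?_
    push_cast
    linarith
  unfold rad
  linarith

lemma circleMap_rad_mem (n : ℕ) (θ : ℝ) : circleMap 0 (rad n) θ ∈ ball (0 : ℂ) 1 :=
  circleMap_mem_unit_ball (rad_pos n).le (rad_lt_one n) θ

instance : IsFiniteMeasure thetaM := by
  refine ⟨?_⟩
  rw [← lintegral_one, lintegral_thetaM_const]
  exact ENNReal.one_lt_top

section boundary

variable {g : ℂ → EReal}

lemma ae_tendsto_bvalE_rad
    (hlim : ∀ᵐ θ ∂thetaM, ∃ l : EReal,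
      Tendsto (fun r : ℝ => g ((r : ℂ) * circleMap 0 1 θ)) (𝓝[<] (1 : ℝ)) (𝓝 l)) :
    ∀ᵐ θ ∂thetaM, Tendsto (fun n => g (circleMap 0 (rad n) θ)) atTop
      (𝓝 (bvalE g (circleMap 0 1 θ))) := by
  filter_upwards [hlim] with θ hθ
  have h1 := (tendsto_bvalE hθ).comp tendsto_rad_left
  refine h1.congr fun n => ?_
  rw [Function.comp_apply, ofReal_mul_circleMap_one]

lemma aemeasurable_bvalE (hg : UpperSemicontinuousOn g (ball 0 1))
    (hlim : ∀ᵐ θ ∂thetaM, ∃ l : EReal,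
      Tendsto (fun r : ℝ => g ((r : ℂ) * circleMap 0 1 θ)) (𝓝[<] (1 : ℝ)) (𝓝 l)) :
    AEMeasurable (fun θ => bvalE g (circleMap 0 1 θ)) thetaM :=
  aemeasurable_of_tendsto_metrizable_ae atTop
    (fun n => (measurable_usc_circle hg (circleMap_rad_mem n)).aemeasurable)
    (ae_tendsto_bvalE_rad hlim)

lemma lintegral_bvalE_le (hg : UpperSemicontinuousOn g (ball 0 1))
    (hlim : ∀ᵐ θ ∂thetaM, ∃ l : EReal,
      Tendsto (fun r : ℝ => g ((r : ℂ) * circleMap 0 1 θ)) (𝓝[<] (1 : ℝ)) (𝓝 l))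
    (k : ℕ) {c : ℝ≥0∞}
    (hc : ∀ n, ∫⁻ θ, epos (g (circleMap 0 (rad n) θ) + ((k : ℝ) : EReal)) ∂thetaM ≤ c) :
    ∫⁻ θ, epos (bvalE g (circleMap 0 1 θ) + ((k : ℝ) : EReal)) ∂thetaM ≤ c := by
  have hm : ∀ n, Measurable fun θ => epos (g (circleMap 0 (rad n) θ) + ((k : ℝ) : EReal)) :=
    fun n => (continuous_epos_add k).measurable.comp
      (measurable_usc_circle hg (circleMap_rad_mem n))
  calc ∫⁻ θ, epos (bvalE g (circleMap 0 1 θ) + ((k : ℝ) : EReal)) ∂thetaM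
      = ∫⁻ θ, liminf (fun n => epos (g (circleMap 0 (rad n) θ) + ((k : ℝ) : EReal))) atTop
          ∂thetaM := by
        refine lintegral_congr_ae ?_
        filter_upwards [ae_tendsto_bvalE_rad hlim] with θ hθ
        exact (((continuous_epos_add k).tendsto _).comp hθ).liminf_eq.symm
    _ ≤ liminf (fun n => ∫⁻ θ, epos (g (circleMap 0 (rad n) θ) + ((k : ℝ) : EReal)) ∂thetaM)
          atTop := lintegral_liminf_le hm
    _ ≤ c := by
        refine (liminf_le_liminf (Eventually.of_forall hc)).trans ?_
        rw [liminf_const]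

lemma lintegral_epos_rad (hg : SubharmOn g (ball 0 1)) (k n : ℕ) :
    ∫⁻ θ, epos (g (circleMap 0 (rad n) θ) + ((k : ℝ) : EReal)) ∂thetaM =
      ENNReal.ofReal (Real.circleAverage (trunc g k) 0 (rad n)) := by
  rw [← lintegral_circle ((hg.subh_trunc k).circleIntegrable (rad_pos n).le
    (sphere_subset_unit_ball (rad_lt_one n))) fun θ => trunc_nonneg]
  exact lintegral_congr fun θ => (ofReal_trunc (hg.2.1 _ (circleMap_rad_mem n θ))).symm

end boundary

lemma ae_exists_tendsto_of_subh_trunc {g : ℂ → EReal} (hlt : ∀ z ∈ ball (0 : ℂ) 1, g z < ⊤)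
    (hs : ∀ k, Subh (trunc g k))
    (hC : ∀ k, ∃ C, ∀ r : ℝ, 0 < r → r < 1 → Real.circleAverage (trunc g k) 0 r ≤ C) :
    ∀ᵐ θ ∂thetaM, ∃ l : EReal,
      Tendsto (fun r : ℝ => g ((r : ℂ) * circleMap 0 1 θ)) (𝓝[<] (1 : ℝ)) (𝓝 l) := by
  refine ae_thetaM ?_
  have h : ∀ k : ℕ, ∀ᵐ θ : ℝ, θ ∈ Ioo 0 (2 * Real.pi) →
      ∃ l, Tendsto (fun r : ℝ => trunc g k (circleMap 0 r θ)) (𝓝[<] 1) (𝓝 l) := fun k => by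
    obtain ⟨C, hC⟩ := hC k
    exact (hs k).ae_exists_tendsto hC
  filter_upwards [ae_all_iff.mpr h] with θ hθ hmem
  simp only [ofReal_mul_circleMap_one]
  refine exists_tendsto_of_trunc ?_ fun k => hθ k hmem
  filter_upwards [eventually_mem_Ioo_one (R := 0) one_pos] with r hr
  exact hlt _ (circleMap_mem_unit_ball hr.1.le hr.2 θ)

/-- The circular means are dominated by the boundary integral when the positive part is uniformly
integrable. -/
lemma circleAverage_trunc_le_lintegral {φ : ℂ → EReal} (hφ : SubharmOn φ (ball 0 1)) (k : ℕ)
    (hlim : ∀ᵐ θ ∂thetaM, ∃ l : EReal,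
      Tendsto (fun r : ℝ => φ ((r : ℂ) * circleMap 0 1 θ)) (𝓝[<] (1 : ℝ)) (𝓝 l))
    {e : ℕ → ℝ} (he : Tendsto e atTop (𝓝 0))
    (hui : ∀ N : ℕ, ∀ r : ℝ, 0 < r → r < 1 → Real.circleAverage (trunc φ k) 0 r ≤
      Real.circleAverage (fun z => min (trunc φ k z) (k + (N + 1))) 0 r + e N) (m : ℕ) :
    ENNReal.ofReal (Real.circleAverage (trunc φ k) 0 (rad m)) ≤
      ∫⁻ θ, epos (bvalE φ (circleMap 0 1 θ) + ((k : ℝ) : EReal)) ∂thetaM := by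
  set I := ∫⁻ θ, epos (bvalE φ (circleMap 0 1 θ) + ((k : ℝ) : EReal)) ∂thetaM with hI
  have hs := hφ.subh_trunc k
  have hN : ∀ N : ℕ, ENNReal.ofReal (Real.circleAverage (trunc φ k) 0 (rad m)) ≤
      I + ENNReal.ofReal (e N) := by
    intro N
    have hK : (0 : ℝ) ≤ k + (N + 1) := by positivity
    have hconv : Tendsto (fun n => ∫⁻ θ, min (epos (φ (circleMap 0 (rad n) θ) +
        ((k : ℝ) : EReal))) (ENNReal.ofReal (k + (N + 1))) ∂thetaM) atTop
        (𝓝 (∫⁻ θ, min (epos (bvalE φ (circleMap 0 1 θ) + ((k : ℝ) : EReal)))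
          (ENNReal.ofReal (k + (N + 1))) ∂thetaM)) := by
      refine tendsto_lintegral_of_dominated_convergence
        (fun _ => ENNReal.ofReal (k + (N + 1))) (fun n => ?_)
        (fun n => Eventually.of_forall fun θ => min_le_right _ _) ?_ ?_
      · have h1 : Measurable fun θ => epos (φ (circleMap 0 (rad n) θ) + ((k : ℝ) : EReal)) :=
          (continuous_epos_add k).measurable.comp
            (measurable_usc_circle hφ.1 (circleMap_rad_mem n))
        exact h1.min measurable_const
      · rw [lintegral_thetaM_const]
        exact ENNReal.ofReal_ne_top
      · filter_upwards [ae_tendsto_bvalE_rad hlim] with θ hθ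
        exact (((continuous_epos_add k).tendsto _).comp hθ).min tendsto_const_nhds
    have hle : ∀ n, m ≤ n → ENNReal.ofReal (Real.circleAverage (trunc φ k) 0 (rad m)) ≤
        (∫⁻ θ, min (epos (φ (circleMap 0 (rad n) θ) +
        ((k : ℝ) : EReal))) (ENNReal.ofReal (k + (N + 1))) ∂thetaM) + ENNReal.ofReal (e N) := by
      intro n hmn
      have hci := hs.circleIntegrable (rad_pos n).le (sphere_subset_unit_ball (rad_lt_one n))
      have hcm : CircleIntegrable (fun z => min (trunc φ k z) (k + (N + 1))) 0 (rad n) := by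
        have h3 : IntegrableOn (fun _ : ℝ => (k : ℝ) + (N + 1)) (uIoc 0 (2 * Real.pi)) volume := by
          simp [uIoc]
        exact intervalIntegrable_iff.mpr ((intervalIntegrable_iff.mp hci).inf h3)
      have h1 := hs.circleAverage_mono (rad_pos m) (rad_mono hmn) (rad_lt_one n)
      have h2 := h1.trans (hui N _ (rad_pos n) (rad_lt_one n))
      refine (ENNReal.ofReal_le_ofReal h2).trans (ENNReal.ofReal_add_le.trans ?_)
      rw [← lintegral_circle hcm fun θ => le_min trunc_nonneg hK]
      gcongr with θ
      rw [ENNReal.ofReal_min, ofReal_trunc (hφ.2.1 _ (circleMap_rad_mem n θ))]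
    have h3 := ge_of_tendsto (hconv.add_const (ENNReal.ofReal (e N)))
      (eventually_atTop.mpr ⟨m, hle⟩)
    exact h3.trans (add_le_add (lintegral_mono fun θ => min_le_left _ _) le_rfl)
  have h4 : Tendsto (fun N => I + ENNReal.ofReal (e N)) atTop (𝓝 (I + 0)) := by
    refine tendsto_const_nhds.add ?_
    simpa using ENNReal.tendsto_ofReal he
  rw [add_zero] at h4
  exact ge_of_tendsto' h4 hN

lemma eint_le_eint {α : Type*} [MeasurableSpace α] {μ : Measure α} (hμ : μ univ = 1)
    {A B : α → EReal} (hA : AEMeasurable A μ)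
    (hB : AEMeasurable B μ) (hfin : ∫⁻ x, epos (B x) ∂μ ≠ ⊤)
    (hle : ∀ k : ℕ, ∫⁻ x, epos (A x + ((k : ℝ) : EReal)) ∂μ ≤
      ∫⁻ x, epos (B x + ((k : ℝ) : EReal)) ∂μ) : eint μ A ≤ eint μ B := by
  have hneg : Measurable fun x : EReal => epos (-x) :=
    (continuous_epos.comp continuous_neg).measurable
  have hsum : ∀ {G : α → EReal}, AEMeasurable G μ → ∀ k : ℕ,
      ∫⁻ x, epos (G x + ((k : ℝ) : EReal)) ∂μ + ∫⁻ x, min (epos (-G x)) k ∂μ =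
        k + ∫⁻ x, epos (G x) ∂μ := by
    intro G hG k
    have h1 : AEMeasurable (fun x => epos (G x + ((k : ℝ) : EReal))) μ :=
      (continuous_epos_add k).measurable.comp_aemeasurable hG
    rw [← lintegral_add_left' h1]
    simp only [epos_add_min]
    rw [lintegral_add_left measurable_const, lintegral_const, hμ, mul_one]
  have hfinA : ∫⁻ x, epos (A x) ∂μ ≠ ⊤ := by
    have := hle 0
    simp only [Nat.cast_zero, EReal.coe_zero, add_zero] at this
    exact ne_top_of_le_ne_top hfin this
  have hk : ∀ k : ℕ, ∫⁻ x, epos (A x) ∂μ + ∫⁻ x, min (epos (-B x)) k ∂μ ≤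
      ∫⁻ x, epos (B x) ∂μ + ∫⁻ x, epos (-A x) ∂μ := by
    intro k
    have hminA : ∫⁻ x, min (epos (-A x)) k ∂μ ≤ ∫⁻ x, epos (-A x) ∂μ :=
      lintegral_mono fun x => min_le_left _ _
    have hBfin : ∫⁻ x, epos (B x + ((k : ℝ) : EReal)) ∂μ ≠ ⊤ := by
      refine ne_top_of_le_ne_top ?_ (le_self_add.trans (hsum hB k).le)
      exact ENNReal.add_ne_top.mpr ⟨by simp, hfin⟩
    have h1 : (k : ℝ≥0∞) + ∫⁻ x, epos (A x) ∂μ ≤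
        ∫⁻ x, epos (B x + ((k : ℝ) : EReal)) ∂μ + ∫⁻ x, epos (-A x) ∂μ := by
      rw [← hsum hA k]
      exact add_le_add (hle k) hminA
    have h2 := hsum hB k
    have hkfin : (k : ℝ≥0∞) ≠ ⊤ := by simp
    rw [← ENNReal.add_le_add_iff_left hkfin, ← add_assoc, ← add_assoc, ← h2]
    calc _ ≤ _ := add_le_add_left h1 _
      _ = _ := by ring
  have hsup : Tendsto (fun k : ℕ => ∫⁻ x, min (epos (-B x)) k ∂μ) atTop
      (𝓝 (∫⁻ x, epos (-B x) ∂μ)) := by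
    refine lintegral_tendsto_of_tendsto_of_monotone
      (fun k => (hneg.comp_aemeasurable hB).min aemeasurable_const) ?_ ?_
    · refine Eventually.of_forall fun x k l hkl => ?_
      dsimp only
      gcongr
    · refine Eventually.of_forall fun x => ?_
      have := (tendsto_const_nhds (x := epos (-B x))).min ENNReal.tendsto_nat_nhds_top
      simpa using this
  have hfinal := le_of_tendsto' (tendsto_const_nhds.add hsup) hk
  rw [eint, eint]
  generalize (∫⁻ x, epos (A x) ∂μ) = PA at *
  generalize (∫⁻ x, epos (B x) ∂μ) = PB at *
  generalize (∫⁻ x, epos (-A x) ∂μ) = NA at *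
  generalize (∫⁻ x, epos (-B x) ∂μ) = NB at *
  lift PA to NNReal using hfinA
  lift PB to NNReal using hfin
  by_cases hNA : NA = ⊤
  · rw [hNA]
    simp [EReal.coe_nnreal_eq_coe_real]
  · have hNB : NB ≠ ⊤ := by
      rintro rfl
      rw [add_top, top_le_iff, ENNReal.add_eq_top] at hfinal
      simp [hNA] at hfinal
    lift NA to NNReal using hNA
    lift NB to NNReal using hNB
    have h5 : (PA : ℝ) + NB ≤ PB + NA := by exact_mod_cast hfinal
    simp only [EReal.coe_nnreal_eq_coe_real]
    rw [← EReal.coe_sub, ← EReal.coe_sub, EReal.coe_le_coe_iff]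
    linarith

/-- The Littlewood subordination principle (Theorem 3.2). -/
theorem stmt_3 (φ : ℂ → EReal) (hφ : SubharmOn φ (ball 0 1))
    (hne : ∃ z ∈ ball (0 : ℂ) 1, φ z ≠ ⊥)
    (h : ℂ → ℝ) (hh : HarmOn h (ball 0 1))
    (hmaj : ∀ z ∈ ball (0 : ℂ) 1, φ z ≤ (h z : EReal))
    (p : ℝ) (hp : 1 < p)
    (hLp : ∃ M : ℝ, ∀ r : ℝ, 0 < r → r < 1 →
      (∫ θ in (0 : ℝ)..(2 * Real.pi), |h (circleMap 0 r θ)| ^ p) ≤ M)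
    (f : ℂ → ℂ) (hf : DifferentiableOn ℂ f (ball 0 1))
    (hmap : MapsTo f (ball 0 1) (ball 0 1)) (hf0 : f 0 = 0) :
    (∀ᵐ θ ∂thetaM, ∃ l : EReal,
      Tendsto (fun r : ℝ => φ (f ((r : ℂ) * circleMap 0 1 θ))) (𝓝[<] (1 : ℝ)) (𝓝 l)) ∧
    eint thetaM (fun θ => bvalE (fun ζ => φ (f ζ)) (circleMap 0 1 θ)) ≤
      eint thetaM (fun θ => bvalE φ (circleMap 0 1 θ)) := by
  obtain ⟨M, hM⟩ := hLp
  have hs := fun k => hφ.subh_trunc k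
  have hui : ∀ (k N : ℕ) (r : ℝ), 0 < r → r < 1 → Real.circleAverage (trunc φ k) 0 r ≤
      Real.circleAverage (fun z => min (trunc φ k z) (k + (N + 1))) 0 r +
        ((N : ℝ) + 1) ^ (1 - p) * ((2 * Real.pi)⁻¹ * M) := fun k N r h0 h1 =>
    circleAverage_trunc_le hφ hh.1 hmaj hp h0 h1 (hM r h0 h1) k (by positivity)
  have hC : ∀ k, ∃ C, ∀ r : ℝ, 0 < r → r < 1 → Real.circleAverage (trunc φ k) 0 r ≤ C := by
    intro k
    refine ⟨(k + 1) + (2 * Real.pi)⁻¹ * M, fun r h0 h1 => ?_⟩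
    have h2 := hui k 0 r h0 h1
    have h3 : Real.circleAverage (fun z => min (trunc φ k z) (k + ((0 : ℕ) + 1))) 0 r ≤ k + 1 := by
      refine Real.circleAverage_mono_on_of_le_circle ?_ fun z _ => ?_
      · have h4 := (hs k).circleIntegrable h0.le (sphere_subset_unit_ball h1)
        have h5 : IntegrableOn (fun _ : ℝ => (k : ℝ) + ((0 : ℕ) + 1)) (uIoc 0 (2 * Real.pi))
            volume := by
          simp [uIoc]
        exact intervalIntegrable_iff.mpr ((intervalIntegrable_iff.mp h4).inf h5)
      · simp
    simp only [Nat.cast_zero, zero_add, Real.one_rpow, one_mul] at h2 h3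
    linarith
  have hsub : ∀ (k : ℕ) (r R : ℝ), 0 < r → r < R → R < 1 →
      Real.circleAverage (trunc (fun ζ => φ (f ζ)) k) 0 r ≤ Real.circleAverage (trunc φ k) 0 R :=
    fun k r R h0 h1 h2 => (hs k).circleAverage_comp_le hf hmap hf0 h0 h1 h2
  have hCf : ∀ k, ∃ C, ∀ r : ℝ, 0 < r → r < 1 →
      Real.circleAverage (trunc (fun ζ => φ (f ζ)) k) 0 r ≤ C := by
    intro k
    obtain ⟨C, hC⟩ := hC k
    exact ⟨C, fun r h0 h1 => (hsub k r ((r + 1) / 2) h0 (by linarith) (by linarith)).trans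
      (hC _ (by linarith) (by linarith))⟩
  have hsf : ∀ k, Subh (trunc (fun ζ => φ (f ζ)) k) := fun k => (hs k).comp hf hmap
  have hlimφ := ae_exists_tendsto_of_subh_trunc hφ.2.1 hs hC
  have hlimf := ae_exists_tendsto_of_subh_trunc (g := fun ζ => φ (f ζ))
    (fun z hz => hφ.2.1 _ (hmap hz)) hsf hCf
  refine ⟨hlimf, ?_⟩
  have huscf : UpperSemicontinuousOn (fun ζ => φ (f ζ)) (ball 0 1) :=
    hφ.1.comp hf.continuousOn hmap
  have he : Tendsto (fun N : ℕ => ((N : ℝ) + 1) ^ (1 - p) * ((2 * Real.pi)⁻¹ * M)) atTop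
      (𝓝 0) := by
    have h1 : Tendsto (fun N : ℕ => (N : ℝ) + 1) atTop atTop :=
      tendsto_atTop_add_const_right _ _ tendsto_natCast_atTop_atTop
    have h2 := (tendsto_rpow_neg_atTop (by linarith : 0 < p - 1)).comp h1
    have h3 := h2.mul_const ((2 * Real.pi)⁻¹ * M)
    simpa [Function.comp_def] using h3
  have hupper := fun k m => circleAverage_trunc_le_lintegral hφ k hlimφ he (hui k) m
  refine eint_le_eint ?_ (aemeasurable_bvalE huscf hlimf) (aemeasurable_bvalE hφ.1 hlimφ) ?_ ?_
  · rw [← lintegral_one, lintegral_thetaM_const]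
  · obtain ⟨C, hC⟩ := hC 0
    have h1 := lintegral_bvalE_le hφ.1 hlimφ 0 (c := ENNReal.ofReal C) fun n => by
      rw [lintegral_epos_rad hφ]
      exact ENNReal.ofReal_le_ofReal (hC _ (rad_pos n) (rad_lt_one n))
    simp only [Nat.cast_zero, EReal.coe_zero, add_zero] at h1
    exact ne_top_of_le_ne_top ENNReal.ofReal_ne_top h1
  · intro k
    refine lintegral_bvalE_le huscf hlimf k fun n => ?_
    refine le_trans (le_of_eq ?_) ((ENNReal.ofReal_le_ofReal
      (hsub k (rad n) (rad (n + 1)) (rad_pos n) (rad_lt_succ n) (rad_lt_one _))).trans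
      (hupper k (n + 1)))
    rw [← lintegral_circle ((hsf k).circleIntegrable (rad_pos n).le
      (sphere_subset_unit_ball (rad_lt_one n))) fun θ => trunc_nonneg]
    exact lintegral_congr fun θ => (ofReal_trunc (φ := fun ζ => φ (f ζ))
      (hφ.2.1 _ (hmap (circleMap_rad_mem n θ)))).symm
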